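/- Let (s,u) be a solution of problem (P) with initial data (s₀,φ) ∈ W, and let T_m denote its maximal existence time. If T_m < ∞, then lim_{t↗T_m} E(s(t),u(t)) = −∞. -/

import Mathlib

open Set MeasureTheory Filter Topology Real
open scoped ENNReal

noncomputable section

/-- `(s₀, φ)` belongs to the class `W`: `s₀ ∈ (0,∞)`, `φ` is Lipschitz on `[0,s₀]`,
not identically zero, nonnegative there, and vanishes at `s₀`. -/
def memW (s₀ : ℝ) (φ : ℝ → ℝ) : Prop :=
  0 < s₀ ∧ (∃ K : NNReal, LipschitzOnWith K φ (Icc 0 s₀)) ∧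
    (∃ x ∈ Icc 0 s₀, φ x ≠ 0) ∧ (∀ x ∈ Icc 0 s₀, 0 ≤ φ x) ∧ φ s₀ = 0

/-- `(s,u)` is a solution of the one-phase Stefan problem (P) on `(0,T]` (finite `T`)
with exponent `p` and initial data `(s₀,φ)`. -/
structure IsSolOn (p s₀ : ℝ) (φ : ℝ → ℝ) (T : ℝ) (s : ℝ → ℝ) (u : ℝ → ℝ → ℝ) : Prop where
  T_pos : 0 < T
  s_cont : ContinuousOn s (Icc 0 T)
  s_diff : ∀ t ∈ Ioc 0 T, DifferentiableAt ℝ s t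
  s_deriv_cont : ContinuousOn (deriv s) (Ioc 0 T)
  s_pos : ∀ t ∈ Icc 0 T, 0 < s t
  ut_diff : ∀ t ∈ Ioc 0 T, ∀ x ∈ Ioo 0 (s t), DifferentiableAt ℝ (fun τ => u τ x) t
  ux_diff : ∀ t ∈ Ioc 0 T, ∀ x ∈ Ioo 0 (s t), DifferentiableAt ℝ (u t) x
  uxx_diff : ∀ t ∈ Ioc 0 T, ∀ x ∈ Ioo 0 (s t), DifferentiableAt ℝ (deriv (u t)) x
  ut_cont : ContinuousOn (fun q : ℝ × ℝ => deriv (fun τ => u τ q.2) q.1)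
      {q : ℝ × ℝ | q.1 ∈ Ioc 0 T ∧ q.2 ∈ Ioo 0 (s q.1)}
  uxx_cont : ContinuousOn (fun q : ℝ × ℝ => deriv (deriv (u q.1)) q.2)
      {q : ℝ × ℝ | q.1 ∈ Ioc 0 T ∧ q.2 ∈ Ioo 0 (s q.1)}
  ux_cont : ContinuousOn (fun q : ℝ × ℝ => deriv (u q.1) q.2)
      {q : ℝ × ℝ | q.1 ∈ Ioc 0 T ∧ q.2 ∈ Icc 0 (s q.1)}
  u_cont : ContinuousOn (fun q : ℝ × ℝ => u q.1 q.2)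
      {q : ℝ × ℝ | q.1 ∈ Icc 0 T ∧ q.2 ∈ Icc 0 (s q.1)}
  u_nonneg : ∀ t ∈ Icc 0 T, ∀ x ∈ Icc 0 (s t), 0 ≤ u t x
  heat : ∀ t ∈ Ioc 0 T, ∀ x ∈ Ioo 0 (s t),
      deriv (fun τ => u τ x) t = deriv (deriv (u t)) x
  bc_zero : ∀ t ∈ Ioc 0 T, -deriv (u t) 0 = u t 0 ^ p
  bc_free : ∀ t ∈ Ioc 0 T, u t (s t) = 0
  stefan : ∀ t ∈ Ioc 0 T, deriv s t = -deriv (u t) (s t)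
  init : ∀ x ∈ Icc 0 s₀, u 0 x = φ x
  init_s : s 0 = s₀

/-- `(s,u)` is a global-in-time solution of problem (P). -/
def IsGlobalSol (p s₀ : ℝ) (φ : ℝ → ℝ) (s : ℝ → ℝ) (u : ℝ → ℝ → ℝ) : Prop :=
  ∀ T : ℝ, 0 < T → IsSolOn p s₀ φ T s u

/-- `Tm ∈ (0,∞]` is the maximal existence time of the solution `(s,u)` of (P) with
initial data `(s₀,φ)`: the solution exists on `(0,T]` for every `T < Tm`, and for
`T > Tm` problem (P) admits no solution on `(0,T]`. -/
def IsMaxSol (p s₀ : ℝ) (φ : ℝ → ℝ) (Tm : ℝ≥0∞) (s : ℝ → ℝ) (u : ℝ → ℝ → ℝ) : Prop :=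
  0 < Tm ∧
    (∀ T : ℝ, 0 < T → ENNReal.ofReal T < Tm → IsSolOn p s₀ φ T s u) ∧
    (∀ T : ℝ, Tm < ENNReal.ofReal T → ¬∃ σ v, IsSolOn p s₀ φ T σ v)

/-- The sup norm `‖u(t)‖_{L^∞(0,s(t))}`. -/
def supNorm (s : ℝ → ℝ) (u : ℝ → ℝ → ℝ) (t : ℝ) : ℝ :=
  sSup (u t '' Ioo 0 (s t))

/-- The `L¹` norm `‖u(t)‖_{L¹(0,s(t))}` of the nonnegative function `u(t,·)`. -/
def L1Norm (s : ℝ → ℝ) (u : ℝ → ℝ → ℝ) (t : ℝ) : ℝ :=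
  ∫ x in (0:ℝ)..(s t), u t x

/-- The energy `E(s(t),u(t))`. -/
def energy (p : ℝ) (s : ℝ → ℝ) (u : ℝ → ℝ → ℝ) (t : ℝ) : ℝ :=
  1 / 2 * (∫ x in (0:ℝ)..(s t), (deriv (u t) x) ^ 2) - u t 0 ^ (p + 1) / (p + 1)

notation "RF" => ℝ → ℝ
notation "RG" => ℝ → ℝ → ℝ
notation "RP" => ℝ × ℝ
notation "fpp" => (by fun_prop)
notation "lnn" => (by linarith)
notation "psv" => (by positivity)
open intervalIntegral renaming integral_sub → isub, integral_const_mul → icm, integral_add → iadd, integral_of_le → iole, integral_interval_sub_left → iisl, continuous_parametric_intervalIntegral_of_continuous' → cpi', integral_hasDerivAt_right → ihd, integral_congr → icon, integral_nonneg → inn, integral_eq_sub_of_hasDerivAt → ftc, continuous_parametric_intervalIntegral_of_continuous → cpi, norm_integral_le_of_norm_le_const → nil, integral_const → icst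

def hk (r y : ℝ) : ℝ := (√(4 * π * r))⁻¹ * exp (-y ^ 2 / (4 * r))
def hk1 (r y : ℝ) : ℝ := -(y / (2 * r)) * hk r y
def hk2 (r y : ℝ) : ℝ := (y ^ 2 / (4 * r ^ 2) - 1 / (2 * r)) * hk r y

lemma hk_nonneg (r y : ℝ) : 0 ≤ hk r y := by unfold hk; positivity

lemma hk_of_nonpos {r : ℝ} (h : r ≤ 0) (y : ℝ) : hk r y = 0 := by
  unfold hk
  rw [sqrt_eq_zero_of_nonpos (by nlinarith [pi_pos])]; simp

lemma hk1_of_nonpos {r : ℝ} (h : r ≤ 0) (y : ℝ) : hk1 r y = 0 := by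
  simp [hk1, hk_of_nonpos h]

lemma hk2_of_nonpos {r : ℝ} (h : r ≤ 0) (y : ℝ) : hk2 r y = 0 := by
  simp [hk2, hk_of_nonpos h]

lemma hk_neg (r y : ℝ) : hk r (-y) = hk r y := by simp [hk]
lemma hk1_neg (r y : ℝ) : hk1 r (-y) = -hk1 r y := by simp [hk1, hk_neg]; ring

lemma four_pi_sqrt_inv_le (r : ℝ) (c : ℝ) (hc : 1 ≤ c) : (√(c * r))⁻¹ ≤ (√r)⁻¹ := by
  rcases le_or_gt r 0 with h | h
  · rw [sqrt_eq_zero_of_nonpos (by nlinarith), sqrt_eq_zero_of_nonpos h]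
  · exact inv_anti₀ (sqrt_pos.2 h) (sqrt_le_sqrt (by nlinarith))

lemma hk_le_exp (r y : ℝ) : hk r y ≤ (√r)⁻¹ * exp (-y ^ 2 / (4 * r)) := by
  unfold hk
  gcongr ?_ * _
  exact four_pi_sqrt_inv_le r _ (by nlinarith [Real.pi_gt_three])

lemma hk_le (r y : ℝ) : hk r y ≤ (√r)⁻¹ := by
  rcases le_or_gt r 0 with h | h
  · rw [hk_of_nonpos h]; positivity
  · refine (hk_le_exp r y).trans (mul_le_of_le_one_right psv ?_)
    rw [Real.exp_le_one_iff, neg_div]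
    have : 0 ≤ y ^ 2 / (4 * r) := by positivity
    linarith

lemma exp_neg_le_fac {z : ℝ} (hz : 0 < z) (n : ℕ) : exp (-z) ≤ n.factorial / z ^ n := by
  have h := Real.pow_div_factorial_le_exp z hz.le n
  rw [Real.exp_neg]
  have h2 : (0 : ℝ) < z ^ n / n.factorial := by positivity
  calc (exp z)⁻¹ ≤ (z ^ n / n.factorial)⁻¹ := inv_anti₀ h2 h
    _ = _ := by rw [inv_div]

lemma hk_le_far {r y : ℝ} (hr : 0 < r) (hy : y ≠ 0) (n : ℕ) :
    hk r y ≤ (√r)⁻¹ * (n.factorial * (4 * r) ^ n / (y ^ 2) ^ n) := by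
  refine (hk_le_exp r y).trans ?_
  gcongr
  have h : 0 < y ^ 2 / (4 * r) := by positivity
  have := exp_neg_le_fac h n
  rw [neg_div]
  refine this.trans (le_of_eq ?_)
  rw [div_pow]; field_simp

lemma hk_far (r : ℝ) {y : ℝ} (hy : y ≠ 0) : hk r y ≤ 32 * (r * √r / y ^ 4) := by
  rcases le_or_gt r 0 with h | h
  · rw [hk_of_nonpos h, sqrt_eq_zero_of_nonpos h]; simp
  · refine (hk_le_far h hy 2).trans (le_of_eq ?_)
    have h1 : (√r) ^ 2 = r := sq_sqrt h.le
    have h2 : 0 < √r := sqrt_pos.2 h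
    simp only [Nat.factorial]
    field_simp
    push_cast
    linear_combination (-32) * h1

lemma hk1_far (r : ℝ) {y : ℝ} (hy : y ≠ 0) : |hk1 r y| ≤ 16 * (√r / |y| ^ 3) := by
  rcases le_or_gt r 0 with h | h
  · rw [hk1_of_nonpos h, sqrt_eq_zero_of_nonpos h]; simp
  · have h0 := hk_far r hy
    have hy' : 0 < |y| := abs_pos.2 hy
    rw [hk1, abs_mul, abs_neg, abs_div, abs_of_nonneg (hk_nonneg r y),
      abs_of_pos (by positivity : 0 < 2 * r)]
    calc |y| / (2 * r) * hk r y ≤ |y| / (2 * r) * (32 * (r * √r / y ^ 4)) := by gcongr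
      _ = _ := by
        rw [show y ^ 4 = |y| ^ 4 by rw [pow_abs, abs_of_nonneg psv]]
        field_simp; ring

lemma hk2_far (r : ℝ) {y : ℝ} (hy : y ≠ 0) : |hk2 r y| ≤ 112 * (√r / y ^ 4) := by
  rcases le_or_gt r 0 with h | h
  · rw [hk2_of_nonpos h, sqrt_eq_zero_of_nonpos h]; simp
  · have h0 := hk_far r hy
    have h3 := hk_le_far h hy 3
    have h1 : (√r) ^ 2 = r := sq_sqrt h.le
    have h2 : 0 < √r := sqrt_pos.2 h
    rw [hk2, abs_mul, abs_of_nonneg (hk_nonneg r y)]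
    calc |y ^ 2 / (4 * r ^ 2) - 1 / (2 * r)| * hk r y
        ≤ (y ^ 2 / (4 * r ^ 2) + 1 / (2 * r)) * hk r y := by
          gcongr
          · exact hk_nonneg r y
          · rw [abs_le]; constructor
            · have : 0 ≤ y ^ 2 / (4 * r ^ 2) := by positivity
              linarith
            · have : 0 ≤ 1 / (2 * r) := by positivity
              linarith
      _ = y ^ 2 / (4 * r ^ 2) * hk r y + 1 / (2 * r) * hk r y := by ring
      _ ≤ y ^ 2 / (4 * r ^ 2) * ((√r)⁻¹ * (Nat.factorial 3 * (4 * r) ^ 3 / (y ^ 2) ^ 3))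
          + 1 / (2 * r) * (32 * (r * √r / y ^ 4)) := by gcongr
      _ = _ := by
        simp only [Nat.factorial]
        field_simp
        push_cast
        linear_combination (-192) * h1

lemma abs_mul_exp_le (z : ℝ) : |z| * exp (-z ^ 2) ≤ 1 := by
  have := Real.add_one_le_exp (z ^ 2)
  rw [Real.exp_neg, ← div_eq_mul_inv, div_le_one (exp_pos _)]
  nlinarith [sq_nonneg (|z| - 1), sq_abs z]

lemma exp_rew {r : ℝ} (h : 0 < r) (y : ℝ) : -y ^ 2 / (4 * r) = -(y / (2 * √r)) ^ 2 := by
  rw [div_pow, mul_pow, sq_sqrt h.le]; ring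

lemma hk1_le (r y : ℝ) : |hk1 r y| ≤ 1 / |r| := by
  rcases le_or_gt r 0 with h | h
  · rw [hk1_of_nonpos h]; simp
  · have h2 : 0 < √r := sqrt_pos.2 h
    have h1 : (√r) ^ 2 = r := sq_sqrt h.le
    have h0 := hk_le_exp r y
    rw [exp_rew h] at h0
    have h3 := abs_mul_exp_le (y / (2 * √r))
    rw [hk1, abs_mul, abs_neg, abs_div, abs_of_nonneg (hk_nonneg r y),
      abs_of_pos (by positivity : 0 < 2 * r), abs_of_pos h]
    rw [abs_div, abs_of_pos (by positivity : 0 < 2 * √r)] at h3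
    calc |y| / (2 * r) * hk r y ≤ |y| / (2 * r) * ((√r)⁻¹ * exp (-(y / (2 * √r)) ^ 2)) := by gcongr
      _ = (1 / r) * (|y| / (2 * √r) * exp (-(y / (2 * √r)) ^ 2)) := by field_simp
      _ ≤ (1 / r) * 1 := by gcongr
      _ = _ := by ring

lemma hk1_le' (r y : ℝ) : |hk1 r y| ≤ |y| * (|r| * √r)⁻¹ := by
  rcases le_or_gt r 0 with h | h
  · rw [hk1_of_nonpos h]; simp; positivity
  · rw [hk1, abs_mul, abs_neg, abs_div, abs_of_nonneg (hk_nonneg r y),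
      abs_of_pos (by positivity : 0 < 2 * r), abs_of_pos h]
    calc |y| / (2 * r) * hk r y ≤ |y| / (1 * r) * (√r)⁻¹ := by
          gcongr
          · exact hk_nonneg r y
          · norm_num
          · exact hk_le r y
      _ = _ := by rw [mul_inv]; ring

lemma hk2_le (r y : ℝ) : |hk2 r y| ≤ (|r| * √r)⁻¹ := by
  rcases le_or_gt r 0 with h | h
  · rw [hk2_of_nonpos h]; simp; positivity
  · have h2 : 0 < √r := sqrt_pos.2 h
    have h1 : (√r) ^ 2 = r := sq_sqrt h.le
    have h0 := hk_le_exp r y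
    rw [exp_rew h] at h0
    set z := y / (2 * √r) with hz
    have h3 : |z ^ 2 - 1 / 2| * exp (-z ^ 2) ≤ 1 := by
      have := Real.add_one_le_exp (z ^ 2)
      rw [Real.exp_neg, ← div_eq_mul_inv, div_le_one (exp_pos _), abs_le]
      constructor <;> nlinarith [sq_nonneg z]
    have h4 : y ^ 2 / (4 * r ^ 2) - 1 / (2 * r) = (1 / r) * (z ^ 2 - 1 / 2) := by
      rw [hz, div_pow, mul_pow, h1]; field_simp; ring
    rw [hk2, h4, abs_mul, abs_mul, abs_of_nonneg (hk_nonneg r y), abs_of_pos h,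
      abs_of_pos (by positivity : 0 < 1 / r)]
    calc 1 / r * |z ^ 2 - 1 / 2| * hk r y ≤ 1 / r * |z ^ 2 - 1 / 2| * ((√r)⁻¹ * exp (-z ^ 2)) := by
          gcongr
      _ = 1 / r * (√r)⁻¹ * (|z ^ 2 - 1 / 2| * exp (-z ^ 2)) := by ring
      _ ≤ 1 / r * (√r)⁻¹ * 1 := by gcongr
      _ = _ := by rw [mul_inv]; ring

lemma hk1_le_hk {r : ℝ} (h : 0 < r) (y : ℝ) : |hk1 r y| ≤ 2 / √r * hk (2 * r) y := by
  have h2 : 0 < √r := sqrt_pos.2 h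
  have h1 : (√r) ^ 2 = r := sq_sqrt h.le
  have h5 : 0 < √(4 * π * r) := sqrt_pos.2 psv
  have e1 : √(4 * π * (2 * r)) = √2 * √(4 * π * r) := by
    rw [← Real.sqrt_mul (by norm_num)]; congr 1; ring
  have h3 := abs_mul_exp_le (y / (2 * √(2 * r)))
  rw [← exp_rew psv, abs_div, abs_of_pos (by positivity : 0 < 2 * √(2 * r))] at h3
  have e2 : √(2 * r) = √2 * √r := Real.sqrt_mul (by norm_num) r
  have e3 : exp (-y ^ 2 / (4 * r)) = exp (-y ^ 2 / (4 * (2 * r))) * exp (-y ^ 2 / (4 * (2 * r))) := by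
    rw [← Real.exp_add]; congr 1; field_simp; ring
  rw [hk1, abs_mul, abs_neg, abs_div, abs_of_nonneg (hk_nonneg r y),
      abs_of_pos (by positivity : 0 < 2 * r)]
  unfold hk
  rw [e1, e3]
  rw [e2] at h3
  set E := exp (-y ^ 2 / (4 * (2 * r)))
  have hE : 0 < E := exp_pos _
  have h22 : √2 ^ 2 = (2:ℝ) := sq_sqrt (by norm_num)
  have hs2 : 0 < √(2:ℝ) := by positivity
  have key : |y| * E ≤ 2 * (√2 * √r) := by
    have := mul_le_mul_of_nonneg_left h3 (by positivity : 0 ≤ 2 * (√2 * √r))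
    calc |y| * E = 2 * (√2 * √r) * (|y| / (2 * (√2 * √r)) * E) := by field_simp
      _ ≤ _ := by linarith
  calc |y| / (2 * r) * ((√(4 * π * r))⁻¹ * (E * E))
      = (|y| * E) * ((√(4 * π * r))⁻¹ * E / (2 * r)) := by ring
    _ ≤ (2 * (√2 * √r)) * ((√(4 * π * r))⁻¹ * E / (2 * r)) := by gcongr
    _ = 2 / √r * ((√2 * √(4 * π * r))⁻¹ * E) := by
      field_simp
      rw [h1, h22]

lemma hk_hasDerivAt (r y : ℝ) : HasDerivAt (hk r) (hk1 r y) y := by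
  unfold hk hk1 hk
  have := ((((hasDerivAt_id y).pow 2).neg.div_const (4 * r)).exp).const_mul (√(4 * π * r))⁻¹
  refine this.congr_deriv ?_
  simp only [id, Pi.neg_apply, Pi.pow_apply]
  ring

lemma hk1_hasDerivAt (r y : ℝ) : HasDerivAt (hk1 r) (hk2 r y) y := by
  have := (((hasDerivAt_id y).div_const (2 * r)).neg).mul (hk_hasDerivAt r y)
  refine this.congr_deriv ?_
  simp only [hk2, hk1, id, Pi.neg_apply]
  ring

lemma hk_hasDerivAt_t {r : ℝ} (h : 0 < r) (y : ℝ) : HasDerivAt (fun r => hk r y) (hk2 r y) r := by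
  have h5 : 0 < √(4 * π * r) := sqrt_pos.2 psv
  have h6 : √(4 * π * r) ^ 2 = 4 * π * r := sq_sqrt psv
  have a := (((hasDerivAt_id r).const_mul (4 * π)).sqrt (by simp; positivity)).inv (by simpa using h5.ne')
  have b := ((((hasDerivAt_id r).const_mul 4).inv (by simp; positivity)).const_mul (-y ^ 2)).exp
  have := a.mul b
  unfold hk2 hk
  refine (this.congr_deriv ?_)
  simp only [id, Pi.inv_apply, ← div_eq_mul_inv]
  rw [h6]
  field_simp
  ring

lemma hk_continuousAt {q : RP} (h : q ≠ 0) :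
    ContinuousAt (fun q : RP => hk q.1 q.2) q ∧ ContinuousAt (fun q : RP => hk1 q.1 q.2) q ∧
    ContinuousAt (fun q : RP => hk2 q.1 q.2) q := by
  obtain ⟨r, y⟩ := q
  rcases lt_trichotomy r 0 with hr | hr | hr
  · have e : ∀ᶠ q : RP in 𝓝 (r, y), q.1 < 0 :=
      (continuous_fst.continuousAt (x := (r, y))).eventually (gt_mem_nhds hr)
    refine ⟨?_, ?_, ?_⟩
    · exact (continuousAt_const (y := (0 : ℝ))).congr
        (e.mono fun q hq => (hk_of_nonpos hq.le _).symm)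
    · exact (continuousAt_const (y := (0 : ℝ))).congr
        (e.mono fun q hq => (hk1_of_nonpos hq.le _).symm)
    · exact (continuousAt_const (y := (0 : ℝ))).congr
        (e.mono fun q hq => (hk2_of_nonpos hq.le _).symm)
  · subst hr
    have hy : y ≠ 0 := fun hy => h (by simp [hy])
    have e : ∀ᶠ q : RP in 𝓝 ((0 : ℝ), y), q.2 ≠ 0 :=
      (continuous_snd.continuousAt (x := ((0 : ℝ), y))).eventually (isOpen_ne.mem_nhds hy)
    have hs : Continuous (fun q : RP => √q.1) := by fun_prop
    have aux : ∀ f g : ℝ × ℝ → ℝ, ContinuousAt g (0, y) → g (0, y) = 0 → f (0, y) = 0 →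
        (∀ᶠ q in 𝓝 ((0:ℝ), y), ‖f q‖ ≤ g q) → ContinuousAt f (0, y) := by
      intro f g hg hg0 hf0 hfg
      rw [ContinuousAt, hf0]
      exact squeeze_zero_norm' hfg (by simpa [ContinuousAt, hg0] using hg)
    refine ⟨aux _ (fun q => 32 * (q.1 * √q.1 / q.2 ^ 4)) ?_ (by simp) (hk_of_nonpos le_rfl _) ?_,
      aux _ (fun q => 16 * (√q.1 / |q.2| ^ 3)) ?_ (by simp) (hk1_of_nonpos le_rfl _) ?_,
      aux _ (fun q => 112 * (√q.1 / q.2 ^ 4)) ?_ (by simp) (hk2_of_nonpos le_rfl _) ?_⟩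
    · exact ContinuousAt.const_mul (ContinuousAt.div fpp fpp (by simpa using hy)) _
    · filter_upwards [e] with q hq
      rw [norm_eq_abs, abs_of_nonneg (hk_nonneg _ _)]; exact hk_far _ hq
    · exact ContinuousAt.const_mul (ContinuousAt.div fpp fpp (by simpa using hy)) _
    · filter_upwards [e] with q hq using hk1_far _ hq
    · exact ContinuousAt.const_mul (ContinuousAt.div fpp fpp (by simpa using hy)) _
    · filter_upwards [e] with q hq using hk2_far _ hq
  · have h5 : √(4 * π * r) ≠ 0 := (sqrt_pos.2 psv).ne'
    have c0 : ContinuousAt (fun q : RP => hk q.1 q.2) (r, y) := by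
      unfold hk
      refine ContinuousAt.mul (ContinuousAt.inv₀ fpp h5) (ContinuousAt.rexp ?_)
      exact ContinuousAt.div fpp fpp (by simpa using hr.ne')
    refine ⟨c0, ContinuousAt.mul (ContinuousAt.neg (ContinuousAt.div fpp fpp
      (by simpa using hr.ne'))) c0, ContinuousAt.mul (ContinuousAt.sub (ContinuousAt.div fpp
      fpp (by simpa using hr.ne')) (ContinuousAt.div fpp fpp
      (by simpa using hr.ne'))) c0⟩

lemma hk_hasDerivAt_t' (r : ℝ) {y : ℝ} (hy : y ≠ 0) : HasDerivAt (fun r => hk r y) (hk2 r y) r := by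
  rcases lt_trichotomy r 0 with hr | hr | hr
  · rw [hk2_of_nonpos hr.le]
    refine (hasDerivAt_const r (0 : ℝ)).congr_of_eventuallyEq ?_
    filter_upwards [gt_mem_nhds hr] with q hq using hk_of_nonpos hq.le _
  · subst hr
    rw [hk2_of_nonpos le_rfl, hasDerivAt_iff_isLittleO]
    simp only [hk_of_nonpos le_rfl, sub_zero, smul_zero]
    refine (Asymptotics.isLittleO_iff_tendsto' ?_).2 ?_
    · filter_upwards with x hx; rw [hx, hk_of_nonpos le_rfl]
    · have : Tendsto (fun x : ℝ => 32 * (√x / y ^ 4)) (𝓝 0) (𝓝 0) := by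
        have : Continuous (fun x : ℝ => 32 * (√x / y ^ 4)) := by fun_prop
        simpa using this.tendsto 0
      refine squeeze_zero_norm (fun x => ?_) this
      rcases le_or_gt x 0 with hx | hx
      · rw [hk_of_nonpos hx]; simp; positivity
      · rw [norm_eq_abs, abs_div, abs_of_nonneg (hk_nonneg _ _), abs_of_pos hx, div_le_iff₀ hx]
        refine (hk_far x hy).trans (le_of_eq (by ring))
  · exact hk_hasDerivAt_t hr y

lemma hk_integral {r : ℝ} (h : 0 < r) : Integrable (hk r) ∧ ∫ y, hk r y = 1 := by
  have hb : 0 < 1 / (4 * r) := by positivity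
  have e : hk r = fun y => (√(4 * π * r))⁻¹ * exp (-(1 / (4 * r)) * y ^ 2) := by
    ext y; unfold hk; congr 2; ring
  rw [e]
  refine ⟨(integrable_exp_neg_mul_sq hb).const_mul _, ?_⟩
  rw [integral_const_mul, integral_gaussian, show π / (1 / (4 * r)) = 4 * π * r by field_simp]
  exact inv_mul_cancel₀ (sqrt_pos.2 psv).ne'

lemma hk_int (r : ℝ) : Integrable (hk r) := by
  rcases le_or_gt r 0 with h | h
  · rw [show hk r = fun _ => 0 from funext (hk_of_nonpos h)]; exact integrable_zero _ _ _
  · exact (hk_integral h).1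

lemma hk_cont (r : ℝ) : Continuous (hk r) := by unfold hk; fun_prop
lemma hk1_cont (r : ℝ) : Continuous (hk1 r) := by unfold hk1 hk; fun_prop
lemma hk2_cont (r : ℝ) : Continuous (hk2 r) := by unfold hk2 hk; fun_prop

@[fun_prop] lemma hk_meas : Measurable (fun q : RP => hk q.1 q.2) := by unfold hk; fun_prop
@[fun_prop] lemma hk1_meas : Measurable (fun q : RP => hk1 q.1 q.2) := by
  unfold hk1 hk; fun_prop
@[fun_prop] lemma hk2_meas : Measurable (fun q : RP => hk2 q.1 q.2) := by
  unfold hk2 hk; fun_prop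

/-! Error function -/
def ph (z : ℝ) : ℝ := (√π)⁻¹ * ∫ x in Iic z, exp (-x ^ 2)

lemma gau_int : Integrable (fun x : ℝ => exp (-x ^ 2)) := by
  simpa using integrable_exp_neg_mul_sq (one_pos)

lemma gau_val : ∫ x : ℝ, exp (-x ^ 2) = √π := by
  simpa using integral_gaussian 1

lemma ph_nonneg (z : ℝ) : 0 ≤ ph z := by
  unfold ph
  exact mul_nonneg psv (integral_nonneg fun x => (exp_pos _).le)

lemma ph_le_one (z : ℝ) : ph z ≤ 1 := by
  unfold ph
  rw [inv_mul_le_iff₀ (sqrt_pos.2 pi_pos), mul_one, ← gau_val]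
  exact setIntegral_le_integral gau_int (ae_of_all _ fun x => (exp_pos _).le)

lemma ph_hasDerivAt (z : ℝ) : HasDerivAt ph ((√π)⁻¹ * exp (-z ^ 2)) z := by
  have e : ph = fun z => (√π)⁻¹ * ((∫ x in 0..z, exp (-x ^ 2)) + ∫ x in Iic (0:ℝ), exp (-x ^ 2)) := by
    ext z; unfold ph
    rw [← intervalIntegral.integral_Iic_sub_Iic gau_int.integrableOn gau_int.integrableOn]; ring
  rw [e]
  have hc : Continuous (fun x : ℝ => exp (-x ^ 2)) := by fun_prop
  exact ((ihd (hc.intervalIntegrable _ _)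
    (hc.stronglyMeasurableAtFilter _ _) hc.continuousAt).add_const _).const_mul _

lemma ph_cont : Continuous ph := continuous_iff_continuousAt.2 fun z => (ph_hasDerivAt z).continuousAt

lemma ph_zero : ph 0 = 1 / 2 := by
  have h : ∫ x in Iic (0:ℝ), exp (-x ^ 2) = √π / 2 := by
    have h1 : ∫ x in Iic (0:ℝ), exp (-x ^ 2) = ∫ x in Ioi (0:ℝ), exp (-x ^ 2) := by
      have := integral_comp_neg_Iic (0:ℝ) (fun x => exp (-x ^ 2))
      simpa using this
    rw [h1]
    simpa using integral_gaussian_Ioi 1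
  have : 0 < √π := sqrt_pos.2 pi_pos
  rw [ph, h]; field_simp

lemma ph_top : Tendsto ph atTop (𝓝 1) := by
  have := (tendsto_setIntegral_of_monotone (μ := volume) (f := fun x : ℝ => exp (-x ^ 2))
    (s := fun z : ℝ => Iic z) (fun _ => measurableSet_Iic) (fun a b h => Iic_subset_Iic.2 h)
    gau_int.integrableOn).const_mul (√π)⁻¹
  rw [iUnion_Iic, setIntegral_univ, gau_val, inv_mul_cancel₀ (sqrt_pos.2 pi_pos).ne'] at this
  exact this

lemma ph_neg (z : ℝ) : ph (-z) = 1 - ph z := by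
  have h : (∫ x in Iic (-z), exp (-x ^ 2)) + ∫ x in Iic z, exp (-x ^ 2) = √π := by
    have := integral_comp_neg_Iic (-z) (fun x : ℝ => exp (-x ^ 2))
    simp only [neg_neg, even_two, Even.neg_pow] at this
    rw [this, add_comm, ← gau_val]
    exact intervalIntegral.integral_Iic_add_Ioi gau_int.integrableOn gau_int.integrableOn
  have h2 : 0 < √π := sqrt_pos.2 pi_pos
  unfold ph
  rw [← inv_mul_cancel₀ h2.ne', ← mul_sub]
  congr 1; linarith

lemma ph_bot : Tendsto ph atBot (𝓝 0) := by
  have := (tendsto_const_nhds (x := (1:ℝ))).sub (ph_top.comp tendsto_neg_atBot_atTop)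
  rw [sub_self] at this
  refine this.congr fun z => ?_
  rw [Function.comp, ph_neg]; ring

def hH (r y : ℝ) : ℝ := ph (y / (2 * √r))

lemma hH_hasDerivAt {ρ y : RF} {ρ' y' j : ℝ} (h : 0 < ρ j) (hρ : HasDerivAt ρ ρ' j)
    (hy : HasDerivAt y y' j) :
    HasDerivAt (fun j => hH (ρ j) (y j)) (hk1 (ρ j) (y j) * ρ' + hk (ρ j) (y j) * y') j := by
  have h2 : 0 < √(ρ j) := sqrt_pos.2 h
  have h1 : √(ρ j) ^ 2 = ρ j := sq_sqrt h.le
  have a := hy.div ((hρ.sqrt h.ne').const_mul 2) psv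
  have b := (ph_hasDerivAt (y j / (2 * √(ρ j)))).comp j a
  refine b.congr_deriv ?_
  rw [hk1, hk, exp_rew h]
  have e : √(4 * π * ρ j) = 2 * √π * √(ρ j) := by
    rw [Real.sqrt_mul psv, Real.sqrt_mul (by norm_num),
      show (4:ℝ) = 2 ^ 2 by norm_num, Real.sqrt_sq (by norm_num)]
  have h3 : 0 < √π := sqrt_pos.2 pi_pos
  rw [e]
  set E := exp (-(y j / (2 * √(ρ j))) ^ 2)
  generalize √(ρ j) = R at *
  rw [← h1]
  field_simp
  ring

lemma hH_cont {q : RP} (h : 0 < q.1) : ContinuousAt (fun q : RP => hH q.1 q.2) q := by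
  unfold hH
  refine ph_cont.continuousAt.comp (ContinuousAt.div fpp fpp ?_)
  have : 0 < √q.1 := sqrt_pos.2 h
  positivity

lemma GCbd {X : Type*} [TopologicalSpace X] {κ : X → ℝ → ℝ} {q₀ : X} {a b : ℝ}
    (hc : ∀ j ∈ Icc a b, ContinuousAt (Function.uncurry κ) (q₀, j)) :
    ∃ C, 0 ≤ C ∧ ∀ᶠ q in 𝓝 q₀, ∀ j ∈ Icc a b, |κ q j| ≤ C := by
  have h1 : ContinuousOn (κ q₀) (Icc a b) := fun j hj =>
    ((hc j hj).comp (f := fun j => (q₀, j)) fpp).continuousWithinAt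
  obtain ⟨C, hC⟩ := isCompact_Icc.exists_bound_of_continuousOn h1
  refine ⟨|C| + 1, by positivity, ?_⟩
  refine isCompact_Icc.eventually_forall_of_forall_eventually fun j hj => ?_
  have h2 : |κ q₀ j| < |C| + 1 := by
    have := hC j hj; rw [norm_eq_abs] at this; linarith [le_abs_self C]
  exact ((hc j hj).abs.eventually (gt_mem_nhds h2)).mono fun z hz => le_of_lt hz

lemma GC {X : Type*} [TopologicalSpace X] [FirstCountableTopology X] {κ : X → ℝ → ℝ} {q₀ : X}
    {a b : ℝ} {g : RF} (hg : Integrable g) (hg0 : ∀ j ∉ Icc a b, g j = 0)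
    (hm : ∀ q, Measurable (κ q))
    (hc : ∀ j ∈ Icc a b, ContinuousAt (Function.uncurry κ) (q₀, j)) :
    ContinuousAt (fun q => ∫ j, g j * κ q j) q₀ := by
  obtain ⟨C, hC0, hC⟩ := GCbd hc
  refine continuousAt_of_dominated (bound := fun j => |g j| * C)
    (Eventually.of_forall fun q => hg.1.mul (hm q).aestronglyMeasurable) ?_ (hg.abs.mul_const C) ?_
  · filter_upwards [hC] with q hq
    refine ae_of_all _ fun j => ?_
    rw [norm_mul, norm_eq_abs, norm_eq_abs]
    by_cases h : j ∈ Icc a b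
    · gcongr; exact hq j h
    · simp [hg0 j h]
  · refine ae_of_all _ fun j => ?_
    by_cases h : j ∈ Icc a b
    · exact ContinuousAt.const_mul ((hc j h).comp (f := fun q => (q, j)) fpp) _
    · simp only [hg0 j h, zero_mul]; exact continuousAt_const

lemma GD {κ κ' : RG} {p₀ : ℝ}
    {a b : ℝ} {g : RF} (hg : Integrable g) (hg0 : ∀ j ∉ Icc a b, g j = 0)
    (hm : ∀ q, Measurable (κ q)) (hm' : Measurable (κ' p₀))
    (hc : ∀ j ∈ Icc a b, ContinuousAt (κ p₀) j)
    (hc' : ∀ j ∈ Icc a b, ContinuousAt (Function.uncurry κ') (p₀, j))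
    (hd : ∀ᶠ q in 𝓝 p₀, ∀ j ∈ Icc a b, HasDerivAt (fun q => κ q j) (κ' q j) q) :
    HasDerivAt (fun q => ∫ j, g j * κ q j) (∫ j, g j * κ' p₀ j) p₀ := by
  obtain ⟨C, hC0, hC⟩ := GCbd hc'
  have h1 : ContinuousOn (κ p₀) (Icc a b) := fun j hj => (hc j hj).continuousWithinAt
  obtain ⟨C1, hC1⟩ := isCompact_Icc.exists_bound_of_continuousOn h1
  refine (hasDerivAt_integral_of_dominated_loc_of_deriv_le (bound := fun j => |g j| * C)
    (F := fun q j => g j * κ q j) (F' := fun q j => g j * κ' q j) (hC.and hd)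
    (Eventually.of_forall fun q => hg.1.mul (hm q).aestronglyMeasurable) ?_
    (hg.1.mul hm'.aestronglyMeasurable) ?_ (hg.abs.mul_const C) ?_).2
  · refine Integrable.mono' (hg.abs.mul_const |C1|) (hg.1.mul (hm p₀).aestronglyMeasurable)
      (ae_of_all _ fun j => ?_)
    rw [norm_mul, norm_eq_abs]
    by_cases h : j ∈ Icc a b
    · gcongr; exact (hC1 j h).trans (le_abs_self _)
    · simp [hg0 j h]
  · refine ae_of_all _ fun j q hq => ?_
    rw [norm_mul, norm_eq_abs, norm_eq_abs]
    by_cases h : j ∈ Icc a b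
    · gcongr; exact hq.1 j h
    · simp [hg0 j h]
  · refine ae_of_all _ fun j q hq => ?_
    by_cases h : j ∈ Icc a b
    · exact (hq.2 j h).const_mul _
    · simp only [hg0 j h, zero_mul]; exact hasDerivAt_const _ _

structure Lay (A G L : ℝ) (g O O' : RF) : Prop where
  gz : ∀ j ∉ Ioo 0 A, g j = 0
  gb : ∀ j, |g j| ≤ G
  gc : ContinuousOn g (Ioo 0 A)
  OL : ∀ a b, |O a - O b| ≤ L * |a - b|
  Od : ∀ j ∈ Ioo 0 A, HasDerivAt O (O' j) j
  dz : ∀ j ∉ Ioo 0 A, O' j = 0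
  db : ∀ j, |O' j| ≤ L
  dc : ContinuousOn O' (Ioo 0 A)

def LV (g O : RF) (t x : ℝ) : ℝ := ∫ j, g j * hk (t - j) (x - O j)
def LV1 (g O : RF) (t x : ℝ) : ℝ := ∫ j, g j * hk1 (t - j) (x - O j)
def LV2 (g O : RF) (t x : ℝ) : ℝ := ∫ j, g j * hk2 (t - j) (x - O j)

section
variable {A G L : ℝ} {g O O' : RF}

lemma Lay.self (h : Lay A G L g O O') : Lay A L L O' O O' :=
  ⟨h.dz, h.db, h.dc, h.OL, h.Od, h.dz, h.db, h.dc⟩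

lemma Lay.Ocont (h : Lay A G L g O O') : Continuous O :=
  (LipschitzWith.of_dist_le_mul (K := ⟨|L|, abs_nonneg L⟩) fun a b => by
    rw [Real.dist_eq, Real.dist_eq]
    exact (h.OL a b).trans (mul_le_mul_of_nonneg_right (le_abs_self L) (abs_nonneg _))).continuous

lemma Lay.G0 (h : Lay A G L g O O') : 0 ≤ G := (abs_nonneg _).trans (h.gb 0)
lemma Lay.L0 (h : Lay A G L g O O') : 0 ≤ L := (abs_nonneg _).trans (h.db 0)

lemma Lay.gae (h : Lay A G L g O O') : AEStronglyMeasurable g volume := by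
  have e : g = (Ioo 0 A).indicator g := by
    ext j; by_cases hj : j ∈ Ioo 0 A
    · rw [indicator_of_mem hj]
    · rw [indicator_of_notMem hj, h.gz j hj]
  rw [e, aestronglyMeasurable_indicator_iff measurableSet_Ioo]
  exact h.gc.aestronglyMeasurable measurableSet_Ioo

lemma Lay.int (h : Lay A G L g O O') : Integrable g := by
  have : IntegrableOn g (Ioo 0 A) := Measure.integrableOn_of_bounded (M := G)
    (by simp) h.gae (ae_of_all _ fun j => h.gb j)
  refine (integrableOn_iff_integrable_of_support_subset ?_).1 this
  intro j hj; by_contra hh; exact hj (h.gz j hh)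

lemma Lay.gca (h : Lay A G L g O O') {j : ℝ} (h0 : j ≠ 0) (hA : j ≠ A) : ContinuousAt g j := by
  by_cases hj : j ∈ Ioo 0 A
  · exact h.gc.continuousAt (isOpen_Ioo.mem_nhds hj)
  · have : j ∈ (Icc 0 A)ᶜ := by
      intro hh; exact hj ⟨lt_of_le_of_ne hh.1 h0.symm, lt_of_le_of_ne hh.2 hA⟩
    refine (continuousAt_const (y := (0:ℝ))).congr ?_
    filter_upwards [isClosed_Icc.isOpen_compl.mem_nhds this] with z hz
    exact (h.gz z fun hh => hz ⟨hh.1.le, hh.2.le⟩).symm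

lemma Lay.gz' (h : Lay A G L g O O') : ∀ j ∉ Icc 0 A, g j = 0 :=
  fun j hj => h.gz j fun hh => hj ⟨hh.1.le, hh.2.le⟩

lemma Lay.off (h : Lay A G L g O O') {t x : ℝ} (hx : x ≠ O t) :
    HasDerivAt (LV g O t) (LV1 g O t x) x ∧ HasDerivAt (LV1 g O t) (LV2 g O t x) x ∧
    HasDerivAt (fun t => LV g O t x) (LV2 g O t x) t ∧
    ContinuousAt (fun q : RP => LV1 g O q.1 q.2) (t, x) ∧
    ContinuousAt (fun q : RP => LV2 g O q.1 q.2) (t, x) := by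
  have hO := h.Ocont
  have hm : Measurable O := hO.measurable
  have ne : ∀ j, ((t - j, x - O j) : RP) ≠ 0 := by
    intro j hh
    have h1 : t = j := sub_eq_zero.1 (congrArg Prod.fst hh)
    have h2 : x - O j = 0 := congrArg Prod.snd hh
    rw [← h1] at h2; exact hx (sub_eq_zero.1 h2)
  have m0 : ∀ t x, Measurable (fun j => hk (t - j) (x - O j)) := fun t x =>
    hk_meas.comp (by fun_prop : Measurable fun j => (t - j, x - O j))
  have m1 : ∀ t x, Measurable (fun j => hk1 (t - j) (x - O j)) := fun t x =>
    hk1_meas.comp (by fun_prop : Measurable fun j => (t - j, x - O j))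
  have m2 : ∀ t x, Measurable (fun j => hk2 (t - j) (x - O j)) := fun t x =>
    hk2_meas.comp (by fun_prop : Measurable fun j => (t - j, x - O j))
  refine ⟨?_, ?_, ?_, ?_, ?_⟩
  · refine GD (κ := fun x j => hk (t - j) (x - O j)) (κ' := fun x j => hk1 (t - j) (x - O j)) h.int h.gz' (m0 t) (m1 t x) ?_ ?_ ?_
    · intro j _
      exact (hk_continuousAt (ne j)).1.comp (f := fun j => (t - j, x - O j)) fpp
    · intro j _
      exact (hk_continuousAt (ne j)).2.1.comp (x := (x, j)) (f := fun q : RP => (t - q.2, q.1 - O q.2))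
        fpp
    · refine Eventually.of_forall fun q j _ => ?_
      simpa using (hk_hasDerivAt (t - j) (q - O j)).comp_sub_const q (O j)
  · refine GD (κ := fun x j => hk1 (t - j) (x - O j)) (κ' := fun x j => hk2 (t - j) (x - O j)) h.int h.gz' (m1 t) (m2 t x) ?_ ?_ ?_
    · intro j _
      exact (hk_continuousAt (ne j)).2.1.comp (f := fun j => (t - j, x - O j)) fpp
    · intro j _
      exact (hk_continuousAt (ne j)).2.2.comp (x := (x, j)) (f := fun q : RP => (t - q.2, q.1 - O q.2))
        fpp
    · refine Eventually.of_forall fun q j _ => ?_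
      simpa using (hk1_hasDerivAt (t - j) (q - O j)).comp_sub_const q (O j)
  · refine GD (κ := fun t j => hk (t - j) (x - O j)) (κ' := fun t j => hk2 (t - j) (x - O j)) h.int h.gz' (fun t => m0 t x) (m2 t x) ?_ ?_ ?_
    · intro j _
      exact (hk_continuousAt (ne j)).1.comp (f := fun j => (t - j, x - O j)) fpp
    · intro j _
      exact (hk_continuousAt (ne j)).2.2.comp (x := (t, j)) (f := fun q : RP => (q.1 - q.2, x - O q.2))
        fpp
    · have : ∀ᶠ q in 𝓝 t, x ≠ O q :=
        hO.continuousAt.eventually (isOpen_ne.mem_nhds hx.symm) |>.mono fun q hq => Ne.symm hq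
      filter_upwards [this] with q hq j _
      by_cases hx2 : x - O j = 0
      · have h3 : q - j ≠ 0 := by
          intro hh; rw [sub_eq_zero.1 hh] at hq; exact hq (sub_eq_zero.1 hx2)
        rcases lt_or_gt_of_ne h3 with h4 | h4
        · rw [hk2_of_nonpos h4.le]
          refine (hasDerivAt_const q (0 : ℝ)).congr_of_eventuallyEq ?_
          filter_upwards [gt_mem_nhds (sub_neg.1 h4)] with z hz using hk_of_nonpos lnn _
        · simpa using (hk_hasDerivAt_t h4 (x - O j)).comp_sub_const q j
      · simpa using (hk_hasDerivAt_t' (q - j) hx2).comp_sub_const q j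
  · refine GC (κ := fun q : RP => fun j => hk1 (q.1 - j) (q.2 - O j)) h.int h.gz'
      (fun q => m1 q.1 q.2) fun j _ => ?_
    exact (hk_continuousAt (ne j)).2.1.comp
      (x := ((t, x), j)) (f := fun q : (ℝ × ℝ) × ℝ => (q.1.1 - q.2, q.1.2 - O q.2)) fpp
  · refine GC (κ := fun q : RP => fun j => hk2 (q.1 - j) (q.2 - O j)) h.int h.gz'
      (fun q => m2 q.1 q.2) fun j _ => ?_
    exact (hk_continuousAt (ne j)).2.2.comp
      (x := ((t, x), j)) (f := fun q : (ℝ × ℝ) × ℝ => (q.1.1 - q.2, q.1.2 - O q.2)) fpp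

lemma LV_eq (g O : RF) (t x : ℝ) : LV g O t x = ∫ r, g (t - r) * hk r (x - O (t - r)) := by
  rw [LV, ← integral_sub_left_eq_self _ volume t]; simp
lemma LV1_eq (g O : RF) (t x : ℝ) : LV1 g O t x = ∫ r, g (t - r) * hk1 r (x - O (t - r)) := by
  rw [LV1, ← integral_sub_left_eq_self _ volume t]; simp

lemma rsq_int (a b : ℝ) : IntervalIntegrable (fun r : ℝ => (√r)⁻¹) volume a b := by
  have := intervalIntegral.intervalIntegrable_rpow' (a := a) (b := b) (r := -(1/2)) (by norm_num)
  refine this.mono_fun fpp (ae_of_all _ fun r => ?_)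
  dsimp only
  rcases le_or_gt 0 r with h | h
  · rw [Real.rpow_neg h, Real.sqrt_eq_rpow]
  · simp only [sqrt_eq_zero_of_nonpos h.le, inv_zero, norm_zero]; positivity

lemma rsq_val {t : ℝ} (ht : 0 ≤ t) : ∫ r in 0..t, (√r)⁻¹ = 2 * √t := by
  have := intervalIntegral.integral_eq_sub_of_hasDerivAt_of_le (a := 0) (b := t) ht
    (f := fun r => 2 * √r) (f' := fun r : ℝ => (√r)⁻¹) fpp (fun r hr => ?_) (rsq_int 0 t)
  · simpa using this
  · refine ((Real.hasDerivAt_sqrt hr.1.ne').const_mul 2).congr_deriv ?_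
    field_simp

lemma rsq_ind (t : ℝ) : Integrable ((Ioc 0 t).indicator fun r : ℝ => (√r)⁻¹) := by
  rw [integrable_indicator_iff measurableSet_Ioc]
  rcases le_or_gt 0 t with h | h
  · exact (intervalIntegrable_iff_integrableOn_Ioc_of_le h).1 (rsq_int 0 t)
  · rw [Ioc_eq_empty lnn]; exact integrableOn_empty

lemma Lay.mg (h : Lay A G L g O O') (t : ℝ) : AEStronglyMeasurable (fun r => g (t - r)) volume :=
  h.gae.comp_quasiMeasurePreserving (quasiMeasurePreserving_sub_left volume t)

lemma Lay.mk0 (h : Lay A G L g O O') (t x : ℝ) : Measurable fun r => hk r (x - O (t - r)) :=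
  have := h.Ocont.measurable
  hk_meas.comp (by fun_prop : Measurable fun r => (r, x - O (t - r)))

lemma Lay.mk1 (h : Lay A G L g O O') (t x : ℝ) : Measurable fun r => hk1 r (x - O (t - r)) :=
  have := h.Ocont.measurable
  hk1_meas.comp (by fun_prop : Measurable fun r => (r, x - O (t - r)))

lemma Lay.dom (h : Lay A G L g O O') {t T : ℝ} (hT : t ≤ T) (x r : ℝ) :
    ‖g (t - r) * hk r (x - O (t - r))‖ ≤ G * (Ioc 0 T).indicator (fun r : ℝ => (√r)⁻¹) r := by
  rw [norm_mul, norm_eq_abs, norm_eq_abs, abs_of_nonneg (hk_nonneg _ _)]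
  by_cases hr : r ∈ Ioc 0 T
  · rw [indicator_of_mem hr]
    exact mul_le_mul (h.gb _) (hk_le _ _) (hk_nonneg _ _) h.G0
  · rw [indicator_of_notMem hr]
    by_cases h0 : 0 < r
    · have : T < r := by by_contra hh; exact hr ⟨h0, not_lt.1 hh⟩
      rw [h.gz (t - r) fun hh => by linarith [hh.1]]; simp
    · rw [hk_of_nonpos (not_lt.1 h0)]; simp

lemma Lay.cont (h : Lay A G L g O O') : Continuous (fun q : RP => LV g O q.1 q.2) := by
  rw [continuous_iff_continuousAt]
  rintro ⟨t, x⟩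
  simp_rw [LV_eq]
  have hO := h.Ocont
  refine continuousAt_of_dominated (bound := fun r => G * (Ioc 0 (t + 1)).indicator (fun r : ℝ => (√r)⁻¹) r)
    (Eventually.of_forall fun q => (h.mg q.1).mul (h.mk0 q.1 q.2).aestronglyMeasurable) ?_
    ((rsq_ind _).const_mul _) ?_
  · have : ∀ᶠ q : RP in 𝓝 (t, x), q.1 < t + 1 :=
      (continuous_fst.continuousAt (x := (t, x))).eventually (gt_mem_nhds (by simp))
    filter_upwards [this] with q hq
    exact ae_of_all _ fun r => h.dom hq.le _ _
  · have e : ∀ᵐ r : ℝ, r ∉ ({t, t - A, 0} : Set ℝ) :=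
      compl_mem_ae_iff.2 ((Set.toFinite _).measure_zero volume)
    filter_upwards [e] with r hr
    simp only [mem_insert_iff, mem_singleton_iff, not_or] at hr
    refine ContinuousAt.mul ?_ ?_
    · refine ContinuousAt.comp (x := (t, x)) (f := fun q : RP => q.1 - r) (h.gca ?_ ?_) fpp
      · exact fun hh => hr.1 (by simp at hh; linarith)
      · exact fun hh => hr.2.1 (by simp at hh; linarith)
    · exact (hk_continuousAt (q := (r, x - O (t - r))) (fun hh => hr.2.2 (congrArg Prod.fst hh))).1.comp
        (x := (t, x)) (f := fun q : RP => (r, q.2 - O (q.1 - r))) fpp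

lemma Lay.bound (h : Lay A G L g O O') {t : ℝ} (ht : 0 ≤ t) (x : ℝ) : |LV g O t x| ≤ G * (2 * √t) := by
  rw [LV_eq, ← norm_eq_abs]
  refine (norm_integral_le_of_norm_le ((rsq_ind t).const_mul G)
    (ae_of_all _ fun r => h.dom le_rfl x r)).trans (le_of_eq ?_)
  rw [integral_const_mul, integral_indicator measurableSet_Ioc, ← rsq_val ht,
    iole ht]

lemma hH_lim {ρ y : RF} {l : Filter ℝ} {y₀ : ℝ} (hρ : Tendsto ρ l (𝓝[>] 0))
    (hy : Tendsto y l (𝓝 y₀)) :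
    (0 < y₀ → Tendsto (fun j => hH (ρ j) (y j)) l (𝓝 1)) ∧
    (y₀ < 0 → Tendsto (fun j => hH (ρ j) (y j)) l (𝓝 0)) := by
  have h1 : Tendsto (fun j => 2 * √(ρ j)) l (𝓝[>] 0) := by
    rw [tendsto_nhdsWithin_iff]
    constructor
    · have : Tendsto (fun r : ℝ => 2 * √r) (𝓝[>] 0) (𝓝 0) := by
        have : Continuous (fun r : ℝ => 2 * √r) := by fun_prop
        simpa using (this.tendsto 0).mono_left nhdsWithin_le_nhds
      exact this.comp hρ
    · filter_upwards [hρ.eventually self_mem_nhdsWithin] with j hj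
      have := sqrt_pos.2 hj
      simpa using hj
  have h2 := tendsto_inv_nhdsGT_zero.comp h1
  refine ⟨fun h0 => ?_, fun h0 => ?_⟩
  · exact ph_top.comp (by simpa [div_eq_mul_inv] using hy.pos_mul_atTop h0 h2)
  · exact ph_bot.comp (by simpa [div_eq_mul_inv] using hy.neg_mul_atTop h0 h2)

lemma hH_mem (r y : ℝ) : 0 ≤ hH r y ∧ hH r y ≤ 1 := ⟨ph_nonneg _, ph_le_one _⟩

lemma hk1_time {d : ℝ} (hd : 0 ≤ d) {η : ℝ} (hη : 0 < η) :
    IntervalIntegrable (fun r => hk1 r (-d)) volume 0 η ∧ ∫ r in 0..η, hk1 r (-d) ≤ 1 := by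
  rcases hd.eq_or_lt with rfl | hd
  · simp [hk1]
  have c : Continuous (fun r => hk1 r (-d)) := continuous_iff_continuousAt.2 fun r =>
    (hk_continuousAt (q := (r, -d)) (fun hh => by
      have : -d = 0 := congrArg Prod.snd hh
      linarith)).2.1.comp (f := fun r => (r, -d)) fpp
  refine ⟨c.intervalIntegrable _ _, ?_⟩
  rw [intervalIntegral.integral_eq_sub_of_hasDerivAt_of_tendsto (f := fun r => hH r (-d))
    (fa := 0) (fb := hH η (-d)) hη ?_ (c.intervalIntegrable _ _) ?_ ?_]
  · linarith [(hH_mem η (-d)).2]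
  · intro r hr
    simpa using hH_hasDerivAt (ρ := id) (y := fun _ => -d) hr.1 (hasDerivAt_id r) (hasDerivAt_const _ _)
  · exact (hH_lim (ρ := id) (y := fun _ => -d) tendsto_id tendsto_const_nhds).2 lnn
  · exact (hH_cont (q := (η, -d)) hη).tendsto.comp (f := fun r => (r, -d))
      ((by fun_prop : ContinuousAt (fun r : ℝ => (r, -d)) η).tendsto.mono_left nhdsWithin_le_nhds)

lemma Lay.hk1_pt (h : Lay A G L g O O') {D t x r : ℝ} (hD : |x - O t| ≤ D) (hr : 0 < r) :
    |hk1 r (x - O (t - r))| ≤ exp (D * L / 2) * (hk1 r (-|x - O t|) + L * (√r)⁻¹) := by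
  set y := x - O (t - r)
  set d := |x - O t| with hd
  have hL := h.L0
  have hd0 : 0 ≤ d := abs_nonneg _
  have h1 := h.OL (t - r) t
  rw [show t - r - t = -r by ring, abs_neg, abs_of_pos hr] at h1
  have hy : x - O t = y + (O (t - r) - O t) := by simp [y]
  have h2 : |y| ≤ d + L * r := by
    have : |y| = |(x - O t) - (O (t - r) - O t)| := by rw [hy]; congr 1; ring
    rw [this]; exact (abs_sub _ _).trans lnn
  have h3 : d ≤ |y| + L * r := by rw [hd, hy]; exact (abs_add_le _ _).trans lnn
  have h4 : d ^ 2 - 2 * d * L * r ≤ y ^ 2 := by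
    rw [← sq_abs y]
    rcases le_or_gt (L * r) d with h5 | h5
    · have := pow_le_pow_left₀ (by linarith : 0 ≤ d - L * r) (by linarith : d - L * r ≤ |y|) 2
      nlinarith [mul_nonneg hL hr.le]
    · nlinarith [sq_nonneg |y|, mul_nonneg hd0 (mul_nonneg hL hr.le)]
  have h5 : hk r y ≤ exp (D * L / 2) * hk r d := by
    unfold hk
    rw [mul_left_comm, ← Real.exp_add]
    gcongr
    have : d * L / 2 ≤ D * L / 2 := by gcongr
    refine le_trans ?_ (add_le_add_left this _)
    have : -y^2/(4*r) - (-d^2/(4*r)) ≤ d*L/2 := by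
      rw [← sub_div, div_le_iff₀ psv]; nlinarith
    linarith
  rw [hk1, abs_mul, abs_neg, abs_div, abs_of_nonneg (hk_nonneg r y), abs_of_pos (by positivity : 0 < 2 * r)]
  have h6 : 0 ≤ hk r d := hk_nonneg _ _
  have h7 := hk_le r d
  calc |y| / (2 * r) * hk r y ≤ (d + L * r) / (2 * r) * (exp (D * L / 2) * hk r d) := by
        gcongr
        exact hk_nonneg r y
    _ = exp (D * L / 2) * (d / (2 * r) * hk r d + (L / 2) * hk r d) := by field_simp
    _ ≤ exp (D * L / 2) * (d / (2 * r) * hk r d + L * (√r)⁻¹) := by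
        have : L / 2 * hk r d ≤ L * (√r)⁻¹ := by
          have : L / 2 ≤ L := by linarith
          gcongr
        gcongr
    _ = _ := by rw [hk1, hk_neg]; congr 2; ring

lemma Lay.hk1_int (h : Lay A G L g O O') (t x : ℝ) {η : ℝ} (hη : 0 ≤ η) :
    IntervalIntegrable (fun r => hk1 r (x - O (t - r))) volume 0 η := by
  rcases hη.eq_or_lt with rfl | hη
  · exact IntervalIntegrable.refl
  have b := ((hk1_time (abs_nonneg (x - O t)) hη).1.add ((rsq_int 0 η).const_mul L)).const_mul
    (exp (|x - O t| * L / 2))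
  refine b.mono_fun' (h.mk1 t x).aestronglyMeasurable ?_
  rw [uIoc_of_le hη.le]
  filter_upwards [ae_restrict_mem measurableSet_Ioc] with r hr
  exact h.hk1_pt le_rfl hr.1

lemma Lay.hk1_bd (h : Lay A G L g O O') {D t x η c : ℝ} (hη : 0 < η) (hD : |x - O t| ≤ D)
    {f : RF} (hf : ∀ r ∈ Ioc 0 η, |f r| ≤ c) :
    |∫ r in 0..η, f r * hk1 r (x - O (t - r))| ≤ c * (exp (D * L / 2) * (1 + L * (2 * √η))) := by
  have hc : 0 ≤ c := (abs_nonneg _).trans (hf η ⟨hη, le_rfl⟩)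
  have i1 := hk1_time (abs_nonneg (x - O t)) hη
  have b := ((i1.1.add ((rsq_int 0 η).const_mul L)).const_mul (exp (D * L / 2))).const_mul c
  rw [← norm_eq_abs]
  refine (intervalIntegral.norm_integral_le_of_norm_le hη.le (ae_of_all _ fun r hr => ?_) b).trans ?_
  · rw [norm_mul]
    exact mul_le_mul (hf r hr) (h.hk1_pt hD hr.1) (norm_nonneg _) hc
  · rw [icm, icm,
      iadd i1.1 ((rsq_int 0 η).const_mul L),
      icm, rsq_val hη.le]
    gcongr
    exact i1.2

lemma Lay.LV1_eq' (h : Lay A G L g O O') {t : ℝ} (ht : 0 ≤ t) (x : ℝ) :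
    LV1 g O t x = ∫ r in 0..t, g (t - r) * hk1 r (x - O (t - r)) := by
  rw [LV1_eq, iole ht, ← integral_indicator measurableSet_Ioc]
  congr 1; ext r
  by_cases hr : r ∈ Ioc 0 t
  · rw [indicator_of_mem hr]
  · rw [indicator_of_notMem hr]
    by_cases h0 : 0 < r
    · have : t < r := by by_contra hh; exact hr ⟨h0, not_lt.1 hh⟩
      rw [h.gz (t - r) fun hh => by linarith [hh.1]]; simp
    · rw [hk1_of_nonpos (not_lt.1 h0)]; simp

lemma Lay.LV_eq' (h : Lay A G L g O O') {t : ℝ} (ht : 0 ≤ t) (x : ℝ) :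
    LV g O t x = ∫ r in 0..t, g (t - r) * hk r (x - O (t - r)) := by
  rw [LV_eq, iole ht, ← integral_indicator measurableSet_Ioc]
  congr 1; ext r
  by_cases hr : r ∈ Ioc 0 t
  · rw [indicator_of_mem hr]
  · rw [indicator_of_notMem hr]
    by_cases h0 : 0 < r
    · have : t < r := by by_contra hh; exact hr ⟨h0, not_lt.1 hh⟩
      rw [h.gz (t - r) fun hh => by linarith [hh.1]]; simp
    · rw [hk_of_nonpos (not_lt.1 h0)]; simp

lemma Lay.LV1_bd (h : Lay A G L g O O') {D t x : ℝ} (ht : 0 < t) (hD : |x - O t| ≤ D) :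
    |LV1 g O t x| ≤ G * (exp (D * L / 2) * (1 + L * (2 * √t))) := by
  rw [h.LV1_eq' ht.le]
  exact h.hk1_bd ht hD fun r _ => h.gb _

lemma Lay.ident (h : Lay A G L g O O') {t x ι : ℝ} (ht : t ∈ Ioo 0 A)
    (hι : Tendsto (fun r => hH r (x - O (t - r))) (𝓝[>] 0) (𝓝 ι)) :
    ∫ r in 0..t, hk1 r (x - O (t - r)) = hH t (x - O 0) - ι - LV O' O t x := by
  have hO := h.Ocont
  have i1 := h.hk1_int t x ht.1.le
  have i2 : IntervalIntegrable (fun r => O' (t - r) * hk r (x - O (t - r))) volume 0 t := by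
    refine ((rsq_int 0 t).const_mul L).mono_fun'
      (((h.self.mg t).mul (h.mk0 t x).aestronglyMeasurable).restrict) (ae_of_all _ fun r => ?_)
    dsimp only
    rw [norm_mul, norm_eq_abs, norm_eq_abs, abs_of_nonneg (hk_nonneg _ _)]
    exact mul_le_mul (h.db _) (hk_le _ _) (hk_nonneg _ _) h.L0
  have key := intervalIntegral.integral_eq_sub_of_hasDerivAt_of_tendsto
    (f := fun r => hH r (x - O (t - r))) (f' := fun r => hk1 r (x - O (t - r)) +
      O' (t - r) * hk r (x - O (t - r))) (fa := ι) (fb := hH t (x - O 0)) ht.1 ?_ (i1.add i2) hι ?_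
  · rw [iadd i1 i2, ← h.self.LV_eq' ht.1.le] at key
    linarith
  · intro r hr
    have d1 : HasDerivAt (fun r => O (t - r)) (-O' (t - r)) r := by
      have := (h.Od (t - r) ⟨by linarith [hr.2], by linarith [hr.1, ht.2]⟩).comp_const_sub t r
      simpa using this
    have := hH_hasDerivAt (ρ := id) (y := fun r => x - O (t - r)) hr.1 (hasDerivAt_id r) (d1.const_sub x)
    refine this.congr_deriv ?_
    simp only [id]; ring
  · have c : ContinuousAt (fun r => ((r, x - O (t - r)) : RP)) t := by fun_prop
    have := (hH_cont (q := (t, x - O (t - t))) ht.1).tendsto.comp c.tendsto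
    simp only [sub_self] at this
    exact this.mono_left nhdsWithin_le_nhds

def LQ (g O O' : RF) (t x : ℝ) : ℝ :=
  (∫ r in 0..t, (g (t - r) - g t) * hk1 r (x - O (t - r))) +
    g t * (hH t (x - O 0) - LV O' O t x)

lemma Lay.LV1_LQ (h : Lay A G L g O O') {t x ι : ℝ} (ht : t ∈ Ioo 0 A)
    (hι : Tendsto (fun r => hH r (x - O (t - r))) (𝓝[>] 0) (𝓝 ι)) :
    LV1 g O t x = LQ g O O' t x - ι * g t := by
  have i1 := h.hk1_int t x ht.1.le
  have i2 : IntervalIntegrable (fun r => g (t - r) * hk1 r (x - O (t - r))) volume 0 t := by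
    refine (i1.norm.const_mul G).mono_fun'
      (((h.mg t).mul (h.mk1 t x).aestronglyMeasurable).restrict) (ae_of_all _ fun r => ?_)
    dsimp only
    rw [norm_mul]
    exact mul_le_mul_of_nonneg_right (h.gb _) (norm_nonneg _)
  rw [LQ, h.LV1_eq' ht.1.le]
  simp only [sub_mul (g _)]
  rw [isub i2 (i1.const_mul _), icm, h.ident ht hι]
  ring

lemma Lay.side (h : Lay A G L g O O') {t x : ℝ} (ht : t ∈ Ioo 0 A) :
    (x < O t → LV1 g O t x = LQ g O O' t x) ∧ (O t < x → LV1 g O t x = LQ g O O' t x - g t) ∧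
    (x = O t → LV1 g O t x = LQ g O O' t x - g t / 2) := by
  have hO := h.Ocont
  have hy : Tendsto (fun r => x - O (t - r)) (𝓝[>] 0) (𝓝 (x - O t)) := by
    have : Continuous (fun r => x - O (t - r)) := by fun_prop
    simpa using (this.tendsto 0).mono_left nhdsWithin_le_nhds
  have l := hH_lim (ρ := id) (y := fun r => x - O (t - r)) (l := 𝓝[>] 0) tendsto_id hy
  refine ⟨fun hx => ?_, fun hx => ?_, fun hx => ?_⟩
  · rw [h.LV1_LQ ht (l.2 lnn)]; ring
  · rw [h.LV1_LQ ht (l.1 lnn)]; ring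
  · rw [h.LV1_LQ (ι := 1 / 2) ht ?_]
    · ring
    · rw [← ph_zero]
      refine (ph_cont.tendsto 0).comp (squeeze_zero_norm' (a := fun r => L * √r) ?_ ?_)
      · filter_upwards [self_mem_nhdsWithin] with r hr
        have hr' : 0 < r := hr
        have h2 := sqrt_pos.2 hr'
        have h1 := h.OL t (t - r)
        rw [show t - (t - r) = r by ring, abs_of_pos hr'] at h1
        rw [norm_div, norm_eq_abs, norm_eq_abs, abs_of_pos (by positivity : 0 < 2 * √r), hx,
          div_le_iff₀ psv]
        nlinarith [sq_sqrt hr'.le, mul_nonneg h.L0 hr'.le]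
      · have : Continuous (fun r : ℝ => L * √r) := by fun_prop
        simpa using (this.tendsto 0).mono_left nhdsWithin_le_nhds

lemma Lay.LQ_cont (h : Lay A G L g O O') {t x : ℝ} (ht : t ∈ Ioo 0 A) :
    ContinuousAt (fun q : RP => LQ g O O' q.1 q.2) (t, x) := by
  have hO := h.Ocont
  have cg : ContinuousAt g t := h.gca ht.1.ne' ht.2.ne
  have cg' : ContinuousAt (fun q : RP => g q.1) (t, x) :=
    ContinuousAt.comp (x := (t, x)) (f := Prod.fst) cg fpp
  refine ContinuousAt.add ?_ (cg'.mul (ContinuousAt.sub ?_ h.self.cont.continuousAt))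
  swap
  · exact (hH_cont (q := (t, x - O 0)) ht.1).comp (x := (t, x)) (f := fun q : RP => (q.1, q.2 - O 0)) fpp
  rw [Metric.continuousAt_iff']
  intro ε hε
  set C := exp ((|x - O t| + 1) * L / 2) * (1 + L * (2 * √1)) with hC
  have hL := h.L0
  have hC0 : 0 < C := by positivity
  -- modulus
  obtain ⟨δ, hδ, hδg⟩ := Metric.continuousAt_iff.1 cg (ε / (8 * C)) psv
  set η := min (min (δ / 3) (t / 2)) 1 with hη
  have hη0 : 0 < η := by have := ht.1; positivity
  have hη1 : η ≤ δ / 3 := (min_le_left _ _).trans (min_le_left _ _)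
  have hη2 : η ≤ t / 2 := (min_le_left _ _).trans (min_le_right _ _)
  have hη3 : η ≤ 1 := min_le_right _ _
  have near : ∀ᶠ q : RP in 𝓝 (t, x), |q.1 - t| < η ∧ |q.2 - O q.1| < |x - O t| + 1 := by
    have c1 : ContinuousAt (fun q : RP => |q.1 - t|) (t, x) := by fun_prop
    have c2 : ContinuousAt (fun q : RP => |q.2 - O q.1|) (t, x) := by fun_prop
    exact (c1.eventually (gt_mem_nhds (by simpa using hη0))).and
      (c2.eventually (gt_mem_nhds (by simp)))
  let J : ℝ × ℝ → ℝ := fun q => ∫ r in η..q.1, (g (q.1 - r) - g q.1) * hk1 r (q.2 - O (q.1 - r))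
  have small : ∀ᶠ q : RP in 𝓝 (t, x),
      |(∫ r in 0..q.1, (g (q.1 - r) - g q.1) * hk1 r (q.2 - O (q.1 - r))) - J q| ≤ ε / 4 := by
    filter_upwards [near] with q hq
    have hq1 := abs_lt.1 hq.1
    have ii : ∀ b, 0 ≤ b → IntervalIntegrable
        (fun r => (g (q.1 - r) - g q.1) * hk1 r (q.2 - O (q.1 - r))) volume 0 b := by
      intro b hb
      refine ((h.hk1_int q.1 q.2 hb).norm.const_mul (G + G)).mono_fun'
        ((((h.mg q.1).sub aestronglyMeasurable_const).mul
          (h.mk1 q.1 q.2).aestronglyMeasurable).restrict) (ae_of_all _ fun r => ?_)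
      dsimp only
      rw [norm_mul]
      exact mul_le_mul_of_nonneg_right ((norm_sub_le _ _).trans (add_le_add (h.gb _) (h.gb _)))
        (norm_nonneg _)
    have hsplit := iisl (ii q.1 lnn) (ii η hη0.le)
    have e : (∫ r in 0..q.1, (g (q.1 - r) - g q.1) * hk1 r (q.2 - O (q.1 - r))) - J q
        = ∫ r in 0..η, (g (q.1 - r) - g q.1) * hk1 r (q.2 - O (q.1 - r)) := by
      simp only [J]; linarith
    rw [e]
    have b := h.hk1_bd (t := q.1) (x := q.2) (c := ε / (4 * C)) hη0 hq.2.le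
      (f := fun r => g (q.1 - r) - g q.1) ?_
    · refine b.trans ?_
      have : exp ((|x - O t| + 1) * L / 2) * (1 + L * (2 * √η)) ≤ C := by
        rw [hC]; gcongr
      calc ε / (4 * C) * (exp ((|x - O t| + 1) * L / 2) * (1 + L * (2 * √η)))
          ≤ ε / (4 * C) * C := by gcongr
        _ = ε / 4 := by field_simp
    · intro r hr
      have d1 := hδg (x := q.1 - r) (by rw [Real.dist_eq, abs_lt]; constructor <;> linarith [hr.1, hr.2])
      have d2 := hδg (x := q.1) (by rw [Real.dist_eq, abs_lt]; constructor <;> linarith)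
      have := dist_triangle_right (g (q.1 - r)) (g q.1) (g t)
      rw [Real.dist_eq] at this
      calc _ ≤ _ := this
        _ ≤ ε / (8 * C) + ε / (8 * C) := by linarith
        _ = _ := by field_simp; norm_num
  have Jc : ContinuousAt J (t, x) := by
    have e : J =ᶠ[𝓝 (t, x)] fun q => ∫ r, (Ioc η q.1).indicator
        (fun r => (g (q.1 - r) - g q.1) * hk1 r (q.2 - O (q.1 - r))) r := by
      filter_upwards [near] with q hq
      have hq1 := abs_lt.1 hq.1
      simp only [J]
      rw [integral_indicator measurableSet_Ioc, iole lnn]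
    refine ContinuousAt.congr ?_ e.symm
    refine continuousAt_of_dominated (bound := (Ioc η (t + 1)).indicator fun _ => (G + G) * (1 / η)) ?_ ?_ ?_ ?_
    · exact Eventually.of_forall fun q => ((((h.mg q.1).sub aestronglyMeasurable_const).mul
          (h.mk1 q.1 q.2).aestronglyMeasurable)).indicator measurableSet_Ioc
    · filter_upwards [near] with q hq
      refine ae_of_all _ fun r => ?_
      have hq1 := abs_lt.1 hq.1
      by_cases hr : r ∈ Ioc η q.1
      · rw [indicator_of_mem hr, indicator_of_mem (show r ∈ Ioc η (t + 1) from ⟨hr.1, by linarith [hr.2]⟩), norm_mul]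
        refine mul_le_mul ((norm_sub_le _ _).trans (add_le_add (h.gb _) (h.gb _))) ?_ (norm_nonneg _)
          (by linarith [h.G0])
        refine (hk1_le _ _).trans ?_
        rw [abs_of_pos (hη0.trans hr.1)]
        exact one_div_le_one_div_of_le hη0 hr.1.le
      · rw [indicator_of_notMem hr, norm_zero]
        exact indicator_nonneg (fun _ _ => by have := h.G0; positivity) _
    · rw [integrable_indicator_iff measurableSet_Ioc]; exact integrableOn_const (by simp)
    · have e : ∀ᵐ r : ℝ, r ∉ ({t, t - A, η} : Set ℝ) :=
        compl_mem_ae_iff.2 ((Set.toFinite _).measure_zero volume)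
      filter_upwards [e] with r hr
      simp only [mem_insert_iff, mem_singleton_iff, not_or] at hr
      by_cases hrr : η < r ∧ r < t
      · have ev : ∀ᶠ q : RP in 𝓝 (t, x), r < q.1 :=
          (continuous_fst.continuousAt (x := (t, x))).eventually (lt_mem_nhds hrr.2)
        refine ContinuousAt.congr (f := fun q : RP =>
          (g (q.1 - r) - g q.1) * hk1 r (q.2 - O (q.1 - r))) ?_ ?_
        · refine ContinuousAt.mul (ContinuousAt.sub ?_ cg') ?_
          · refine ContinuousAt.comp (x := (t, x)) (f := fun q : RP => q.1 - r) (h.gca ?_ ?_) fpp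
            · exact fun hh => hr.1 (by simp at hh; linarith)
            · exact fun hh => hr.2.1 (by simp at hh; linarith)
          · exact (hk_continuousAt (q := (r, x - O (t - r)))
              (fun hh => (hη0.trans hrr.1).ne' (congrArg Prod.fst hh))).2.1.comp
              (x := (t, x)) (f := fun q : RP => (r, q.2 - O (q.1 - r))) fpp
        · filter_upwards [ev] with q hq
          rw [indicator_of_mem (show r ∈ Ioc η q.1 from ⟨hrr.1, hq.le⟩)]
      · refine (continuousAt_const (y := (0:ℝ))).congr ?_
        by_cases h1 : η < r
        · have h2 : t < r := lt_of_le_of_ne (not_lt.1 fun h2 => hrr ⟨h1, h2⟩) (Ne.symm hr.1)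
          filter_upwards [(continuous_fst.continuousAt (x := (t, x))).eventually (gt_mem_nhds h2)] with q hq
          rw [indicator_of_notMem fun hh => (not_le.2 hq) hh.2]
        · filter_upwards with q
          rw [indicator_of_notMem fun hh => h1 hh.1]
  filter_upwards [small, (Metric.continuousAt_iff'.1 Jc) (ε / 4) psv] with q h1 h2
  have h3 := small.self_of_nhds
  rw [Real.dist_eq] at h2 ⊢
  rw [abs_le] at h1 h3
  rw [abs_lt] at h2 ⊢
  constructor <;> linarith [h1.1, h1.2, h2.1, h2.2, h3.1, h3.2]
end

structure LipB (B K : ℝ) (ψ : RF) : Prop where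
  z : ∀ ξ ∉ Icc (-B) B, ψ ξ = 0
  l : ∀ a b, |ψ a - ψ b| ≤ K * |a - b|

def FF (ψ : RF) (t x : ℝ) : ℝ := ∫ ξ, ψ ξ * hk t (x - ξ)
def FF1 (ψ : RF) (t x : ℝ) : ℝ := ∫ ξ, ψ ξ * hk1 t (x - ξ)
def FF2 (ψ : RF) (t x : ℝ) : ℝ := ∫ ξ, ψ ξ * hk2 t (x - ξ)

section
variable {B K : ℝ} {ψ : RF}

lemma LipB.c (h : LipB B K ψ) : Continuous ψ :=
  (LipschitzWith.of_dist_le_mul (K := ⟨|K|, abs_nonneg K⟩) fun a b => by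
    rw [Real.dist_eq, Real.dist_eq]
    exact (h.l a b).trans (mul_le_mul_of_nonneg_right (le_abs_self K) (abs_nonneg _))).continuous

lemma LipB.K0 (h : LipB B K ψ) : 0 ≤ K := by
  have := (abs_nonneg _).trans (h.l 1 0); simpa using this

lemma LipB.int (h : LipB B K ψ) : Integrable ψ :=
  h.c.integrable_of_hasCompactSupport (HasCompactSupport.intro isCompact_Icc h.z)

lemma LipB.off (h : LipB B K ψ) {t : ℝ} (ht : 0 < t) (x : ℝ) :
    HasDerivAt (FF ψ t) (FF1 ψ t x) x ∧ HasDerivAt (FF1 ψ t) (FF2 ψ t x) x ∧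
    HasDerivAt (fun t => FF ψ t x) (FF2 ψ t x) t ∧
    ContinuousAt (fun q : RP => FF ψ q.1 q.2) (t, x) ∧
    ContinuousAt (fun q : RP => FF1 ψ q.1 q.2) (t, x) ∧
    ContinuousAt (fun q : RP => FF2 ψ q.1 q.2) (t, x) := by
  have ne : ∀ j, ((t, x - j) : RP) ≠ 0 := fun j hh => ht.ne' (congrArg Prod.fst hh)
  have m0 : ∀ t x, Measurable (fun j => hk t (x - j)) := fun t x =>
    hk_meas.comp (by fun_prop : Measurable fun j => (t, x - j))
  have m1 : ∀ t x, Measurable (fun j => hk1 t (x - j)) := fun t x =>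
    hk1_meas.comp (by fun_prop : Measurable fun j => (t, x - j))
  have m2 : ∀ t x, Measurable (fun j => hk2 t (x - j)) := fun t x =>
    hk2_meas.comp (by fun_prop : Measurable fun j => (t, x - j))
  refine ⟨?_, ?_, ?_, ?_, ?_, ?_⟩
  · refine GD (κ := fun x j => hk t (x - j)) (κ' := fun x j => hk1 t (x - j)) h.int h.z (m0 t) (m1 t x) ?_ ?_ ?_
    · intro j _
      exact (hk_continuousAt (ne j)).1.comp (f := fun j => (t, x - j)) fpp
    · intro j _
      exact (hk_continuousAt (ne j)).2.1.comp (x := (x, j)) (f := fun q : RP => (t, q.1 - q.2)) fpp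
    · refine Eventually.of_forall fun q j _ => ?_
      simpa using (hk_hasDerivAt t (q - j)).comp_sub_const q j
  · refine GD (κ := fun x j => hk1 t (x - j)) (κ' := fun x j => hk2 t (x - j)) h.int h.z (m1 t) (m2 t x) ?_ ?_ ?_
    · intro j _
      exact (hk_continuousAt (ne j)).2.1.comp (f := fun j => (t, x - j)) fpp
    · intro j _
      exact (hk_continuousAt (ne j)).2.2.comp (x := (x, j)) (f := fun q : RP => (t, q.1 - q.2)) fpp
    · refine Eventually.of_forall fun q j _ => ?_
      simpa using (hk1_hasDerivAt t (q - j)).comp_sub_const q j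
  · refine GD (κ := fun t j => hk t (x - j)) (κ' := fun t j => hk2 t (x - j)) h.int h.z (fun t => m0 t x) (m2 t x) ?_ ?_ ?_
    · intro j _
      exact (hk_continuousAt (ne j)).1.comp (f := fun j => (t, x - j)) fpp
    · intro j _
      exact (hk_continuousAt (ne j)).2.2.comp (x := (t, j)) (f := fun q : RP => (q.1, x - q.2)) fpp
    · filter_upwards [lt_mem_nhds ht] with q hq j _
      exact hk_hasDerivAt_t hq _
  · refine GC (κ := fun q : RP => fun j => hk q.1 (q.2 - j)) h.int h.z (fun q => m0 q.1 q.2) fun j _ => ?_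
    exact (hk_continuousAt (ne j)).1.comp (x := ((t, x), j))
      (f := fun q : (ℝ × ℝ) × ℝ => (q.1.1, q.1.2 - q.2)) fpp
  · refine GC (κ := fun q : RP => fun j => hk1 q.1 (q.2 - j)) h.int h.z (fun q => m1 q.1 q.2) fun j _ => ?_
    exact (hk_continuousAt (ne j)).2.1.comp (x := ((t, x), j))
      (f := fun q : (ℝ × ℝ) × ℝ => (q.1.1, q.1.2 - q.2)) fpp
  · refine GC (κ := fun q : RP => fun j => hk2 q.1 (q.2 - j)) h.int h.z (fun q => m2 q.1 q.2) fun j _ => ?_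
    exact (hk_continuousAt (ne j)).2.2.comp (x := ((t, x), j))
      (f := fun q : (ℝ × ℝ) × ℝ => (q.1.1, q.1.2 - q.2)) fpp

lemma FF_eq (ψ : RF) (t x : ℝ) : FF ψ t x = ∫ y, ψ (x - y) * hk t y := by
  rw [FF, ← integral_sub_left_eq_self _ volume x]; simp
lemma FF1_eq (ψ : RF) (t x : ℝ) : FF1 ψ t x = ∫ y, ψ (x - y) * hk1 t y := by
  rw [FF1, ← integral_sub_left_eq_self _ volume x]; simp

lemma LipB.bd (h : LipB B K ψ) : ∃ M, 0 ≤ M ∧ ∀ x, |ψ x| ≤ M := by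
  obtain ⟨C, hC⟩ := h.c.bounded_above_of_compact_support (HasCompactSupport.intro isCompact_Icc h.z)
  exact ⟨C, (norm_nonneg _).trans (hC 0), hC⟩

lemma LipB.i0 (h : LipB B K ψ) (t x : ℝ) : Integrable fun y => ψ (x - y) * hk t y := by
  obtain ⟨M, _, hM⟩ := h.bd
  have := h.c
  exact (hk_int t).bdd_mul (c := M) fpp (ae_of_all _ fun y => hM _)

lemma hk1_absint {t : ℝ} (ht : 0 < t) : Integrable (hk1 t) ∧ ∫ y, |hk1 t y| ≤ 2 / √t := by
  have b := (hk_int (2 * t)).const_mul (2 / √t)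
  have i : Integrable (hk1 t) := b.mono' (hk1_cont t).aestronglyMeasurable
    (ae_of_all _ fun y => hk1_le_hk ht y)
  refine ⟨i, (integral_mono i.abs b fun y => hk1_le_hk ht y).trans (le_of_eq ?_)⟩
  rw [integral_const_mul, (hk_integral psv).2, mul_one]

lemma LipB.i1 (h : LipB B K ψ) {t : ℝ} (ht : 0 < t) (x : ℝ) : Integrable fun y => ψ (x - y) * hk1 t y := by
  obtain ⟨M, _, hM⟩ := h.bd
  have := h.c
  exact (hk1_absint ht).1.bdd_mul (c := M) fpp (ae_of_all _ fun y => hM _)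

lemma LipB.FFbd (_h : LipB B K ψ) {M : ℝ} (hM : ∀ x, |ψ x| ≤ M) (t x : ℝ) : |FF ψ t x| ≤ M := by
  have hM0 := (abs_nonneg _).trans (hM 0)
  rcases le_or_gt t 0 with ht | ht
  · simp [FF, hk_of_nonpos ht, hM0]
  rw [FF_eq, ← norm_eq_abs]
  refine (norm_integral_le_of_norm_le ((hk_int t).const_mul M) (ae_of_all _ fun y => ?_)).trans ?_
  · rw [norm_mul, norm_eq_abs, norm_eq_abs, abs_of_nonneg (hk_nonneg _ _)]
    exact mul_le_mul_of_nonneg_right (hM _) (hk_nonneg _ _)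
  · rw [integral_const_mul, (hk_integral ht).2, mul_one]

lemma LipB.FFlip (h : LipB B K ψ) {t : ℝ} (ht : 0 < t) (a b : ℝ) : |FF ψ t a - FF ψ t b| ≤ K * |a - b| := by
  rw [FF_eq, FF_eq, ← integral_sub (h.i0 t a) (h.i0 t b), ← norm_eq_abs]
  refine (norm_integral_le_of_norm_le ((hk_int t).const_mul (K * |a - b|)) (ae_of_all _ fun y => ?_)).trans ?_
  · rw [← sub_mul, norm_mul, norm_eq_abs, norm_eq_abs, abs_of_nonneg (hk_nonneg _ _)]
    refine mul_le_mul_of_nonneg_right ?_ (hk_nonneg _ _)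
    simpa using h.l (a - y) (b - y)
  · rw [integral_const_mul, (hk_integral ht).2, mul_one]

lemma LipB.FF1lip (h : LipB B K ψ) {t : ℝ} (ht : 0 < t) (a b : ℝ) :
    |FF1 ψ t a - FF1 ψ t b| ≤ K * |a - b| * (2 / √t) := by
  have hK := h.K0
  rw [FF1_eq, FF1_eq, ← integral_sub (h.i1 ht a) (h.i1 ht b), ← norm_eq_abs]
  refine (norm_integral_le_of_norm_le ((hk1_absint ht).1.abs.const_mul (K * |a - b|))
    (ae_of_all _ fun y => ?_)).trans ?_
  · rw [← sub_mul, norm_mul, norm_eq_abs, norm_eq_abs]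
    refine mul_le_mul_of_nonneg_right ?_ (abs_nonneg _)
    simpa using h.l (a - y) (b - y)
  · rw [integral_const_mul]
    exact mul_le_mul_of_nonneg_left (hk1_absint ht).2 psv

lemma LipB.FF1bd (h : LipB B K ψ) {t : ℝ} (ht : 0 < t) (x : ℝ) : |FF1 ψ t x| ≤ K := by
  have := (h.off ht x).1.le_of_lip' (C := K) h.K0 (Eventually.of_forall fun y => by
    simpa using h.FFlip ht y x)
  simpa using this

lemma LipB.FFini (h : LipB B K ψ) {t : ℝ} (ht : 0 < t) (x : ℝ) : |FF ψ t x - ψ x| ≤ K * (4 * √t) := by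
  have e : ψ x = ∫ y, ψ x * hk t y := by rw [integral_const_mul, (hk_integral ht).2, mul_one]
  rw [FF_eq, e, ← integral_sub (h.i0 t x) ((hk_int t).const_mul _), ← norm_eq_abs]
  refine (norm_integral_le_of_norm_le ((hk_int (2 * t)).const_mul (K * (4 * √t)))
    (ae_of_all _ fun y => ?_)).trans ?_
  · have h1 := h.l (x - y) x
    have h2 := hk1_le_hk ht y
    have h0 := hk_nonneg t y
    have h3 : |y| * hk t y ≤ 4 * √t * hk (2 * t) y := by
      have e1 : |y| * hk t y = 2 * t * |hk1 t y| := by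
        rw [hk1, abs_mul, abs_neg, abs_div, abs_of_nonneg h0, abs_of_pos (by positivity : 0 < 2 * t)]
        field_simp
      rw [e1]
      calc 2 * t * |hk1 t y| ≤ 2 * t * (2 / √t * hk (2 * t) y) := by gcongr
        _ = 4 * (t / √t) * hk (2 * t) y := by ring
        _ = _ := by rw [Real.div_sqrt]
    rw [← sub_mul, norm_mul, norm_eq_abs, norm_eq_abs, abs_of_nonneg h0]
    rw [show x - y - x = -y by ring, abs_neg] at h1
    calc _ ≤ K * |y| * hk t y := by gcongr
      _ = K * (|y| * hk t y) := by ring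
      _ ≤ K * (4 * √t * hk (2 * t) y) := mul_le_mul_of_nonneg_left h3 h.K0
      _ = _ := by ring
  · rw [integral_const_mul, (hk_integral psv).2, mul_one]

def F0 (ψ : RF) (t x : ℝ) : ℝ := if t ≤ 0 then ψ x else FF ψ t x

lemma LipB.F0c (h : LipB B K ψ) : Continuous (fun q : RP => F0 ψ q.1 q.2) := by
  have hc := h.c
  rw [continuous_iff_continuousAt]
  rintro ⟨t, x⟩
  rcases lt_trichotomy t 0 with ht | ht | ht
  · refine ContinuousAt.congr (f := fun q : RP => ψ q.2) fpp ?_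
    filter_upwards [(continuous_fst.continuousAt (x := (t, x))).eventually (gt_mem_nhds ht)] with q hq
    simp [F0, le_of_lt hq]
  · subst ht
    have e : F0 ψ 0 x = ψ x := by simp [F0]
    rw [ContinuousAt, tendsto_iff_norm_sub_tendsto_zero]
    have c : Continuous (fun q : RP => K * (4 * √q.1) + K * |q.2 - x|) := by fun_prop
    have c' := c.tendsto (0, x)
    simp only [Real.sqrt_zero, mul_zero, sub_self, abs_zero, add_zero] at c'
    refine squeeze_zero (fun _ => norm_nonneg _) (fun q => ?_) c'
    dsimp only
    rw [e, norm_eq_abs]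
    have h1 := h.l q.2 x
    by_cases hq : q.1 ≤ 0
    · simp only [F0, hq, if_true, sqrt_eq_zero_of_nonpos hq]; simpa using h1
    · simp only [F0, hq, if_false]
      have h2 := h.FFini (not_le.1 hq) q.2
      rw [abs_le] at *
      constructor <;> linarith [h1.1, h1.2, h2.1, h2.2]
  · refine (h.off ht x).2.2.2.1.congr ?_
    filter_upwards [(continuous_fst.continuousAt (x := (t, x))).eventually (lt_mem_nhds ht)] with q hq
    simp [F0, not_le.2 hq]

lemma FF_even (he : ∀ x, ψ (-x) = ψ x) (t x : ℝ) : FF ψ t (-x) = FF ψ t x := by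
  rw [FF, FF, ← integral_neg_eq_self]
  congr 1; ext ξ
  rw [he, ← hk_neg]; congr 2; ring
lemma FF1_odd (he : ∀ x, ψ (-x) = ψ x) (t x : ℝ) : FF1 ψ t (-x) = -FF1 ψ t x := by
  rw [FF1, FF1, ← integral_neg_eq_self, ← integral_neg]
  congr 1; ext ξ
  rw [he, ← mul_neg, ← hk1_neg]; congr 2; ring
end

structure Cl (p a b : ℝ) (S V : RF) (U X Z : RG) : Prop where
  ab : a < b
  Sc : Continuous S
  Sp : ∀ t, 0 < S t
  Vc : Continuous V
  V0 : ∀ t, 0 ≤ V t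
  Sd : ∀ t ∈ Ioo a b, HasDerivAt S (V t) t
  Uc : Continuous fun q : RP => U q.1 q.2
  Xc : Continuous fun q : RP => X q.1 q.2
  Ue : ∀ t x, U t (-x) = U t x
  Uz : ∀ t x, S t ≤ |x| → U t x = 0
  U0 : ∀ t x, 0 ≤ U t x
  Ud : ∀ t, ∀ x ∈ Ioo 0 (S t), HasDerivAt (U t) (X t x) x
  Ut : ∀ t ∈ Ioo a b, ∀ x ∈ Ioo 0 (S t), HasDerivAt (fun j => U j x) (Z t x) t
  Xd : ∀ t ∈ Ioo a b, ∀ x ∈ Ioo 0 (S t), HasDerivAt (X t) (Z t x) x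
  Zc : ContinuousOn (fun q : RP => Z q.1 q.2) {q | q.1 ∈ Ioo a b ∧ q.2 ∈ Ioo 0 (S q.1)}
  X0 : ∀ t, X t 0 = -(U t 0) ^ p
  XS : ∀ t, X t (S t) = -V t

structure Tst (P : ℝ) (ψ ψ' : RF) : Prop where
  c : Continuous ψ
  d : ∃ C : Set ℝ, C.Countable ∧ ∀ x ∉ C, HasDerivAt ψ (ψ' x) x
  m : Measurable ψ'
  b : ∀ x, |ψ' x| ≤ P

lemma Tst.i {P : ℝ} {ψ ψ' : RF} (h : Tst P ψ ψ') (α β : ℝ) : IntervalIntegrable ψ' volume α β :=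
  (intervalIntegrable_const (c := P)).mono_fun' h.m.aestronglyMeasurable (ae_of_all _ fun x => h.b x)

lemma Tst.iX {P : ℝ} {ψ ψ' : RF} (h : Tst P ψ ψ') {f : RF} (hf : Continuous f) (α β : ℝ) :
    IntervalIntegrable (fun x => f x * ψ' x) volume α β := (h.i α β).continuousOn_mul hf.continuousOn

lemma Tst.pc {P : ℝ} {ψ ψ' : RF} (h : Tst P ψ ψ') {Y : Type*} [TopologicalSpace Y]
    [FirstCountableTopology Y] {f : Y → ℝ → ℝ} (hf : Continuous fun q : Y × ℝ => f q.1 q.2) {α β : Y → ℝ} (hα : Continuous α) (hβ : Continuous β) :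
    Continuous fun j => ∫ x in α j..β j, f j x * ψ' x := by
  have i : ∀ j, ∫ x in α j..β j, f j x * ψ' x = (∫ x in 0..β j, f j x * ψ' x) - ∫ x in 0..α j, f j x * ψ' x := by
    intro j
    have c : Continuous (f j) := by fun_prop
    rw [iisl (h.iX c _ _) (h.iX c _ _)]
  simp_rw [i]
  have key : ∀ β : Y → ℝ, Continuous β → Continuous fun j => ∫ x in 0..β j, f j x * ψ' x := by
    intro β hβ
    have e2 : Continuous fun q : Y × ℝ => ∫ x in 0..q.2, f q.1 x * ψ' x := by
      rw [continuous_iff_continuousAt]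
      rintro ⟨j, y⟩
      have hc : ∀ j, Continuous (f j) := fun j => by fun_prop
      obtain ⟨C, hC0, hC⟩ := GCbd (κ := f) (q₀ := j) (a := -(|y| + 1)) (b := |y| + 1)
        (fun j _ => hf.continuousAt)
      have := intervalIntegral.continuousAt_parametric_primitive_of_dominated (a := -(|y| + 1)) (b := |y| + 1)
        (μ := volume) (F := fun j x => f j x * ψ' x) (bound := fun _ => C * P) (a₀ := 0) (b₀ := y) (x₀ := j)
        (fun j => ((hc j).aestronglyMeasurable.mul h.m.aestronglyMeasurable).restrict) ?_
        intervalIntegrable_const ?_ ?_ ?_ (by simp)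
      · exact this
      · filter_upwards [hC] with q hq
        refine (ae_restrict_iff' measurableSet_uIoc).2 (ae_of_all _ fun x hx => ?_)
        rw [norm_mul]
        have hx' := uIoc_subset_uIcc hx
        rw [uIcc_of_le (by linarith [abs_nonneg y])] at hx'
        exact mul_le_mul (hq x hx') (h.b x) (norm_nonneg _) hC0
      · exact ae_of_all _ fun x => by fun_prop
      · constructor <;> linarith [abs_nonneg y]
      · constructor <;> linarith [neg_abs_le y, le_abs_self y]
    exact e2.comp (by fun_prop : Continuous fun j => (j, β j))
  exact (key β hβ).sub (key α hα)

section
variable {p a b : ℝ} {S V : RF} {U X Z : RG} (H : Cl p a b S V U X Z)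
include H

lemma Cl.mono {t t' : ℝ} (ht : t ∈ Icc a b) (ht' : t' ∈ Icc a b) (h : t ≤ t') : S t ≤ S t' := by
  refine (monotoneOn_of_deriv_nonneg (convex_Icc a b) H.Sc.continuousOn ?_ ?_) ht ht' h
  · intro x hx; rw [interior_Icc] at hx; exact (H.Sd x hx).differentiableAt.differentiableWithinAt
  · intro x hx; rw [interior_Icc] at hx; rw [(H.Sd x hx).deriv]; exact H.V0 x

lemma Cl.rect {P : ℝ} {ψ ψ' : RF} (h : Tst P ψ ψ') {t t' : ℝ} (ht : t ∈ Ioo a b) (ht' : t' ∈ Ioo a b)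
    (htt : t ≤ t') : ∫ x in 0..S t, (U t' x - U t x) * ψ x =
      ∫ j in t..t', (X j (S t) * ψ (S t) - X j 0 * ψ 0 - ∫ x in 0..S t, X j x * ψ' x) := by
  have hUc := H.Uc
  have hXc := H.Xc
  have hψ := h.c
  have hS := H.Sp t
  have hsub : ∀ j ∈ Icc t t', j ∈ Ioo a b := fun j hj => ⟨ht.1.trans_le hj.1, hj.2.trans_lt ht'.2⟩
  have hSm : ∀ j ∈ Icc t t', S t ≤ S j := fun j hj =>
    H.mono ⟨ht.1.le, ht.2.le⟩ ⟨(hsub j hj).1.le, (hsub j hj).2.le⟩ hj.1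
  have cX : ∀ j, Continuous (X j) := fun j => by fun_prop
  -- inset identity
  have ins : ∀ ε ∈ Ioo 0 (S t / 2), ∫ x in ε..(S t - ε), (U t' x - U t x) * ψ x =
      ∫ j in t..t', (X j (S t - ε) * ψ (S t - ε) - X j ε * ψ ε - ∫ x in ε..(S t - ε), X j x * ψ' x) := by
    intro ε hε
    have hle : ε ≤ S t - ε := by linarith [hε.2]
    have dom : ∀ j ∈ Icc t t', ∀ x ∈ Icc ε (S t - ε), x ∈ Ioo 0 (S j) := fun j hj x hx =>
      ⟨hε.1.trans_le hx.1, by linarith [hSm j hj, hx.2, hε.1]⟩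
    have hZ : ContinuousOn (fun q : RP => Z q.1 q.2) (Icc t t' ×ˢ Icc ε (S t - ε)) :=
      H.Zc.mono fun q hq => ⟨hsub _ hq.1, dom _ hq.1 _ hq.2⟩
    have e1 : ∀ x ∈ Icc ε (S t - ε), U t' x - U t x = ∫ j in t..t', Z j x := by
      intro x hx
      refine (ftc (f := fun j => U j x) ?_ ?_).symm
      · intro j hj; rw [uIcc_of_le htt] at hj
        exact H.Ut j (hsub j hj) x (dom j hj x hx)
      · refine ContinuousOn.intervalIntegrable ?_
        rw [uIcc_of_le htt]
        exact hZ.comp (f := fun j => (j, x)) fpp fun j hj => ⟨hj, hx⟩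
    have e2 : ∀ j ∈ Icc t t', ∫ x in ε..(S t - ε), Z j x * ψ x =
        X j (S t - ε) * ψ (S t - ε) - X j ε * ψ ε - ∫ x in ε..(S t - ε), X j x * ψ' x := by
      intro j hj
      obtain ⟨C, hC, hd⟩ := h.d
      have i1 : IntervalIntegrable (fun x => Z j x * ψ x) volume ε (S t - ε) := by
        refine ContinuousOn.intervalIntegrable ?_
        rw [uIcc_of_le hle]
        exact (hZ.comp (f := fun x => (j, x)) fpp fun x hx => ⟨hj, hx⟩).mul hψ.continuousOn
      have i2 := h.iX (cX j) ε (S t - ε)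
      have := integral_eq_of_hasDerivAt_off_countable_of_le (fun x => X j x * ψ x)
        (fun x => Z j x * ψ x + X j x * ψ' x) hle hC fpp (fun x hx => ?_) (i1.add i2)
      · rw [iadd i1 i2] at this
        linarith
      · exact (H.Xd j (hsub j hj) x (dom j hj x ⟨hx.1.1.le, hx.1.2.le⟩)).mul (hd x hx.2)
    have s1 : ∫ x in ε..(S t - ε), (U t' x - U t x) * ψ x = ∫ x in ε..(S t - ε), ∫ j in t..t', Z j x * ψ x := by
      refine icon fun x hx => ?_
      rw [uIcc_of_le hle] at hx
      simp only [intervalIntegral.integral_mul_const, e1 x hx]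
    rw [s1, intervalIntegral_intervalIntegral_swap]
    · refine icon fun j hj => ?_
      rw [uIcc_of_le htt] at hj
      exact e2 j hj
    · have c : ContinuousOn (fun q : RP => Z q.2 q.1 * ψ q.1) (Icc ε (S t - ε) ×ˢ Icc t t') := by
        refine ContinuousOn.mul ?_ fpp
        exact hZ.comp (f := fun q : RP => (q.2, q.1)) fpp fun q hq => ⟨hq.2, hq.1⟩
      refine (c.integrableOn_compact (isCompact_Icc.prod isCompact_Icc)).mono_set ?_
      rw [uIoc_of_le hle, uIoc_of_le htt]
      exact prod_mono Ioc_subset_Icc_self Ioc_subset_Icc_self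
  -- pass to the limit
  have l1 : Continuous fun ε => ∫ x in ε..(S t - ε), (U t' x - U t x) * ψ x := by
    have hh : Continuous fun x => (U t' x - U t x) * ψ x := by fun_prop
    have e : ∀ ε, ∫ x in ε..(S t - ε), (U t' x - U t x) * ψ x =
        (∫ x in 0..(S t - ε), (U t' x - U t x) * ψ x) - ∫ x in 0..ε, (U t' x - U t x) * ψ x := by
      intro ε
      rw [iisl (hh.intervalIntegrable _ _) (hh.intervalIntegrable _ _)]
    simp_rw [e]
    have pr := intervalIntegral.continuous_primitive (μ := volume) (fun a b => hh.intervalIntegrable a b) 0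
    exact (pr.comp (by fun_prop : Continuous fun ε => S t - ε)).sub pr
  have l2 : Continuous fun ε => ∫ j in t..t', (X j (S t - ε) * ψ (S t - ε) - X j ε * ψ ε - ∫ x in ε..(S t - ε), X j x * ψ' x) := by
    refine cpi' ?_ _ _
    refine Continuous.sub fpp ?_
    exact h.pc (Y := ℝ × ℝ) (f := fun q => X q.2) (α := fun q => q.1) (β := fun q => S t - q.1) fpp fpp fpp
  have m : Ioo 0 (S t / 2) ∈ 𝓝[>] (0:ℝ) := Ioo_mem_nhdsGT lnn
  have t1 := (l1.tendsto 0).mono_left (nhdsWithin_le_nhds (s := Ioi 0))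
  have t2 := (l2.tendsto 0).mono_left (nhdsWithin_le_nhds (s := Ioi 0))
  have := tendsto_nhds_unique (t1.congr' (by filter_upwards [m] with ε hε using ins ε hε)) t2
  simpa using this
end

section
variable {p a b : ℝ} {S V : RF} {U X Z : RG} (H : Cl p a b S V U X Z)
include H

lemma Cl.wc (hp : 1 < p) : Continuous fun t => (U t 0) ^ p := by
  have := H.Uc
  exact (by fun_prop : Continuous fun t => U t 0).rpow_const fun t => Or.inr lnn

lemma Cl.Pc {ψ : RF} (hψ : Continuous ψ) : Continuous fun j => ∫ x in 0..S j, U j x * ψ x := by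
  have := H.Uc
  exact cpi
    (f := fun j x => U j x * ψ x) fpp H.Sc

lemma Cl.Ui {ψ : RF} (hψ : Continuous ψ) {t R : ℝ} (h : S t ≤ R) :
    ∫ x in 0..S t, U t x * ψ x = ∫ x in 0..R, U t x * ψ x := by
  have := H.Uc
  have c : Continuous fun x => U t x * ψ x := by fun_prop
  rw [← intervalIntegral.integral_add_adjacent_intervals (c.intervalIntegrable 0 (S t)) (c.intervalIntegrable (S t) R)]
  have : ∫ x in S t..R, U t x * ψ x = ∫ x in S t..R, (0:ℝ) := by
    refine icon fun x hx => ?_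
    rw [uIcc_of_le h] at hx
    simp [H.Uz t x (hx.1.trans (le_abs_self x))]
  rw [this]; simp

lemma Cl.wf {P : ℝ} {ψ ψ' : RF} (h : Tst P ψ ψ') (hp : 1 < p) {t : ℝ} (ht : t ∈ Ioo a b) :
    HasDerivAt (fun j => ∫ x in 0..S j, U j x * ψ x)
      (-V t * ψ (S t) + (U t 0) ^ p * ψ 0 - ∫ x in 0..S t, X t x * ψ' x) t := by
  have hUc := H.Uc
  have hXc := H.Xc
  have hψ := h.c
  have hSc := H.Sc
  have hVc := H.Vc
  have hw := H.wc hp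
  set R : RF := fun t => -V t * ψ (S t) + (U t 0) ^ p * ψ 0 - ∫ x in 0..S t, X t x * ψ' x with hR
  have Rc : Continuous R := Continuous.sub fpp
    (h.pc hXc (α := fun _ => 0) continuous_const hSc)
  have right : ∀ t ∈ Ioo a b, HasDerivWithinAt (fun j => ∫ x in 0..S j, U j x * ψ x) (R t) (Ici t) t := by
    intro t ht
    let r : RF := fun j => X j (S t) * ψ (S t) - X j 0 * ψ 0 - ∫ x in 0..S t, X j x * ψ' x
    have rc : Continuous r := Continuous.sub fpp
      (h.pc hXc (α := fun _ => 0) (β := fun _ => S t) continuous_const continuous_const)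
    have hA : HasDerivAt (fun t' => ∫ j in t..t', r j) (R t) t := by
      have := ihd (rc.intervalIntegrable t t)
        rc.aestronglyMeasurable.stronglyMeasurableAtFilter rc.continuousAt
      have e : R t = r t := by simp only [hR, r]; rw [H.XS, H.X0]; ring
      rw [e]; exact this
    have hB : HasDerivAt (fun t' => ∫ x in S t..S t', U t' x * ψ x) 0 t := by
      rw [hasDerivAt_iff_isLittleO]
      simp only [intervalIntegral.integral_same, sub_zero, smul_zero]
      refine Asymptotics.IsLittleO.trans_isBigO ?_ (H.Sd t ht).isBigO_sub
      rw [Asymptotics.isLittleO_iff]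
      intro c hc
      have c1 : ContinuousAt (fun q : RP => U q.1 q.2 * ψ q.2) (t, S t) := by fun_prop
      have z : U t (S t) = 0 := H.Uz t _ (le_abs_self _)
      obtain ⟨δ, hδ, hδ'⟩ := Metric.continuousAt_iff.1 c1 c hc
      filter_upwards [Metric.ball_mem_nhds t hδ, hSc.continuousAt (Metric.ball_mem_nhds (S t) hδ)] with t' h1 h2
      refine nil fun x hx => ?_
      have h3 : dist x (S t) ≤ dist (S t') (S t) := by
        rw [Real.dist_eq, Real.dist_eq]
        exact abs_sub_left_of_mem_uIcc (uIoc_subset_uIcc hx)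
      have := hδ' (x := (t', x)) (by
        rw [Prod.dist_eq]; exact max_lt h1 (h3.trans_lt h2))
      rw [Real.dist_eq] at this
      simp only [z, zero_mul, sub_zero] at this
      exact this.le
    have sum := ((hA.add hB).const_add (∫ x in 0..S t, U t x * ψ x)).hasDerivWithinAt (s := Ici t)
    rw [add_zero] at sum
    refine sum.congr_of_eventuallyEq ?_ (by simp)
    filter_upwards [Ico_mem_nhdsGE ht.2] with t' h1
    have ht' : t' ∈ Ioo a b := ⟨ht.1.trans_le h1.1, h1.2⟩
    have c1 : ∀ t', Continuous fun x => U t' x * ψ x := fun t' => by fun_prop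
    have := H.rect h ht ht' h1.1
    simp only [sub_mul (U _ _)] at this
    rw [isub ((c1 _).intervalIntegrable _ _) ((c1 _).intervalIntegrable _ _)] at this
    simp only [Pi.add_apply, r]
    rw [← this, ← intervalIntegral.integral_add_adjacent_intervals ((c1 t').intervalIntegrable 0 (S t)) ((c1 t').intervalIntegrable (S t) (S t'))]
    ring
  obtain ⟨t0, h0⟩ := exists_between ht.1
  have int : ∀ t' ∈ Ioo t0 b, ∫ x in 0..S t', U t' x * ψ x =
      (∫ x in 0..S t0, U t0 x * ψ x) + ∫ j in t0..t', R j := by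
    intro t' ht'
    have := intervalIntegral.integral_eq_sub_of_hasDeriv_right_of_le ht'.1.le (H.Pc hψ).continuousOn
      (fun x hx => (right x ⟨h0.1.trans hx.1, hx.2.trans ht'.2⟩).mono Ioi_subset_Ici_self)
      (Rc.intervalIntegrable _ _)
    rw [this]; ring
  have := (ihd (Rc.intervalIntegrable t0 t)
        Rc.aestronglyMeasurable.stronglyMeasurableAtFilter Rc.continuousAt).const_add (∫ x in 0..S t0, U t0 x * ψ x)
  refine this.congr_of_eventuallyEq ?_
  filter_upwards [isOpen_Ioo.mem_nhds (⟨h0.2, ht.2⟩ : t ∈ Ioo t0 b)] with t' h1 using int t' h1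

lemma Cl.Xb (c d : ℝ) : ∃ K, 0 ≤ K ∧ ∀ t ∈ Icc c d, ∀ x ∈ Icc 0 (S t), |X t x| ≤ K := by
  obtain ⟨M, hM⟩ := (isCompact_Icc (a := c) (b := d)).exists_bound_of_continuousOn H.Sc.continuousOn
  obtain ⟨K, hK⟩ := ((isCompact_Icc (a := c) (b := d)).prod (isCompact_Icc (a := 0) (b := M))).exists_bound_of_continuousOn H.Xc.continuousOn
  refine ⟨max K 0, le_max_right _ _, fun t ht x hx => le_max_of_le_left (hK (t, x) ⟨ht, hx.1, hx.2.trans ?_⟩)⟩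
  exact (le_abs_self _).trans (hM t ht)

lemma Cl.Umin (t x : ℝ) : U t x = U t (min |x| (S t)) := by
  have e : U t x = U t |x| := by
    rcases abs_cases x with h | h
    · rw [h.1]
    · rw [h.1, H.Ue]
  rcases le_total |x| (S t) with h | h
  · rw [min_eq_left h, e]
  · rw [min_eq_right h, H.Uz t x h, H.Uz t _ (le_abs_self _)]

lemma Cl.lip {t K : ℝ} (hK0 : 0 ≤ K) (hK : ∀ x ∈ Ioo 0 (S t), |X t x| ≤ K) : LipB (S t) K (U t) := by
  have hUc := H.Uc
  have cU : Continuous (U t) := by fun_prop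
  have key : ∀ x y, 0 ≤ x → x ≤ y → y ≤ S t → |U t x - U t y| ≤ K * |x - y| := by
    intro x y hx hxy hy
    rcases hxy.eq_or_lt with rfl | hxy
    · simp
    obtain ⟨c, hc, e⟩ := exists_hasDerivAt_eq_slope (U t) (X t) hxy cU.continuousOn
      fun z hz => H.Ud t z ⟨hx.trans_lt hz.1, hz.2.trans_le hy⟩
    have h1 := hK c ⟨hx.trans_lt hc.1, hc.2.trans_le hy⟩
    rw [e, abs_div, div_le_iff₀ (abs_pos.2 lnn)] at h1
    rwa [abs_sub_comm, abs_sub_comm x y]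
  refine ⟨fun x hx => H.Uz t x ?_, fun x y => ?_⟩
  · by_contra hh
    exact hx (abs_le.1 (not_le.1 hh).le)
  · rw [H.Umin t x, H.Umin t y]
    have l : |min |x| (S t) - min |y| (S t)| ≤ |x - y| :=
      (abs_inf_sub_inf_le_abs _ _ _).trans (abs_abs_sub_abs_le _ _)
    refine le_trans ?_ (mul_le_mul_of_nonneg_left l hK0)
    have h0 := (H.Sp t).le
    rcases le_total (min |x| (S t)) (min |y| (S t)) with h | h
    · exact key _ _ (le_min (abs_nonneg _) h0) h (min_le_right _ _)
    · rw [abs_sub_comm, abs_sub_comm (min |x| (S t))]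
      exact key _ _ (le_min (abs_nonneg _) h0) h (min_le_right _ _)
end

lemma tube {Y : Type*} [TopologicalSpace Y] {f : Y → ℝ → ℝ} {q₀ : Y} {α β : ℝ}
    (hf : ∀ x, ContinuousAt (fun q : Y × ℝ => f q.1 q.2) (q₀, x)) {c : ℝ} (hc : 0 < c) :
    ∀ᶠ q in 𝓝 q₀, ∀ x ∈ Icc α β, |f q x - f q₀ x| < c := by
  refine (isCompact_Icc (a := α) (b := β)).eventually_forall_of_forall_eventually fun x _ => ?_
  have c0 : ContinuousAt (fun q : Y × ℝ => f q.1 q.2 - f q₀ q.2) (q₀, x) :=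
    (hf x).sub (((hf x).comp (x := x) (f := fun x => (q₀, x)) fpp).comp (x := (q₀, x)) (f := Prod.snd) continuousAt_snd)
  have := c0.abs.tendsto
  simp only [sub_self, abs_zero] at this
  exact this.eventually (gt_mem_nhds hc)

lemma G2d {U e e' : RG} {R t T : ℝ} (ht : t < T) (R0 : 0 ≤ R)
    (hU : Continuous fun q : RP => U q.1 q.2)
    (he : ∀ j < T, ∀ x, HasDerivAt (fun j => e j x) (e' j x) j) (hec : ∀ j < T, Continuous (e j))
    (he' : ∀ j < T, ∀ x, ContinuousAt (fun q : RP => e' q.1 q.2) (j, x)) :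
    HasDerivAt (fun j => ∫ x in 0..R, U j x * (e j x - e t x)) (∫ x in 0..R, U t x * e' t x) t := by
  rw [hasDerivAt_iff_isLittleO, Asymptotics.isLittleO_iff]
  intro c hc
  have hc' : 0 < c / (R + 1) := by positivity
  have tb := tube (Y := ℝ × ℝ) (f := fun q x => U q.1 x * e' q.2 x) (q₀ := (t, t)) (α := 0) (β := R)
    (fun x => ContinuousAt.mul fpp
      ((he' t ht x).comp (x := ((t, t), x)) (f := fun q : (ℝ × ℝ) × ℝ => (q.1.2, q.2)) fpp)) hc'
  obtain ⟨δ, hδ, hb⟩ := Metric.eventually_nhds_iff.1 tb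
  filter_upwards [Metric.ball_mem_nhds t hδ, Iio_mem_nhds ht] with j h1 h2
  have cU : ∀ j, Continuous (U j) := fun j => by fun_prop
  have ce' : Continuous (e' t) := continuous_iff_continuousAt.2 fun x =>
    (he' t ht x).comp (x := x) (f := fun x => (t, x)) fpp
  have i1 := ((cU j).mul ((hec j h2).sub (hec t ht))).intervalIntegrable (μ := volume) 0 R
  have i2 := (((cU t).mul ce').const_smul (j - t)).intervalIntegrable (μ := volume) 0 R
  change IntervalIntegrable (fun x => U j x * (e j x - e t x)) _ _ _ at i1
  change IntervalIntegrable (fun x => (j - t) • (U t x * e' t x)) _ _ _ at i2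
  have e1 : (∫ x in 0..R, U j x * (e j x - e t x)) - (∫ x in 0..R, U t x * (e t x - e t x)) -
      (j - t) • ∫ x in 0..R, U t x * e' t x =
      ∫ x in 0..R, (U j x * (e j x - e t x) - (j - t) • (U t x * e' t x)) := by
    rw [← intervalIntegral.integral_smul, isub i1 i2]
    simp only [sub_self, mul_zero, intervalIntegral.integral_zero, sub_zero]
  rw [e1]
  have h3 := nil (a := 0) (b := R) (C := c / (R + 1) * ‖j - t‖)
    (f := fun x => (U j x * (e j x - e t x) - (j - t) • (U t x * e' t x))) (fun x hx => ?_)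
  · refine h3.trans ?_
    rw [sub_zero, abs_of_nonneg R0]
    have : c / (R + 1) * R ≤ c := by
      rw [div_mul_eq_mul_div, div_le_iff₀ psv]; nlinarith
    nlinarith [norm_nonneg (j - t)]
  · rw [uIoc_of_le R0] at hx
    have := (convex_uIcc t j).norm_image_sub_le_of_norm_hasDerivWithin_le
      (f := fun r => U j x * e r x - r * (U t x * e' t x)) (f' := fun r => U j x * e' r x - 1 * (U t x * e' t x))
      (C := c / (R + 1)) (x := t) (y := j) (fun r hr => ?_) (fun r hr => ?_) left_mem_uIcc right_mem_uIcc
    · convert this using 2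
      simp only [smul_eq_mul]; ring
    · have hr' : r < T := by rcases le_total t j with h | h <;> simp [h] at hr <;> [exact hr.2.trans_lt h2; exact hr.2.trans_lt ht]
      exact (((he r hr' x).const_mul _).sub ((hasDerivAt_id r).mul_const _)).hasDerivWithinAt
    · rw [one_mul]
      refine (hb (y := (j, r)) ?_ x ⟨hx.1.le, hx.2⟩).le
      rw [Prod.dist_eq]
      refine max_lt h1 (lt_of_le_of_lt ?_ h1)
      rw [Real.dist_eq, Real.dist_eq]; exact abs_sub_left_of_mem_uIcc hr

def ek (T x0 j x : ℝ) : ℝ := hk (T - j) (x0 - x) + hk (T - j) (x0 + x)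
def ek1 (T x0 j x : ℝ) : ℝ := -hk1 (T - j) (x0 - x) + hk1 (T - j) (x0 + x)
def ek2 (T x0 j x : ℝ) : ℝ := hk2 (T - j) (x0 - x) + hk2 (T - j) (x0 + x)

lemma ek_d (T x0 j x : ℝ) : HasDerivAt (ek T x0 j) (ek1 T x0 j x) x := by
  have h1 := (hk_hasDerivAt (T - j) (x0 - x)).comp x ((hasDerivAt_id x).const_sub x0)
  have h2 := (hk_hasDerivAt (T - j) (x0 + x)).comp x ((hasDerivAt_id x).const_add x0)
  exact (h1.add h2).congr_deriv (by simp [ek1])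

lemma ek1_d (T x0 j x : ℝ) : HasDerivAt (ek1 T x0 j) (ek2 T x0 j x) x := by
  have h1 := (hk1_hasDerivAt (T - j) (x0 - x)).comp x ((hasDerivAt_id x).const_sub x0)
  have h2 := (hk1_hasDerivAt (T - j) (x0 + x)).comp x ((hasDerivAt_id x).const_add x0)
  exact (h1.neg.add h2).congr_deriv (by simp [ek2])

lemma ek_t {T j : ℝ} (h : j < T) (x0 x : ℝ) : HasDerivAt (fun j => ek T x0 j x) (-ek2 T x0 j x) j := by
  have h1 := (hk_hasDerivAt_t (sub_pos.2 h) (x0 - x)).comp j ((hasDerivAt_id j).const_sub T)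
  have h2 := (hk_hasDerivAt_t (sub_pos.2 h) (x0 + x)).comp j ((hasDerivAt_id j).const_sub T)
  exact (h1.add h2).congr_deriv (by simp [ek2]; ring)

lemma ek_c {T j : ℝ} (h : j < T) (x0 x : ℝ) : ContinuousAt (fun q : RP => ek T x0 q.1 q.2) (j, x) ∧
    ContinuousAt (fun q : RP => ek2 T x0 q.1 q.2) (j, x) := by
  have ne : ∀ y, ((T - j, y) : RP) ≠ 0 := fun y h' => (sub_pos.2 h).ne' (congrArg Prod.fst h')
  constructor
  · exact ((hk_continuousAt (ne (x0 - x))).1.comp (x := (j, x)) (f := fun q : RP => (T - q.1, x0 - q.2)) fpp).add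
      ((hk_continuousAt (ne (x0 + x))).1.comp (x := (j, x)) (f := fun q : RP => (T - q.1, x0 + q.2)) fpp)
  · exact ((hk_continuousAt (ne (x0 - x))).2.2.comp (x := (j, x)) (f := fun q : RP => (T - q.1, x0 - q.2)) fpp).add
      ((hk_continuousAt (ne (x0 + x))).2.2.comp (x := (j, x)) (f := fun q : RP => (T - q.1, x0 + q.2)) fpp)

section
variable {p a b : ℝ} {S V : RF} {U X Z : RG} (H : Cl p a b S V U X Z)
include H

lemma Cl.rp0 (hp : 1 < p) {t T : ℝ} (ht : t ∈ Ioo a b) (hT : t < T) (x0 : ℝ) :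
    HasDerivAt (fun j => ∫ x in 0..S j, U j x * ek T x0 j x)
      ((U t 0) ^ p * ek T x0 t 0 - V t * ek T x0 t (S t)) t := by
  have hUc := H.Uc
  have hXc := H.Xc
  have cU : ∀ j, Continuous (U j) := fun j => by fun_prop
  have cX : ∀ j, Continuous (X j) := fun j => by fun_prop
  have c0 : ∀ j, Continuous (ek T x0 j) := fun j => continuous_iff_continuousAt.2 fun x => (ek_d T x0 j x).continuousAt
  have c1 : Continuous (ek1 T x0 t) := continuous_iff_continuousAt.2 fun x => (ek1_d T x0 t x).continuousAt
  have c2 : Continuous (ek2 T x0 t) := by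
    have := hk2_cont (T - t); unfold ek2; fun_prop
  have ts : Tst (1 / |T - t| + 1 / |T - t|) (ek T x0 t) (ek1 T x0 t) := by
    refine ⟨c0 t, ⟨∅, countable_empty, fun x _ => ek_d T x0 t x⟩, c1.measurable, fun x => ?_⟩
    refine (abs_add_le _ _).trans (add_le_add ?_ (hk1_le _ _))
    rw [abs_neg]; exact hk1_le _ _
  have w := H.wf ts hp ht
  set R := S t + 1 with hR
  have R0 : 0 ≤ R := by linarith [H.Sp t]
  have g := G2d (U := U) (e := ek T x0) (e' := fun j x => -ek2 T x0 j x) hT R0 hUc (fun j h x => ek_t h x0 x)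
    (fun j _ => c0 j) (fun j h x => (ek_c h x0 x).2.neg)
  have sum := w.add g
  have ibp : ∫ x in 0..S t, X t x * ek1 T x0 t x = -∫ x in 0..S t, U t x * ek2 T x0 t x := by
    have := intervalIntegral.integral_mul_deriv_eq_deriv_mul_of_hasDerivAt (a := 0) (b := S t) (u := U t) (v := ek1 T x0 t)
      (u' := X t) (v' := ek2 T x0 t) (cU t).continuousOn c1.continuousOn
      (fun x hx => H.Ud t x (by rwa [min_eq_left (H.Sp t).le, max_eq_right (H.Sp t).le] at hx))
      (fun x _ => ek1_d T x0 t x) ((cX t).intervalIntegrable _ _) (c2.intervalIntegrable _ _)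
    rw [this, H.Uz t _ (le_abs_self _)]
    simp [ek1]
  have e2 := H.Ui (ψ := fun x => -ek2 T x0 t x) c2.neg (t := t) (R := R) lnn
  rw [← e2, ibp] at sum
  have e3 : -V t * ek T x0 t (S t) + U t 0 ^ p * ek T x0 t 0 - -∫ (x : ℝ) in 0..S t, U t x * ek2 T x0 t x =
    U t 0 ^ p * ek T x0 t 0 - V t * ek T x0 t (S t) + ∫ (x : ℝ) in 0..S t, U t x * ek2 T x0 t x := by ring
  rw [e3] at sum
  have e4 : ∫ (x : ℝ) in 0..S t, U t x * -ek2 T x0 t x = -∫ (x : ℝ) in 0..S t, U t x * ek2 T x0 t x := by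
    rw [← intervalIntegral.integral_neg]; simp
  rw [e4, add_neg_cancel_right] at sum
  refine sum.congr_of_eventuallyEq ?_
  filter_upwards [H.Sc.continuousAt.eventually (gt_mem_nhds (show S t < R by linarith))] with j h1
  simp only [Pi.add_apply]
  rw [H.Ui (c0 j) h1.le, H.Ui (c0 t) h1.le, ← iadd]
  · congr 1; ext x; ring
  · exact ((cU j).mul (c0 t)).intervalIntegrable _ _
  · exact ((cU j).mul ((c0 j).sub (c0 t))).intervalIntegrable _ _

lemma Cl.rpF (t T x0 : ℝ) :
    ∫ x in 0..S t, U t x * ek T x0 t x = FF (U t) (T - t) x0 := by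
  have hUc := H.Uc
  have cU : Continuous (U t) := by fun_prop
  have ck := hk_cont (T - t)
  have c1 : Continuous fun x => U t x * hk (T - t) (x0 - x) := by fun_prop
  have c2 : Continuous fun x => U t x * hk (T - t) (x0 + x) := by fun_prop
  have e : ∫ x in 0..S t, U t x * ek T x0 t x = (∫ x in 0..S t, U t x * hk (T - t) (x0 - x)) + ∫ x in 0..S t, U t x * hk (T - t) (x0 + x) := by
    rw [← iadd (c1.intervalIntegrable _ _) (c2.intervalIntegrable _ _)]
    simp only [ek, mul_add]
  have e2 : ∫ x in 0..S t, U t x * hk (T - t) (x0 + x) = ∫ x in (-S t)..(0:ℝ), U t x * hk (T - t) (x0 - x) := by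
    have := intervalIntegral.integral_comp_neg (a := 0) (b := S t) (fun x => U t x * hk (T - t) (x0 - x))
    rw [neg_zero] at this
    rw [← this]; simp only [H.Ue, sub_neg_eq_add]
  rw [e, e2, add_comm, intervalIntegral.integral_add_adjacent_intervals (c1.intervalIntegrable _ _) (c1.intervalIntegrable _ _),
    FF, iole (by linarith [H.Sp t])]
  refine setIntegral_eq_integral_of_forall_compl_eq_zero fun x hx => ?_
  rw [H.Uz t x, zero_mul]
  by_contra hh
  rw [not_le, abs_lt] at hh
  exact hx ⟨hh.1, hh.2.le⟩

lemma Cl.rp1 (hp : 1 < p) {t0 t T : ℝ} (h0 : t0 ∈ Ioo a b) (ht : t ∈ Ioo a b) (htt : t0 ≤ t) (hT : t < T) (x0 : ℝ) :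
    FF (U t) (T - t) x0 - FF (U t0) (T - t0) x0 =
      ∫ j in t0..t, ((U j 0) ^ p * ek T x0 j 0 - V j * ek T x0 j (S j)) := by
  rw [← H.rpF, ← H.rpF]
  have hUc := H.Uc
  have hVc := H.Vc
  have hSc := H.Sc
  have hw := H.wc hp
  symm
  refine ftc (f := fun j => ∫ x in 0..S j, U j x * ek T x0 j x) (fun j hj => ?_) ?_
  · rw [uIcc_of_le htt] at hj
    exact H.rp0 hp ⟨h0.1.trans_le hj.1, hj.2.trans_lt ht.2⟩ (hj.2.trans_lt hT) x0
  · refine ContinuousOn.intervalIntegrable fun j hj => ?_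
    rw [uIcc_of_le htt] at hj
    have hj' := hj.2.trans_lt hT
    refine ContinuousAt.continuousWithinAt (ContinuousAt.sub (hw.continuousAt.mul ?_) (hVc.continuousAt.mul ?_))
    · exact (ek_c hj' x0 0).1.comp (x := j) (f := fun j => (j, 0)) fpp
    · exact (ek_c hj' x0 (S j)).1.comp (x := j) (f := fun j => (j, S j)) fpp
end

structure Bd (A G : ℝ) (g : RF) : Prop where
  gz : ∀ j ∉ Ioo 0 A, g j = 0
  gb : ∀ j, |g j| ≤ G
  gc : ContinuousOn g (Ioo 0 A)

def pth (b : ℝ) (v : RF) (j : ℝ) : ℝ := b + ∫ r in 0..j, v r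

lemma pth_neg (b : ℝ) (v : RF) (j : ℝ) : pth (-b) (-v) j = -pth b v j := by
  simp [pth, intervalIntegral.integral_neg]; ring

lemma pth_zero (b : ℝ) (v : RF) : pth b v 0 = b := by simp [pth]

def ct (A : ℝ) (f : RF) : RF := (Ioo 0 A).indicator f

lemma ct_in {A : ℝ} {f : RF} {j : ℝ} (h : j ∈ Ioo 0 A) : ct A f j = f j := indicator_of_mem h f
lemma ct_out {A : ℝ} {f : RF} {j : ℝ} (h : j ∉ Ioo 0 A) : ct A f j = 0 := indicator_of_notMem h f

lemma ct_bd {A G : ℝ} (hG : 0 ≤ G) {f : RF} (hf : ContinuousOn f (Ioo 0 A)) (hb : ∀ j ∈ Ioo 0 A, |f j| ≤ G) :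
    Bd A G (ct A f) := by
  refine ⟨fun j h => ct_out h, fun j => ?_, hf.congr fun j h => ct_in h⟩
  by_cases h : j ∈ Ioo 0 A
  · rw [ct_in h]; exact hb j h
  · rw [ct_out h, abs_zero]; exact hG

section
variable {A G L : ℝ} {g v : RF}

lemma Bd.lay0 (hg : Bd A G g) : Lay A G 0 g (fun _ => 0) (fun _ => 0) :=
  ⟨hg.gz, hg.gb, hg.gc, fun a b => by simp, fun j _ => hasDerivAt_const j 0, fun _ _ => rfl, fun j => by simp,
    continuousOn_const⟩

lemma Bd.G0 (hg : Bd A G g) : 0 ≤ G := (abs_nonneg _).trans (hg.gb 0)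

lemma Bd.ii (hg : Bd A G g) (a b : ℝ) : IntervalIntegrable g volume a b := hg.lay0.int.intervalIntegrable

lemma Bd.neg (hg : Bd A G g) : Bd A G (-g) :=
  ⟨fun j h => by simp [hg.gz j h], fun j => by simpa using hg.gb j, hg.gc.neg⟩

lemma Bd.lip (hv : Bd A L v) (b x y : ℝ) : |pth b v x - pth b v y| ≤ L * |x - y| := by
  have : pth b v x - pth b v y = ∫ r in y..x, v r := by
    simp only [pth]
    rw [← iisl (hv.ii 0 x) (hv.ii 0 y)]; ring
  rw [this]
  exact nil (f := v) (C := L) fun r _ => hv.gb r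

lemma Bd.lay (hg : Bd A G g) (hv : Bd A L v) (b : ℝ) : Lay A G L g (pth b v) v := by
  refine ⟨hg.gz, hg.gb, hg.gc, hv.lip b, fun j h => ?_, hv.gz, hv.gb, hv.gc⟩
  exact (ihd (hv.ii 0 j)
    ⟨univ, univ_mem, by simpa using hv.lay0.gae⟩ (hv.gc.continuousAt (isOpen_Ioo.mem_nhds h))).const_add b

end

def NN (ψ : RF) (b : ℝ) (g v : RF) (t x : ℝ) : ℝ :=
  F0 ψ t x + 2 * LV g (fun _ => 0) t x - LV v (pth b v) t x - LV v (pth (-b) (-v)) t x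

lemma LV_cau {A A' : ℝ} {f O : RF} {t x : ℝ} (h : t ≤ A) (h' : t ≤ A') {O' : RF} (hs : ∀ j ∈ Ioo 0 t, O j = O' j) :
    LV (ct A f) O t x = LV (ct A' f) O' t x := by
  unfold LV
  congr 1; ext j
  by_cases h1 : j < t
  · by_cases h2 : 0 < j
    · rw [ct_in ⟨h2, h1.trans_le h⟩, ct_in ⟨h2, h1.trans_le h'⟩, hs j ⟨h2, h1⟩]
    · rw [ct_out fun h3 => h2 h3.1, ct_out fun h3 => h2 h3.1]; simp
  · rw [hk_of_nonpos lnn, hk_of_nonpos lnn]; simp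

lemma pth_cau {A A' b : ℝ} {f : RF} {t : ℝ} (h0 : 0 ≤ t) (h : t ≤ A) (h' : t ≤ A') :
    pth b (ct A f) t = pth b (ct A' f) t := by
  unfold pth
  congr 1
  refine intervalIntegral.integral_congr_ae ?_
  have : ∀ᵐ j : ℝ, j ≠ t := by simp [ae_iff, measure_singleton]
  filter_upwards [this] with j h1 h2
  rw [uIoc_of_le h0] at h2
  have h3 := lt_of_le_of_ne h2.2 h1
  rw [ct_in ⟨h2.1, h3.trans_le h⟩, ct_in ⟨h2.1, h3.trans_le h'⟩]

lemma ct_neg (A : ℝ) (f : RF) : -ct A f = ct A (-f) := by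
  unfold ct; rw [indicator_neg']

lemma NN_cau {A A' b : ℝ} {ψ g v : RF} {t x : ℝ} (h : t ≤ A) (h' : t ≤ A') :
    NN ψ b (ct A g) (ct A v) t x = NN ψ b (ct A' g) (ct A' v) t x := by
  have s1 : ∀ (b : ℝ) v, ∀ j ∈ Ioo 0 t, pth b (ct A v) j = pth b (ct A' v) j := fun b v j hj =>
    pth_cau hj.1.le (hj.2.le.trans h) (hj.2.le.trans h')
  unfold NN
  rw [ct_neg, ct_neg, LV_cau h h' (fun j _ => rfl), LV_cau h h' (s1 b v), LV_cau h h' (s1 (-b) (-v))]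

section
variable {p a b : ℝ} {S V : RF} {U X Z : RG} (H : Cl p a b S V U X Z)
include H

lemma Cl.Spth {t0 r A : ℝ} (h0 : t0 ∈ Ioo a b) (h1 : t0 + r ∈ Ioo a b) (hr : 0 ≤ r) (hA : r ≤ A) :
    S (t0 + r) = pth (S t0) (ct A fun j => V (t0 + j)) r := by
  have hVc := H.Vc
  rw [pth_cau hr hA le_rfl, pth]
  have e : ∫ j in 0..r, ct r (fun j => V (t0 + j)) j = ∫ j in 0..r, V (t0 + j) := by
    refine intervalIntegral.integral_congr_ae ?_
    have : ∀ᵐ j : ℝ, j ≠ r := by simp [ae_iff, measure_singleton]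
    filter_upwards [this] with j h1 h2
    rw [uIoc_of_le hr] at h2
    rw [ct_in ⟨h2.1, lt_of_le_of_ne h2.2 h1⟩]
  have := ftc (f := fun j => S (t0 + j)) (f' := fun j => V (t0 + j)) (a := 0) (b := r)
    (fun j hj => by
      rw [uIcc_of_le hr] at hj
      exact (H.Sd (t0 + j) ⟨by linarith [h0.1, hj.1], by linarith [h1.2, hj.2]⟩).comp_const_add t0 j)
    (by apply Continuous.intervalIntegrable; fun_prop)
  rw [e, this]; simp

lemma Cl.bds {t0 A L G : ℝ} (hp : 1 < p) (L0 : 0 ≤ L) (G0 : 0 ≤ G) (hL : ∀ j ∈ Ioo 0 A, V (t0 + j) ≤ L) (hG : ∀ j ∈ Ioo 0 A, (U (t0 + j) 0) ^ p ≤ G) :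
    Bd A L (ct A fun j => V (t0 + j)) ∧ Bd A G (ct A fun j => (U (t0 + j) 0) ^ p) := by
  have hVc := H.Vc
  have hw := H.wc hp
  constructor
  · refine ct_bd L0 fpp fun j hj => ?_
    rw [abs_of_nonneg (H.V0 _)]; exact hL j hj
  · refine ct_bd G0 (hw.comp (by fun_prop : Continuous fun j => t0 + j)).continuousOn fun j hj => ?_
    rw [abs_of_nonneg (rpow_nonneg (H.U0 _ _) _)]; exact hG j hj

lemma Cl.bdsE (hp : 1 < p) (t0 A : ℝ) : ∃ L G, Bd A L (ct A fun j => V (t0 + j)) ∧ Bd A G (ct A fun j => (U (t0 + j) 0) ^ p) := by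
  have hVc := H.Vc
  have hw := H.wc hp
  obtain ⟨L, hL⟩ := (isCompact_Icc (a := 0) (b := A)).exists_bound_of_continuousOn (f := fun j => V (t0 + j)) fpp
  obtain ⟨G, hG⟩ := (isCompact_Icc (a := 0) (b := A)).exists_bound_of_continuousOn (f := fun j => (U (t0 + j) 0) ^ p)
    (hw.comp (by fun_prop : Continuous fun j => t0 + j)).continuousOn
  exact ⟨|L|, |G|, H.bds hp (abs_nonneg _) (abs_nonneg _)
    (fun j hj => (le_abs_self _).trans ((hL j ⟨hj.1.le, hj.2.le⟩).trans (le_abs_self L)))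
    (fun j hj => (le_abs_self _).trans ((hG j ⟨hj.1.le, hj.2.le⟩).trans (le_abs_self G)))⟩

lemma Cl.lipE (t : ℝ) : ∃ K, LipB (S t) K (U t) := by
  obtain ⟨K, hK0, hK⟩ := H.Xb t t
  exact ⟨K, H.lip hK0 fun x hx => hK t ⟨le_rfl, le_rfl⟩ x ⟨hx.1.le, hx.2.le⟩⟩

lemma Cl.rp2 (hp : 1 < p) {t0 r T x0 : ℝ} (h0 : t0 ∈ Ioo a b) (h1 : t0 + r ∈ Ioo a b) (hr : 0 < r) (hT : r < T) :
    FF (U (t0 + r)) (T - r) x0 = FF (U t0) T x0 + 2 * LV (ct r fun j => (U (t0 + j) 0) ^ p) (fun _ => 0) T x0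
      - LV (ct r fun j => V (t0 + j)) (pth (S t0) (ct r fun j => V (t0 + j))) T x0
      - LV (ct r fun j => V (t0 + j)) (pth (-S t0) (-ct r fun j => V (t0 + j))) T x0 := by
  have hVc := H.Vc
  have hSc := H.Sc
  have hw := H.wc hp
  have e := H.rp1 hp h0 h1 lnn (T := t0 + T) lnn x0
  rw [show t0 + T - (t0 + r) = T - r by ring, show t0 + T - t0 = T by ring] at e
  have key : ∀ f ρ : RF, LV (ct r f) ρ T x0 = ∫ j in 0..r, f j * hk (T - j) (x0 - ρ j) := by
    intro f ρ
    rw [LV, iole hr.le, ← integral_Ioc_eq_integral_Ioo.symm, ← integral_indicator measurableSet_Ioo]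
    congr 1; ext j
    by_cases h : j ∈ Ioo 0 r
    · rw [ct_in h, indicator_of_mem h]
    · rw [ct_out h, indicator_of_notMem h, zero_mul]
  have sub : ∫ j in t0..(t0 + r), ((U j 0) ^ p * ek (t0 + T) x0 j 0 - V j * ek (t0 + T) x0 j (S j)) =
      ∫ j in 0..r, ((U (t0 + j) 0) ^ p * ek (t0 + T) x0 (t0 + j) 0 - V (t0 + j) * ek (t0 + T) x0 (t0 + j) (S (t0 + j))) := by
    rw [intervalIntegral.integral_comp_add_left (fun j => (U j 0) ^ p * ek (t0 + T) x0 j 0 - V j * ek (t0 + T) x0 j (S j))]; simp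
  have hI : ∀ f ρ : RF, Continuous f → Continuous ρ → IntervalIntegrable (fun j => f j * hk (T - j) (x0 - ρ j)) volume 0 r := by
    intro f ρ hf hρ
    refine ContinuousOn.intervalIntegrable fun j hj => ContinuousAt.continuousWithinAt (hf.continuousAt.mul ?_)
    rw [uIcc_of_le hr.le] at hj
    exact (hk_continuousAt (q := (T - j, x0 - ρ j)) (fun h' => by
      have := congrArg Prod.fst h'; simp at this; linarith [hj.2])).1.comp (x := j) (f := fun j => (T - j, x0 - ρ j)) fpp
  have cg : Continuous fun j => (U (t0 + j) 0) ^ p := hw.comp (by fun_prop : Continuous fun j => t0 + j)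
  have i1 := hI _ (fun _ => 0) cg continuous_const
  have i2 := hI (fun j => V (t0 + j)) (fun j => S (t0 + j)) fpp fpp
  have i3 := hI (fun j => V (t0 + j)) (fun j => -S (t0 + j)) fpp fpp
  have c1 : ∫ j in 0..r, V (t0 + j) * hk (T - j) (x0 - pth (S t0) (ct r fun j => V (t0 + j)) j) =
      ∫ j in 0..r, V (t0 + j) * hk (T - j) (x0 - S (t0 + j)) := by
    refine icon fun j hj => ?_
    rw [uIcc_of_le hr.le] at hj
    rw [H.Spth h0 ⟨by linarith [h0.1, hj.1], by linarith [h1.2, hj.2]⟩ hj.1 hj.2]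
  have c2 : ∫ j in 0..r, V (t0 + j) * hk (T - j) (x0 - pth (-S t0) (-ct r fun j => V (t0 + j)) j) =
      ∫ j in 0..r, V (t0 + j) * hk (T - j) (x0 - -S (t0 + j)) := by
    refine icon fun j hj => ?_
    rw [uIcc_of_le hr.le] at hj
    rw [pth_neg, H.Spth h0 ⟨by linarith [h0.1, hj.1], by linarith [h1.2, hj.2]⟩ hj.1 hj.2]
  rw [key, key, key, c1, c2]
  have : FF (U (t0 + r)) (T - r) x0 = FF (U t0) T x0 + ∫ j in 0..r, (2 * ((U (t0 + j) 0) ^ p * hk (T - j) (x0 - 0)) - V (t0 + j) * hk (T - j) (x0 - S (t0 + j)) - V (t0 + j) * hk (T - j) (x0 - -S (t0 + j))) := by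
    rw [sub] at e
    rw [← sub_eq_iff_eq_add', e]
    congr 1; ext j
    simp only [ek, add_sub_add_left_eq_sub, sub_zero, add_zero, sub_neg_eq_add]; ring
  rw [this, isub ((i1.const_mul 2).sub i2) i3, isub (i1.const_mul 2) i2,
    icm]
  ring

lemma Cl.rep (hp : 1 < p) {t0 r A : ℝ} (h0 : t0 ∈ Ioo a b) (h1 : t0 + r ∈ Ioo a b) (hr : 0 ≤ r) (hA : r ≤ A) (x : ℝ) :
    U (t0 + r) x = NN (U t0) (S t0) (ct A fun j => (U (t0 + j) 0) ^ p) (ct A fun j => V (t0 + j)) r x := by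
  rcases hr.eq_or_lt with rfl | hr
  · have z : ∀ f ρ, LV (ct A f) ρ 0 x = 0 := by
      intro f ρ
      rw [LV]
      have : ∀ j, ct A f j * hk (0 - j) (x - ρ j) = 0 := fun j => by
        by_cases h : j ∈ Ioo 0 A
        · rw [hk_of_nonpos (by linarith [h.1]), mul_zero]
        · rw [ct_out h, zero_mul]
      simp only [this, integral_zero]
    simp [NN, z, F0]
  rw [NN_cau hA le_rfl]
  obtain ⟨L, G, hL, hG⟩ := H.bdsE hp t0 r
  obtain ⟨K0, l0⟩ := H.lipE t0
  obtain ⟨K1, l1⟩ := H.lipE (t0 + r)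
  have c : ∀ f ρ : RF, (Continuous fun q : RP => LV f ρ q.1 q.2) → Tendsto (fun T => LV f ρ T x) (𝓝[>] r) (𝓝 (LV f ρ r x)) :=
    fun f ρ h => ((h.comp (by fun_prop : Continuous fun T : ℝ => (T, x))).tendsto r).mono_left nhdsWithin_le_nhds
  have cF : Tendsto (fun T => FF (U t0) T x) (𝓝[>] r) (𝓝 (FF (U t0) r x)) :=
    (l0.off hr x).2.2.1.continuousAt.tendsto.mono_left nhdsWithin_le_nhds
  have lim := ((cF.add ((c _ _ hG.lay0.cont).const_mul 2)).sub (c _ _ (hL.lay hL (S t0)).cont)).sub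
    (c _ _ (hL.lay hL.neg (-S t0)).cont)
  have e : F0 (U t0) r x = FF (U t0) r x := by simp [F0, not_le.2 hr]
  rw [NN, e]
  refine tendsto_nhds_unique ?_ lim
  have : Tendsto (fun T => FF (U (t0 + r)) (T - r) x) (𝓝[>] r) (𝓝 (U (t0 + r) x)) := by
    rw [tendsto_iff_dist_tendsto_zero]
    have hz : Tendsto (fun T : ℝ => K1 * (4 * √(T - r))) (𝓝[>] r) (𝓝 0) := by
      have : ContinuousAt (fun T : ℝ => K1 * (4 * √(T - r))) r := by fun_prop
      have := this.tendsto.mono_left (nhdsWithin_le_nhds (s := Ioi r))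
      simpa using this
    refine squeeze_zero' (Eventually.of_forall fun _ => dist_nonneg) ?_ hz
    filter_upwards [self_mem_nhdsWithin] with T hT
    exact l1.FFini (sub_pos.2 hT) x
  refine this.congr' ?_
  filter_upwards [self_mem_nhdsWithin] with T hT using H.rp2 hp h0 h1 hr hT
end

lemma HHd {Q : RG} (hQ : Continuous fun q : RP => Q q.1 q.2) (α β t : ℝ) :
    HasDerivAt (fun t => ∫ O in 0..(t + α), ∫ j in 0..(t + β), Q O j)
      ((∫ j in 0..(t + β), Q (t + α) j) + ∫ O in 0..(t + α), Q O (t + β)) t := by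
  let f : RG := fun x y => ∫ O in 0..x, ∫ j in 0..y, Q O j
  let f1 : RG := fun x y => ∫ j in 0..y, Q x j
  let f2 : RG := fun x y => ∫ O in 0..x, Q O y
  have c1 : Continuous fun q : RP => f1 q.1 q.2 :=
    cpi (f := fun (q : RP) j => Q q.1 j)
      (by unfold Function.uncurry; fun_prop) continuous_snd
  have c2 : Continuous fun q : RP => f2 q.1 q.2 :=
    cpi (f := fun (q : RP) j => Q j q.2)
      (by unfold Function.uncurry; fun_prop) continuous_fst
  have d1 : ∀ x y, HasDerivAt (fun x => f x y) (f1 x y) x := fun x y => by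
    have c : Continuous fun O => f1 O y := c1.comp (by fun_prop : Continuous fun O : ℝ => (O, y))
    exact ihd (c.intervalIntegrable _ _) c.aestronglyMeasurable.stronglyMeasurableAtFilter c.continuousAt
  have sw : ∀ x y, f x y = ∫ j in 0..y, ∫ O in 0..x, Q O j := fun x y => by
    refine intervalIntegral_intervalIntegral_swap ?_
    exact (hQ.continuousOn.integrableOn_compact (isCompact_uIcc.prod isCompact_uIcc)).mono_set
      (prod_mono uIoc_subset_uIcc uIoc_subset_uIcc)
  have d2 : ∀ x y, HasDerivAt (fun y => f x y) (f2 x y) y := fun x y => by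
    have c : Continuous fun O => f2 x O := c2.comp (by fun_prop : Continuous fun O : ℝ => (x, O))
    have e : (fun y => f x y) = fun y => ∫ j in 0..y, f2 x j := funext fun y => sw x y
    rw [e]
    exact ihd (c.intervalIntegrable _ _) c.aestronglyMeasurable.stronglyMeasurableAtFilter c.continuousAt
  have := hasStrictFDerivAt_uncurry_coprod (𝕜 := ℝ) (u := (t + α, t + β)) (f := f)
    (f₁ := fun x y => ContinuousLinearMap.toSpanSingleton ℝ (f1 x y)) (f₂ := fun x y => ContinuousLinearMap.toSpanSingleton ℝ (f2 x y))
    (Eventually.of_forall fun v => (d1 v.1 v.2).hasFDerivAt) (Eventually.of_forall fun v => (d2 v.1 v.2).hasFDerivAt)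
    ((ContinuousLinearMap.toSpanSingletonCLE (𝕜 := ℝ) (E := ℝ)).continuous.comp c1).continuousAt ((ContinuousLinearMap.toSpanSingletonCLE (𝕜 := ℝ) (E := ℝ)).continuous.comp c2).continuousAt
  have h2 := this.hasFDerivAt.comp_hasDerivAt t (((hasDerivAt_id t).add_const α).prodMk ((hasDerivAt_id t).add_const β))
  refine h2.congr_deriv ?_
  simp [f1, f2, Function.HasUncurry.uncurry]

def av (f : RF) (h t : ℝ) : ℝ := ∫ θ in 0..1, f (t + h * θ)

lemma av_eq {f : RF} {h : ℝ} (hh : h ≠ 0) (t : ℝ) : av f h t = h⁻¹ * ∫ O in t..(t + h), f O := by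
  rw [av, intervalIntegral.integral_comp_add_mul _ hh]; simp

lemma av_cont {f : RF} (hf : Continuous f) : Continuous fun q : RP => av f q.1 q.2 := by
  unfold av
  exact cpi'
    (f := fun (q : RP) θ => f (q.2 + q.1 * θ)) (by unfold Function.uncurry; fun_prop) 0 1

lemma av_zero (f : RF) (t : ℝ) : av f 0 t = f t := by simp [av]

lemma av_d {f : RF} (hf : Continuous f) {h : ℝ} (hh : h ≠ 0) (t : ℝ) :
    HasDerivAt (av f h) (h⁻¹ * (f (t + h) - f t)) t := by
  have e : av f h = fun t => h⁻¹ * ((∫ O in 0..(t + h), f O) - ∫ O in 0..t, f O) := by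
    ext t
    rw [av_eq hh, ← iisl (hf.intervalIntegrable 0 _) (hf.intervalIntegrable 0 _)]
  rw [e]
  have d : ∀ t, HasDerivAt (fun t => ∫ O in 0..t, f O) (f t) t := fun t =>
    ihd (hf.intervalIntegrable _ _) hf.aestronglyMeasurable.stronglyMeasurableAtFilter hf.continuousAt
  exact (((d (t + h)).comp_add_const t h).sub (d t)).const_mul _

def av2 (Q : RG) (h t : ℝ) : ℝ := ∫ θ in 0..1, av (Q (t + h * θ)) h t

lemma av2_cont {Q : RG} (hQ : Continuous fun q : RP => Q q.1 q.2) : Continuous fun q : RP => av2 Q q.1 q.2 := by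
  unfold av2 av
  refine cpi'
    (f := fun (q : RP) θ => ∫ ρ in 0..1, Q (q.2 + q.1 * θ) (q.2 + q.1 * ρ)) ?_ 0 1
  exact cpi'
    (f := fun (q : (ℝ × ℝ) × ℝ) ρ => Q (q.1.2 + q.1.1 * q.2) (q.1.2 + q.1.1 * ρ)) (by unfold Function.uncurry; fun_prop) 0 1

lemma av2_zero (Q : RG) (t : ℝ) : av2 Q 0 t = Q t t := by simp [av2, av]

lemma av2_d {Q : RG} (hQ : Continuous fun q : RP => Q q.1 q.2) (hs : ∀ O j, Q O j = Q j O) {h : ℝ} (hh : h ≠ 0) (t : ℝ) :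
    HasDerivAt (av2 Q h) (2 * (h⁻¹ * (h⁻¹ * ∫ O in t..(t + h), (Q O (t + h) - Q O t)))) t := by
  have c1 : ∀ O, Continuous (Q O) := fun O => by fun_prop
  have c1' : ∀ j, Continuous fun O => Q O j := fun j => by fun_prop
  have c2 : ∀ y, Continuous fun O => ∫ j in 0..y, Q O j := fun y =>
    cpi' (f := Q) hQ 0 y
  have e : av2 Q h = fun t => h⁻¹ * (h⁻¹ * (((∫ O in 0..(t + h), ∫ j in 0..(t + h), Q O j) -
      (∫ O in 0..(t + h), ∫ j in 0..(t + 0), Q O j)) - ((∫ O in 0..(t + 0), ∫ j in 0..(t + h), Q O j) -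
      ∫ O in 0..(t + 0), ∫ j in 0..(t + 0), Q O j))) := by
    ext t
    simp only [add_zero]
    have ii : ∀ x y, IntervalIntegrable (fun O => (∫ j in 0..(t + h), Q O j) - ∫ j in 0..t, Q O j) volume x y :=
      fun x y => ((c2 _).sub (c2 _)).intervalIntegrable x y
    rw [← isub ((c2 _).intervalIntegrable _ _) ((c2 _).intervalIntegrable _ _),
      ← isub ((c2 _).intervalIntegrable _ _) ((c2 _).intervalIntegrable _ _),
      iisl (ii _ _) (ii _ _)]
    have : av2 Q h t = av (fun O => av (Q O) h t) h t := rfl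
    rw [this, av_eq hh]
    congr 1
    rw [← icm]
    congr 1; ext O
    rw [av_eq hh, ← iisl ((c1 O).intervalIntegrable 0 _) ((c1 O).intervalIntegrable 0 _)]
  rw [e]
  refine ((((HHd hQ h h t).sub (HHd hQ h 0 t)).sub ((HHd hQ 0 h t).sub (HHd hQ 0 0 t))).const_mul h⁻¹).const_mul h⁻¹ |>.congr_deriv ?_
  rw [isub ((c1' _).intervalIntegrable _ _) ((c1' _).intervalIntegrable _ _)]
  have s : ∀ y a, ∫ O in 0..a, Q O y = ∫ j in 0..a, Q y j := fun y a => by simp only [hs y]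
  have s1 : ∀ y, ∫ O in t..(t + h), Q O y = (∫ j in 0..(t + h), Q y j) - ∫ j in 0..t, Q y j := fun y => by
    rw [← s, ← s, iisl ((c1' y).intervalIntegrable 0 _) ((c1' y).intervalIntegrable 0 _)]
  rw [s1, s1]
  simp only [s, add_zero]
  ring

lemma pow_exp {p : ℝ} (hp : 1 < p) (M : ℝ) {ε : ℝ} (hε : 0 < ε) : ∃ δ > 0, ∀ x ∈ Icc 0 M, ∀ y ∈ Icc 0 M, |x - y| < δ →
    |x ^ p - y ^ p - p * y ^ (p - 1) * (x - y)| ≤ ε * |x - y| := by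
  have c : ContinuousOn (fun z : ℝ => p * z ^ (p - 1)) (Icc 0 M) :=
    (continuous_const.mul (continuous_id.rpow_const fun _ => Or.inr lnn)).continuousOn
  obtain ⟨δ, hδ, h⟩ := Metric.uniformContinuousOn_iff.1 (isCompact_Icc.uniformContinuousOn_of_continuous c) ε hε
  refine ⟨δ, hδ, fun x hx y hy hxy => ?_⟩
  have sub : uIcc y x ⊆ Icc 0 M := uIcc_subset_Icc hy hx
  have := (convex_uIcc y x).norm_image_sub_le_of_norm_hasDerivWithin_le
      (f := fun z : ℝ => z ^ p - z * (p * y ^ (p - 1))) (f' := fun z => p * z ^ (p - 1) - 1 * (p * y ^ (p - 1)))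
      (C := ε) (x := y) (y := x) (fun z hz => ?_) (fun z hz => ?_) left_mem_uIcc right_mem_uIcc
  · rw [norm_eq_abs, norm_eq_abs] at this; convert this using 2; ring
  · exact ((Real.hasDerivAt_rpow_const (Or.inr hp.le)).sub ((hasDerivAt_id z).mul_const _)).hasDerivWithinAt
  · have hz' : |z - y| ≤ |x - y| := abs_sub_left_of_mem_uIcc hz
    have := h z (sub hz) y hy (by rw [Real.dist_eq]; exact hz'.trans_lt hxy)
    rw [Real.dist_eq] at this
    simpa using this.le

lemma av_const (k h t : ℝ) : av (fun _ => k) h t = k := by simp [av]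

lemma av_abs {f g : RF} {h t B : ℝ} (hf : Continuous f) (hg : Continuous g)
    (hb : ∀ θ ∈ Icc (0:ℝ) 1, |f (t + h * θ) - g (t + h * θ)| ≤ B) : |av f h t - av g h t| ≤ B := by
  unfold av
  rw [← isub ((by fun_prop : Continuous fun θ => f (t + h * θ)).intervalIntegrable _ _)
    ((by fun_prop : Continuous fun θ => g (t + h * θ)).intervalIntegrable _ _)]
  have := nil (a := (0:ℝ)) (b := 1) (C := B)
    (f := fun θ => f (t + h * θ) - g (t + h * θ)) (fun θ hθ => by
      rw [uIoc_of_le zero_le_one] at hθ; exact hb θ ⟨hθ.1.le, hθ.2⟩)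
  simpa using this

lemma av_err {p : ℝ} (hp : 1 < p) {w : RF} {c e C : ℝ} (hw : Continuous w) (w0 : ∀ t, 0 ≤ w t) (C0 : 0 ≤ C)
    (hc : ∀ t ∈ Icc c e, ∀ t' ∈ Icc c e, |w t' - w t| ^ 2 ≤ C * |t' - t|) {ε : ℝ} (hε : 0 < ε) :
    ∃ h0 > 0, ∀ h ∈ Ioo 0 h0, ∀ t, t ∈ Icc c e → t + h ∈ Icc c e →
      |av (fun O => w O ^ p) h t - (av w h t) ^ p| ≤ ε * √(C * h) ∧ |w (t + h) - w t| ≤ √(C * h) := by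
  obtain ⟨M, hM⟩ := (isCompact_Icc (a := c) (b := e)).exists_bound_of_continuousOn hw.continuousOn
  obtain ⟨δ, hδ, H⟩ := pow_exp hp M hε
  refine ⟨δ ^ 2 / (C + 1), by positivity, fun h hh t ht ht' => ?_⟩
  have hD : √(C * h) < δ := by
    rw [Real.sqrt_lt' hδ]
    have h1 := hh.2
    rw [lt_div_iff₀ psv] at h1
    nlinarith [hh.1]
  have mem : ∀ θ ∈ Icc (0:ℝ) 1, t + h * θ ∈ Icc c e := fun θ hθ =>
    ⟨by nlinarith [ht.1, hh.1, hθ.1], by nlinarith [ht'.2, hh.1, hθ.2]⟩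
  have osc : ∀ θ ∈ Icc (0:ℝ) 1, ∀ θ' ∈ Icc (0:ℝ) 1, |w (t + h * θ) - w (t + h * θ')| ≤ √(C * h) := fun θ hθ θ' hθ' => by
    refine Real.le_sqrt_of_sq_le ((hc _ (mem θ' hθ') _ (mem θ hθ)).trans (mul_le_mul_of_nonneg_left ?_ C0))
    rw [abs_le]; constructor <;> nlinarith [hh.1, hθ.1, hθ.2, hθ'.1, hθ'.2, mul_nonneg hh.1.le hθ.1, mul_nonneg hh.1.le hθ'.1]
  have d : ∀ θ ∈ Icc (0:ℝ) 1, |w (t + h * θ) - av w h t| ≤ √(C * h) := fun θ hθ => by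
    rw [← av_const (w (t + h * θ)) h t]
    exact av_abs continuous_const hw fun θ' hθ' => osc θ hθ θ' hθ'
  have W : av w h t ∈ Icc 0 M := by
    constructor
    · exact inn zero_le_one fun θ _ => w0 _
    · have h1 := av_abs (f := w) (g := fun _ => 0) (h := h) (t := t) (B := M) hw continuous_const fun θ hθ => by
        simpa using hM _ (mem θ hθ)
      rw [av_const] at h1
      simpa using (le_abs_self _).trans h1
  have cp : Continuous fun O => w O ^ p := hw.rpow_const fun _ => Or.inr lnn
  refine ⟨?_, ?_⟩
  · set W0 := av w h t
    have e1 : W0 ^ p = av (fun O => W0 ^ p + p * W0 ^ (p - 1) * (w O - W0)) h t := by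
      have : ∀ k1 k2 : ℝ, av (fun O => k1 + k2 * (w O - W0)) h t = k1 := fun k1 k2 => by
        unfold av
        rw [iadd (by simp) ((by fun_prop : Continuous fun θ => k2 * (w (t + h * θ) - W0)).intervalIntegrable _ _),
          icm, isub ((by fun_prop : Continuous fun θ => w (t + h * θ)).intervalIntegrable _ _) (by simp)]
        have : ∫ θ in 0..1, w (t + h * θ) = W0 := rfl
        rw [this]; simp
      rw [this]
    rw [e1]
    refine av_abs cp fpp fun θ hθ => ?_
    have b1 : w (t + h * θ) ∈ Icc 0 M := ⟨w0 _, (le_abs_self _).trans (hM _ (mem θ hθ))⟩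
    have := H _ b1 W0 W ((d θ hθ).trans_lt hD)
    rw [show ∀ a b c : ℝ, a - (b + c) = a - b - c from fun a b c => by ring]
    exact this.trans (mul_le_mul_of_nonneg_left (d θ hθ) hε.le)
  · have := osc 1 (by simp) 0 (by simp)
    simpa using this

lemma energy_scalar {p : ℝ} (hp : 1 < p) {Q R : RG} {w y : RF} {c e C : ℝ}
    (hQ : Continuous fun q : RP => Q q.1 q.2) (hs : ∀ O j, Q O j = Q j O)
    (hR : Continuous fun q : RP => R q.1 q.2) (hw : Continuous w) (w0 : ∀ t, 0 ≤ w t)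
    (hy : Continuous y) (y0 : ∀ t, 0 < y t) (C0 : 0 ≤ C)
    (hc : ∀ t ∈ Icc c e, ∀ t' ∈ Icc c e, |w t' - w t| ^ 2 ≤ C * |t' - t|)
    (hq : ∀ t h, 0 < h → t ∈ Icc c e → t + h ∈ Icc c e → ∫ O in t..(t + h), (Q O (t + h) - Q O t) ≤
      -(∫ O in t..(t + h), R O t) ^ 2 / y t + (∫ O in t..(t + h), w O ^ p) * (w (t + h) - w t))
    {t1 t2 : ℝ} (h1 : c ≤ t1) (h12 : t1 ≤ t2) (h2 : t2 < e) :
    1 / 2 * Q t2 t2 - w t2 ^ (p + 1) / (p + 1) + ∫ t in t1..t2, (R t t) ^ 2 / y t ≤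
      1 / 2 * Q t1 t1 - w t1 ^ (p + 1) / (p + 1) := by
  have p1 : 0 < p + 1 := by linarith
  let F : RG := fun h t => 1 / 2 * av2 Q h t - (av w h t) ^ (p + 1) / (p + 1)
  let f : RG := fun h t => (av (fun O => R O t) h t) ^ 2 / y t
  have fc : Continuous fun q : RP => f q.1 q.2 := by
    have : Continuous fun q : RP => av (fun O => R O q.2) q.1 q.2 := by
      unfold av
      exact cpi'
        (f := fun (q : RP) θ => R (q.2 + q.1 * θ) q.2) (by unfold Function.uncurry; fun_prop) 0 1
    exact (this.pow 2).div (hy.comp continuous_snd) fun q => (y0 _).ne'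
  have Fc : Continuous fun q : RP => F q.1 q.2 :=
    (continuous_const.mul (av2_cont hQ)).sub (((av_cont hw).rpow_const fun _ => Or.inr p1.le).div_const _)
  have cp : Continuous fun O => w O ^ p := hw.rpow_const fun _ => Or.inr lnn
  have key : ∀ ε > 0, F 0 t2 - F 0 t1 + ∫ t in t1..t2, f 0 t ≤ ε * C * (t2 - t1) := by
    intro ε hε
    obtain ⟨h0, hh0, H⟩ := av_err hp hw w0 C0 hc hε
    have lim : ContinuousAt (fun h => F h t2 - F h t1 + ∫ t in t1..t2, f h t) 0 := by
      have g1 : Continuous fun h => ∫ t in t1..t2, f h t :=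
        cpi' (f := f) fc t1 t2
      have g2 : ∀ t, Continuous fun h => F h t := fun t => Fc.comp (by fun_prop : Continuous fun h : ℝ => (h, t))
      exact (((g2 t2).sub (g2 t1)).add g1).continuousAt
    refine le_of_tendsto (lim.tendsto.mono_left (nhdsWithin_le_nhds (s := Ioi 0))) ?_
    filter_upwards [Ioo_mem_nhdsGT (lt_min hh0 (sub_pos.2 h2))] with h hh
    have hh1 : h ∈ Ioo 0 h0 := ⟨hh.1, hh.2.trans_le (min_le_left _ _)⟩
    have hh2 : t2 + h ≤ e := by have := hh.2.trans_le (min_le_right _ _); linarith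
    have hne : h ≠ 0 := hh.1.ne'
    have fch : Continuous fun t => f h t := fc.comp (by fun_prop : Continuous fun t : ℝ => (h, t))
    have := intervalIntegral.sub_le_integral_of_hasDeriv_right_of_le (a := t1) (b := t2) (g := F h)
      (g' := fun t => 1 / 2 * (2 * (h⁻¹ * (h⁻¹ * ∫ O in t..(t + h), (Q O (t + h) - Q O t)))) -
        h⁻¹ * (w (t + h) - w t) * (p + 1) * (av w h t) ^ (p + 1 - 1) / (p + 1)) (φ := fun t => -f h t + ε * C) h12
      (Fc.comp (by fun_prop : Continuous fun t : ℝ => (h, t))).continuousOn (fun t ht => ?_)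
      ((fch.neg.add continuous_const).integrableOn_Icc) (fun t ht => ?_)
    · rw [iadd (f := fun t => -f h t) (fch.neg.intervalIntegrable _ _) (by simp), intervalIntegral.integral_neg] at this
      simp only [icst, smul_eq_mul] at this
      linarith
    · exact (((av2_d hQ hs hne t).const_mul _).sub (((av_d hw hne t).rpow_const (Or.inr lnn)).div_const _)).hasDerivWithinAt
    · have m1 : t ∈ Icc c e := ⟨h1.trans ht.1.le, ht.2.le.trans h2.le⟩
      have m2 : t + h ∈ Icc c e := ⟨by linarith [m1.1, hh.1], by linarith [ht.2]⟩
      obtain ⟨e1, e2⟩ := H h hh1 t m1 m2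
      have e3 := hq t h hh.1 m1 m2
      rw [show p + 1 - 1 = p by ring]
      have e4 : f h t = h⁻¹ * (h⁻¹ * ((∫ O in t..(t + h), R O t) ^ 2 / y t)) := by
        simp only [f]; rw [av_eq hne]; ring
      have e5 : av (fun O => w O ^ p) h t = h⁻¹ * ∫ O in t..(t + h), w O ^ p := av_eq hne t
      have hi : 0 < h⁻¹ := inv_pos.2 hh.1
      have e6 : (av (fun O => w O ^ p) h t - (av w h t) ^ p) * (w (t + h) - w t) ≤ ε * C * h := by
        refine (le_abs_self _).trans ?_
        rw [abs_mul]
        refine (mul_le_mul e1 e2 (abs_nonneg _) psv).trans (le_of_eq ?_)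
        rw [mul_assoc, Real.mul_self_sqrt (mul_nonneg C0 hh.1.le)]; ring
      have e7 := mul_le_mul_of_nonneg_left e6 hi.le
      have e8 := mul_le_mul_of_nonneg_left (mul_le_mul_of_nonneg_left e3 hi.le) hi.le
      rw [show h⁻¹ * (ε * C * h) = ε * C by field_simp] at e7
      rw [e5] at e7
      rw [e4]
      calc _ = h⁻¹ * (h⁻¹ * ∫ O in t..(t + h), (Q O (t + h) - Q O t)) - h⁻¹ * (w (t + h) - w t) * (av w h t) ^ p := by
            field_simp
        _ ≤ _ := by
            have : -(∫ O in t..(t + h), R O t) ^ 2 / y t = -((∫ O in t..(t + h), R O t) ^ 2 / y t) := by ring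
            rw [this] at e8
            linarith
  have fin : F 0 t2 - F 0 t1 + ∫ t in t1..t2, f 0 t ≤ 0 := by
    refine le_of_forall_pos_le_add fun η hη => ?_
    have := key (η / (C * (t2 - t1) + 1)) (div_pos hη (by nlinarith))
    refine this.trans ?_
    rw [zero_add]
    have hz : 0 ≤ C * (t2 - t1) := mul_nonneg C0 lnn
    rw [mul_assoc, div_mul_eq_mul_div, div_le_iff₀ lnn]
    nlinarith
  simp only [F, f, av2_zero, av_zero] at fin
  linarith

def QQ (S : RF) (X : RG) (O j : ℝ) : ℝ := ∫ x in 0..min (S O) (S j), X O x * X j x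

def PP (S : RF) (U : RG) (O j : ℝ) : ℝ := ∫ x in 0..S O, U O x * U j (max 0 x)

lemma cs {f g : RF} (hf : Continuous f) (hg : Continuous g) {R y : ℝ} (hR : 0 ≤ R) (hy : 0 < y)
    (h : ∫ x in 0..R, g x * g x ≤ y) : (∫ x in 0..R, f x * g x) ^ 2 / y ≤ ∫ x in 0..R, f x * f x := by
  set B := ∫ x in 0..R, f x * g x
  have h1 : 0 ≤ ∫ x in 0..R, (f x - B / y * g x) ^ 2 := inn hR fun x _ => sq_nonneg _
  have e : ∫ x in 0..R, (f x - B / y * g x) ^ 2 = (∫ x in 0..R, f x * f x) - (2 * (B / y)) * B +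
      (B / y) ^ 2 * ∫ x in 0..R, g x * g x := by
    simp only [B]
    rw [← icm, ← icm, ← isub
      ((by fun_prop : Continuous fun x => f x * f x).intervalIntegrable _ _)
      ((by fun_prop : Continuous fun x => 2 * ((∫ x in 0..R, f x * g x) / y) * (f x * g x)).intervalIntegrable _ _),
      ← iadd ((by fun_prop : Continuous fun x => f x * f x - 2 * ((∫ x in 0..R, f x * g x) / y) * (f x * g x)).intervalIntegrable _ _)
      ((by fun_prop : Continuous fun x => ((∫ x in 0..R, f x * g x) / y) ^ 2 * (g x * g x)).intervalIntegrable _ _)]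
    congr 1; ext x; ring
  have h2 : (B / y) ^ 2 * ∫ x in 0..R, g x * g x ≤ (B / y) ^ 2 * y := mul_le_mul_of_nonneg_left h (sq_nonneg _)
  have h3 : (B / y) ^ 2 * y = B ^ 2 / y := by field_simp
  have h4 : 2 * (B / y) * B = 2 * (B ^ 2 / y) := by ring
  linarith

section
variable {p a b : ℝ} {S V : RF} {U X Z : RG} (H : Cl p a b S V U X Z)
include H

lemma Cl.Qc : Continuous fun q : RP => QQ S X q.1 q.2 := by
  have := H.Xc
  have := H.Sc
  exact cpi
    (f := fun (q : RP) x => X q.1 x * X q.2 x) (by unfold Function.uncurry; fun_prop) fpp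

omit H in
lemma QQs (O j : ℝ) : QQ S X O j = QQ S X j O := by
  unfold QQ; rw [min_comm]; congr 1; ext x; ring

lemma Cl.tst (j : ℝ) : ∃ P, Tst P (fun x => U j (max 0 x)) ((Ioo 0 (S j)).indicator (X j)) := by
  have hU := H.Uc
  have hX := H.Xc
  have cX : Continuous (X j) := by fun_prop
  obtain ⟨K, K0, hK⟩ := H.Xb j j
  refine ⟨K, by fun_prop, ⟨{0, S j}, (Set.toFinite _).countable, fun x hx => ?_⟩, cX.measurable.indicator measurableSet_Ioo, fun x => ?_⟩
  · simp only [mem_insert_iff, mem_singleton_iff, not_or] at hx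
    rcases lt_or_gt_of_ne hx.1 with h | h
    · rw [indicator_of_notMem fun h' => absurd h'.1 lnn]
      refine (hasDerivAt_const x (U j 0)).congr_of_eventuallyEq ?_
      filter_upwards [Iio_mem_nhds h] with y hy
      rw [max_eq_left (le_of_lt (mem_Iio.1 hy))]
    · rcases lt_or_gt_of_ne hx.2 with h2 | h2
      · rw [indicator_of_mem (mem_Ioo.2 ⟨h, h2⟩)]
        refine (H.Ud j x ⟨h, h2⟩).congr_of_eventuallyEq ?_
        filter_upwards [Ioi_mem_nhds h] with y hy
        rw [max_eq_right (le_of_lt (mem_Ioi.1 hy))]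
      · rw [indicator_of_notMem fun h' => absurd h'.2 lnn]
        refine (hasDerivAt_const x (0:ℝ)).congr_of_eventuallyEq ?_
        filter_upwards [Ioi_mem_nhds h2] with y hy
        exact H.Uz j _ ((le_of_lt (mem_Ioi.1 hy)).trans ((le_max_right 0 y).trans (le_abs_self _)))
  · by_cases h : x ∈ Ioo 0 (S j)
    · rw [indicator_of_mem h]; exact hK j ⟨le_rfl, le_rfl⟩ x ⟨h.1.le, h.2.le⟩
    · rw [indicator_of_notMem h]; simpa

lemma Cl.Pd (hp : 1 < p) {t : ℝ} (ht : t ∈ Ioo a b) (j : ℝ) : HasDerivAt (fun O => PP S U O j)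
    (-V t * U j (S t) + (U t 0) ^ p * U j 0 - QQ S X t j) t := by
  obtain ⟨P, hP⟩ := H.tst j
  refine (H.wf hP hp ht).congr_deriv ?_
  simp only [max_self, max_eq_right (H.Sp t).le]
  congr 1
  have : ∀ x, X t x * (Ioo 0 (S j)).indicator (X j) x = (Ioo 0 (S j)).indicator (fun x => X t x * X j x) x := fun x => by
    by_cases h : x ∈ Ioo 0 (S j) <;> simp [h]
  simp only [this, QQ]
  rw [iole (H.Sp t).le, iole (lt_min (H.Sp t) (H.Sp j)).le,
    integral_Ioc_eq_integral_Ioo, integral_Ioc_eq_integral_Ioo, setIntegral_indicator measurableSet_Ioo, Ioo_inter_Ioo, max_self]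

lemma Cl.Rc (hp : 1 < p) : Continuous fun q : RP => -V q.1 * U q.2 (S q.1) + (U q.1 0) ^ p * U q.2 0 - QQ S X q.1 q.2 := by
  have h1 := H.Uc
  have h2 := H.Sc
  have h3 := H.Vc
  have h4 := H.wc hp
  have h5 : Continuous fun q : RP => (U q.1 0) ^ p := h4.comp continuous_fst
  exact Continuous.sub fpp H.Qc

lemma Cl.Smono {t t' : ℝ} (ht : t ∈ Ioo a b) (ht' : t' ∈ Ioo a b) (h : t ≤ t') : S t ≤ S t' := by
  have := monotoneOn_of_deriv_nonneg (convex_Ioo a b) H.Sc.continuousOn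
    (by rw [interior_Ioo]; exact fun t ht => (H.Sd t ht).differentiableAt.differentiableWithinAt)
    (by rw [interior_Ioo]; exact fun t ht => by rw [(H.Sd t ht).deriv]; exact H.V0 t)
  exact this ht ht' h

lemma Cl.PPe {O j R : ℝ} (h : S O ≤ R) : PP S U O j = ∫ x in 0..R, U O x * U j x := by
  have hU := H.Uc
  rw [PP, H.Ui fpp h]
  refine icon fun x hx => ?_
  rw [uIcc_of_le ((H.Sp O).le.trans h)] at hx
  simp [max_eq_right hx.1]

lemma Cl.hq (hp : 1 < p) {t h : ℝ} (hh : 0 < h) (ht : t ∈ Ioo a b) (ht' : t + h ∈ Ioo a b) :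
    ∫ O in t..(t + h), (QQ S X O (t + h) - QQ S X O t) ≤
      -(∫ O in t..(t + h), (-V O * U t (S O) + (U O 0) ^ p * U t 0 - QQ S X O t)) ^ 2 / (1 + PP S U t t) +
      (∫ O in t..(t + h), (U O 0) ^ p) * (U (t + h) 0 - U t 0) := by
  have hU := H.Uc
  have hS := H.Sc
  have hV := H.Vc
  have hw := H.wc hp
  have hQ := H.Qc
  have le : t ≤ t + h := by linarith
  have mem : ∀ O ∈ Icc t (t + h), O ∈ Ioo a b := fun O hO => ⟨ht.1.trans_le hO.1, hO.2.trans_lt ht'.2⟩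
  have Rc : ∀ j, Continuous fun O => -V O * U j (S O) + (U O 0) ^ p * U j 0 - QQ S X O j := fun j =>
    (H.Rc hp).comp (by fun_prop : Continuous fun O : ℝ => (O, j))
  have F : ∀ j, ∫ O in t..(t + h), (-V O * U j (S O) + (U O 0) ^ p * U j 0 - QQ S X O j) = PP S U (t + h) j - PP S U t j := fun j => by
    refine ftc (fun O hO => H.Pd hp (mem O ?_) j) ((Rc j).intervalIntegrable _ _)
    rwa [uIcc_of_le le] at hO
  set R := S (t + h)
  have SR : S t ≤ R := H.Smono ht ht' le
  have R0 : 0 ≤ R := (H.Sp _).le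
  have c1 : ∀ j, Continuous (U j) := fun j => by fun_prop
  have i1 : ∀ O j, IntervalIntegrable (fun x => U O x * U j x) volume 0 R := fun O j => ((c1 O).mul (c1 j)).intervalIntegrable _ _
  have B : ∫ x in 0..R, (U (t + h) x - U t x) * U t x = PP S U (t + h) t - PP S U t t := by
    rw [H.PPe le_rfl, H.PPe SR]
    simp only [sub_mul]
    exact isub (i1 _ _) (i1 _ _)
  have N : ∫ x in 0..R, (U (t + h) x - U t x) * (U (t + h) x - U t x) =
      (PP S U (t + h) (t + h) - PP S U t (t + h)) - (PP S U (t + h) t - PP S U t t) := by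
    rw [H.PPe (le_rfl : S (t + h) ≤ R), H.PPe (le_rfl : S (t + h) ≤ R), H.PPe SR, H.PPe SR, ← isub (i1 _ _) (i1 _ _),
      ← isub (i1 _ _) (i1 _ _), ← isub ((i1 _ _).sub (i1 _ _)) ((i1 _ _).sub (i1 _ _))]
    congr 1; ext x; ring
  have y0 : 0 ≤ PP S U t t := by
    rw [H.PPe SR]; exact inn R0 fun x _ => mul_self_nonneg _
  have C := cs (f := fun x => U (t + h) x - U t x) (g := U t) (R := R) (y := 1 + PP S U t t) fpp (c1 t) R0 lnn
    (by rw [← H.PPe SR]; linarith)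
  rw [B, N, ← F, ← F, ← isub ((Rc _).intervalIntegrable _ _) ((Rc _).intervalIntegrable _ _)] at C
  have cQ : ∀ j, Continuous fun O => QQ S X O j := fun j => hQ.comp (by fun_prop : Continuous fun O : ℝ => (O, j))
  have D : ∫ O in t..(t + h), ((-V O * U (t + h) (S O) + (U O 0) ^ p * U (t + h) 0 - QQ S X O (t + h)) -
      (-V O * U t (S O) + (U O 0) ^ p * U t 0 - QQ S X O t)) ≤
      ∫ O in t..(t + h), ((U O 0) ^ p * (U (t + h) 0 - U t 0) - (QQ S X O (t + h) - QQ S X O t)) := by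
    refine intervalIntegral.integral_mono_on le (((Rc _).sub (Rc _)).intervalIntegrable _ _)
      (((hw.mul continuous_const).sub ((cQ _).sub (cQ _))).intervalIntegrable _ _) fun O hO => ?_
    have z : U t (S O) = 0 := H.Uz t _ ((H.Smono ht (mem O hO) hO.1).trans (le_abs_self _))
    have n := mul_nonneg (H.V0 O) (H.U0 (t + h) (S O))
    rw [z]; linarith
  rw [isub (f := fun O => (U O 0) ^ p * (U (t + h) 0 - U t 0)) (g := fun O => QQ S X O (t + h) - QQ S X O t)
    ((hw.mul continuous_const).intervalIntegrable _ _) (((cQ _).sub (cQ _)).intervalIntegrable _ _),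
    intervalIntegral.integral_mul_const] at D
  rw [neg_div]
  linarith

lemma Cl.hol (hp : 1 < p) {c e : ℝ} (hc : a < c) (he : e < b) : ∃ C, 0 ≤ C ∧
    ∀ t ∈ Icc c e, ∀ t' ∈ Icc c e, |U t' 0 - U t 0| ^ 2 ≤ C * |t' - t| := by
  have hw := H.wc hp
  obtain ⟨K, K0, hK⟩ := H.Xb c e
  obtain ⟨L, hL⟩ := (isCompact_Icc (a := c) (b := e)).exists_bound_of_continuousOn H.Vc.continuousOn
  obtain ⟨G, hG⟩ := (isCompact_Icc (a := c) (b := e)).exists_bound_of_continuousOn hw.continuousOn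
  have key : ∀ t ∈ Icc c e, ∀ r, 0 < r → t + r ∈ Icc c e → |U (t + r) 0 - U t 0| ≤ (K * 4 + |G| * 4 + |L| * 4) * √r := by
    intro t ht r hr ht'
    have m1 : t ∈ Ioo a b := ⟨hc.trans_le ht.1, ht.2.trans_lt he⟩
    have m2 : t + r ∈ Ioo a b := ⟨hc.trans_le ht'.1, ht'.2.trans_lt he⟩
    have li := H.lip K0 fun x hx => hK t ht x ⟨hx.1.le, hx.2.le⟩
    have mm : ∀ j ∈ Ioo 0 r, t + j ∈ Icc c e := fun j hj => ⟨by linarith [ht.1, hj.1], by linarith [ht'.2, hj.2]⟩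
    obtain ⟨b1, b2⟩ := H.bds (t0 := t) (A := r) hp (abs_nonneg L) (abs_nonneg G)
      (fun j hj => (le_abs_self _).trans ((hL _ (mm j hj)).trans (le_abs_self _)))
      (fun j hj => (le_abs_self _).trans ((hG _ (mm j hj)).trans (le_abs_self _)))
    rw [H.rep hp m1 m2 hr.le le_rfl, NN, F0, if_neg hr.not_ge]
    have e1 := abs_le.1 (li.FFini hr 0)
    have e2 := abs_le.1 (b2.lay0.bound hr.le 0)
    have e3 := abs_le.1 ((b1.lay b1 (S t)).bound hr.le 0)
    have e4 := abs_le.1 ((b1.lay b1.neg (-S t)).bound hr.le 0)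
    rw [abs_le]; constructor <;> linarith [e1.1, e1.2, e2.1, e2.2, e3.1, e3.2, e4.1, e4.2]
  set C := K * 4 + |G| * 4 + |L| * 4
  have C0 : 0 ≤ C := by positivity
  have key2 : ∀ t ∈ Icc c e, ∀ t' ∈ Icc c e, t < t' → |U t' 0 - U t 0| ^ 2 ≤ C ^ 2 * |t' - t| := fun t ht t' ht' h => by
    have := key t ht (t' - t) lnn (by simpa using ht')
    rw [add_sub_cancel] at this
    calc _ ≤ (C * √(t' - t)) ^ 2 := by gcongr
      _ = _ := by rw [mul_pow, sq_sqrt lnn, abs_of_pos lnn]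
  refine ⟨C ^ 2, sq_nonneg _, fun t ht t' ht' => ?_⟩
  rcases lt_trichotomy t t' with h | h | h
  · exact key2 t ht t' ht' h
  · simp [h]
  · rw [abs_sub_comm, abs_sub_comm t']; exact key2 t' ht' t ht h

lemma Cl.PPc : Continuous fun t => PP S U t t := by
  have hU := H.Uc
  have hS := H.Sc
  exact cpi
    (f := fun t x => U t x * U t (max 0 x)) (by unfold Function.uncurry; fun_prop) hS

lemma Cl.PP0 (t : ℝ) : 0 ≤ PP S U t t := inn (H.Sp t).le fun _ _ => mul_nonneg (H.U0 _ _) (H.U0 _ _)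

lemma Cl.energy (hp : 1 < p) {t1 t2 : ℝ} (h1 : a < t1) (h12 : t1 ≤ t2) (h2 : t2 < b) :
    1 / 2 * QQ S X t2 t2 - U t2 0 ^ (p + 1) / (p + 1) + ∫ t in t1..t2, (U t 0 ^ (p + 1) - QQ S X t t) ^ 2 / (1 + PP S U t t) ≤
      1 / 2 * QQ S X t1 t1 - U t1 0 ^ (p + 1) / (p + 1) := by
  have hU := H.Uc
  obtain ⟨e, he1, he2⟩ := exists_between h2
  obtain ⟨C, C0, hC⟩ := H.hol hp h1 he2
  have := energy_scalar hp (Q := QQ S X) (R := fun O j => -V O * U j (S O) + (U O 0) ^ p * U j 0 - QQ S X O j)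
    (w := fun t => U t 0) (y := fun t => 1 + PP S U t t) H.Qc QQs (H.Rc hp) fpp (fun t => H.U0 t 0)
    (continuous_const.add H.PPc) (fun t => by linarith [H.PP0 t]) C0 hC
    (fun t h hh ht ht' => H.hq hp hh ⟨h1.trans_le ht.1, ht.2.trans_lt he2⟩ ⟨h1.trans_le ht'.1, ht'.2.trans_lt he2⟩)
    le_rfl h12 he1
  have e : ∀ t, -V t * U t (S t) + (U t 0) ^ p * U t 0 = U t 0 ^ (p + 1) := fun t => by
    rw [H.Uz t (S t) (le_abs_self _), rpow_add_one' (H.U0 t 0) lnn]; ring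
  simpa only [e] using this

lemma Cl.L2d (hp : 1 < p) {t : ℝ} (ht : t ∈ Ioo a b) :
    HasDerivAt (fun t => PP S U t t) (2 * (U t 0 ^ (p + 1) - QQ S X t t)) t := by
  have hU := H.Uc
  have Rc := H.Rc hp
  have sy : ∀ O j, PP S U O j = PP S U j O := fun O j => by
    rw [H.PPe (le_max_left (S O) (S j)), H.PPe (le_max_right (S O) (S j))]; congr 1; ext x; ring
  set R : RG := fun O j => -V O * U j (S O) + (U O 0) ^ p * U j 0 - QQ S X O j
  have Rc' : ∀ j, Continuous fun O => R O j := fun j => Rc.comp (by fun_prop : Continuous fun O : ℝ => (O, j))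
  have e : 2 * (U t 0 ^ (p + 1) - QQ S X t t) = ∫ θ in 0..1, (R (t + 0 * θ) (t + 0) + R (t + 0 * θ) t) := by
    simp only [zero_mul, add_zero, icst, sub_zero, smul_eq_mul, R]
    rw [H.Uz t (S t) (le_abs_self _), rpow_add_one' (H.U0 t 0) lnn]; ring
  rw [hasDerivAt_iff_tendsto_slope_zero, e]
  have c : Continuous fun h => ∫ θ in 0..1, (R (t + h * θ) (t + h) + R (t + h * θ) t) :=
    cpi'
      (f := fun h θ => R (t + h * θ) (t + h) + R (t + h * θ) t) (by
        unfold Function.uncurry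
        exact (Rc.comp (by fun_prop : Continuous fun q : RP => (t + q.1 * q.2, t + q.1))).add
          (Rc.comp (by fun_prop : Continuous fun q : RP => (t + q.1 * q.2, t)))) 0 1
  refine ((c.tendsto 0).mono_left (nhdsWithin_le_nhds (s := {0}ᶜ))).congr' ?_
  have ev : ∀ᶠ h in 𝓝 (0:ℝ), t + h ∈ Ioo a b := by
    have : ContinuousAt (fun h : ℝ => t + h) 0 := by fun_prop
    exact this.preimage_mem_nhds (by rw [add_zero]; exact isOpen_Ioo.mem_nhds ht)
  filter_upwards [nhdsWithin_le_nhds ev, self_mem_nhdsWithin] with h hh hne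
  have F : ∀ j, ∫ O in t..(t + h), R O j = PP S U (t + h) j - PP S U t j := fun j =>
    ftc (fun O hO => H.Pd hp (ordConnected_Ioo.uIcc_subset ht hh hO) j) ((Rc' j).intervalIntegrable _ _)
  have := av_eq (f := fun O => R O (t + h) + R O t) hne t
  rw [iadd ((Rc' _).intervalIntegrable _ _) ((Rc' _).intervalIntegrable _ _), F, F, sy t (t + h)] at this
  unfold av at this
  rw [this, smul_eq_mul]; ring
end

def En (p : ℝ) (S : RF) (U X : RG) (t : ℝ) : ℝ := 1 / 2 * QQ S X t t - U t 0 ^ (p + 1) / (p + 1)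

section
variable {p a b : ℝ} {S V : RF} {U X Z : RG} (H : Cl p a b S V U X Z)
include H

lemma Cl.gc (hp : 1 < p) : Continuous fun t => U t 0 ^ (p + 1) - QQ S X t t := by
  have hU := H.Uc
  exact ((by fun_prop : Continuous fun t => U t 0).rpow_const fun _ => Or.inr lnn).sub
    (H.Qc.comp (by fun_prop : Continuous fun t : ℝ => (t, t)))

lemma Cl.bI (hp : 1 < p) {t1 t E1 C Y T0 : ℝ} (h1 : a < t1) (ht1 : t1 ≤ t) (ht : t < b) (hT : t - t1 ≤ T0)
    (hE : En p S U X t1 ≤ E1) (hC : ∀ j ∈ Icc t1 t, -C ≤ En p S U X j) (hY : PP S U t1 t1 ≤ Y) :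
    ∫ j in t1..t, (U j 0 ^ (p + 1)) ^ 2 ≤
      ((p + 1) / (p - 1)) ^ 2 * (2 * ((1 + Y) * exp (T0 + (E1 + C)) * (E1 + C)) + 8 * (|E1| + |C|) ^ 2 * T0) := by
  have hg := H.gc hp
  have hP := H.PPc
  have m : ∀ j ∈ Icc t1 t, j ∈ Ioo a b := fun j hj => ⟨h1.trans_le hj.1, hj.2.trans_lt ht⟩
  have z1 : ∀ j, 0 < 1 + PP S U j j := fun j => by linarith [H.PP0 j]
  have qc : Continuous fun j => (U j 0 ^ (p + 1) - QQ S X j j) ^ 2 / (1 + PP S U j j) :=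
    (hg.pow 2).div (continuous_const.add hP) fun j => (z1 j).ne'
  have DD : ∀ j ∈ Icc t1 t, ∫ r in t1..j, (U r 0 ^ (p + 1) - QQ S X r r) ^ 2 / (1 + PP S U r r) ≤ E1 + C := fun j hj => by
    have e := H.energy hp h1 hj.1 (m j hj).2
    have := hC j hj
    unfold En at this hE
    linarith
  have zb : ∀ j ∈ Icc t1 t, 1 + PP S U j j ≤ (1 + Y) * exp (T0 + (E1 + C)) := fun j hj => by
    have := intervalIntegral.sub_le_integral_of_hasDeriv_right_of_le (a := t1) (b := j) (g := fun r => Real.log (1 + PP S U r r))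
      (g' := fun r => 2 * (U r 0 ^ (p + 1) - QQ S X r r) / (1 + PP S U r r))
      (φ := fun r => 1 + (U r 0 ^ (p + 1) - QQ S X r r) ^ 2 / (1 + PP S U r r)) hj.1
      (Continuous.continuousOn ((continuous_const.add hP).log fun r => (z1 r).ne')) (fun r hr =>
        (((H.L2d hp (m r ⟨hr.1.le, hr.2.le.trans hj.2⟩)).const_add 1).log (z1 r).ne').hasDerivWithinAt)
      (continuous_const.add qc).integrableOn_Icc (fun r hr => by
        have p0 := H.PP0 r
        have zr := z1 r
        have e : 1 + (U r 0 ^ (p + 1) - QQ S X r r) ^ 2 / (1 + PP S U r r) =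
          ((1 + PP S U r r) + (U r 0 ^ (p + 1) - QQ S X r r) ^ 2) / (1 + PP S U r r) := by field_simp
        rw [e]
        gcongr
        nlinarith [sq_nonneg (U r 0 ^ (p + 1) - QQ S X r r - 1)])
    rw [iadd (by simp) (qc.intervalIntegrable _ _)] at this
    simp only [icst, smul_eq_mul, mul_one] at this
    have h3 := DD j hj
    have h4 : Real.log (1 + PP S U t1 t1) ≤ Real.log (1 + Y) := Real.log_le_log (z1 t1) lnn
    have h5 : 0 < 1 + Y := by linarith [z1 t1]
    rw [← Real.log_le_log_iff (z1 j) psv, Real.log_mul h5.ne' (exp_pos _).ne', Real.log_exp]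
    linarith [hj.2]
  have t1m : t1 ∈ Icc t1 t := ⟨le_rfl, ht1⟩
  set ZZ := (1 + Y) * exp (T0 + (E1 + C))
  have ZZ0 : 0 < ZZ := (z1 t1).trans_le (zb t1 t1m)
  have gb : ∫ j in t1..t, (U j 0 ^ (p + 1) - QQ S X j j) ^ 2 ≤ ZZ * (E1 + C) := by
    refine le_trans ?_ (mul_le_mul_of_nonneg_left (DD t ⟨ht1, le_rfl⟩) ZZ0.le)
    rw [← icm]
    refine intervalIntegral.integral_mono_on ht1 ((hg.pow 2).intervalIntegrable _ _) ((continuous_const.mul qc).intervalIntegrable _ _) fun j hj => ?_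
    have zz := z1 j
    rw [mul_div_assoc', le_div_iff₀ (z1 j), mul_comm]
    exact mul_le_mul_of_nonneg_right (zb j hj) (sq_nonneg _)
  have p1 : 0 < p - 1 := by linarith
  have pp : 0 < p + 1 := by linarith
  have pt : ∀ j ∈ Icc t1 t, (U j 0 ^ (p + 1)) ^ 2 ≤ ((p + 1) / (p - 1)) ^ 2 *
      (2 * (U j 0 ^ (p + 1) - QQ S X j j) ^ 2 + 8 * (|E1| + |C|) ^ 2) := fun j hj => by
    have e1 : En p S U X j ≤ E1 := by
      have e := H.energy hp h1 hj.1 (m j hj).2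
      have n : 0 ≤ ∫ r in t1..j, (U r 0 ^ (p + 1) - QQ S X r r) ^ 2 / (1 + PP S U r r) :=
        inn hj.1 fun r _ => div_nonneg (sq_nonneg _) (z1 r).le
      unfold En at hE ⊢; linarith
    have e2 := hC j hj
    have e3 : U j 0 ^ (p + 1) = (p + 1) / (p - 1) * ((U j 0 ^ (p + 1) - QQ S X j j) + 2 * En p S U X j) := by
      unfold En; field_simp; ring
    have e4 : En p S U X j ^ 2 ≤ (|E1| + |C|) ^ 2 := by
      rw [sq_le_sq, abs_of_nonneg (a := |E1| + |C|) psv]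
      rw [abs_le]; constructor <;> linarith [le_abs_self E1, le_abs_self C, abs_nonneg E1, abs_nonneg C]
    have e5 : (U j 0 ^ (p + 1)) ^ 2 = ((p + 1) / (p - 1)) ^ 2 * ((U j 0 ^ (p + 1) - QQ S X j j) + 2 * En p S U X j) ^ 2 := by
      rw [← mul_pow, ← e3]
    rw [e5]
    gcongr
    nlinarith [sq_nonneg ((U j 0 ^ (p + 1) - QQ S X j j) - 2 * En p S U X j)]
  have wc : Continuous fun j => (U j 0 ^ (p + 1)) ^ 2 := by
    have hU := H.Uc
    exact ((by fun_prop : Continuous fun t => U t 0).rpow_const fun _ => Or.inr pp.le).pow 2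
  refine (intervalIntegral.integral_mono_on ht1 (wc.intervalIntegrable _ _) ((by fun_prop : Continuous fun j => ((p + 1) / (p - 1)) ^ 2 *
      (2 * (U j 0 ^ (p + 1) - QQ S X j j) ^ 2 + 8 * (|E1| + |C|) ^ 2)).intervalIntegrable _ _) pt).trans ?_
  rw [icm, iadd ((by fun_prop : Continuous fun j => 2 * (U j 0 ^ (p + 1) - QQ S X j j) ^ 2).intervalIntegrable _ _) (by simp),
    icm]
  simp only [icst, smul_eq_mul]
  refine mul_le_mul_of_nonneg_left ?_ (sq_nonneg _)
  have := mul_le_mul_of_nonneg_left hT (by positivity : 0 ≤ 8 * (|E1| + |C|) ^ 2)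
  linarith

lemma Cl.bU (hp : 1 < p) {t1 r M1 W T0 : ℝ} (h1 : a < t1) (hr : 0 < r) (ht : t1 + r < b) (hT : r ≤ T0)
    (hM : ∀ x, U t1 x ≤ M1) (hW : ∫ j in t1..(t1 + r), (U j 0 ^ (p + 1)) ^ 2 ≤ W) (x : ℝ) :
    U (t1 + r) x ≤ M1 + 2 * (W + (p + 2) * T0 ^ (1 / (p + 2))) := by
  have hw := H.wc hp
  have p0 : 0 < p := by linarith
  have m1 : t1 ∈ Ioo a b := ⟨h1, by linarith⟩
  have m2 : t1 + r ∈ Ioo a b := ⟨by linarith, ht⟩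
  obtain ⟨L, G, bV, bG⟩ := H.bdsE hp t1 r
  rw [H.rep hp m1 m2 hr.le le_rfl, NN, F0, if_neg hr.not_ge]
  have f1 : FF (U t1) r x ≤ M1 := by
    obtain ⟨K, hK⟩ := H.lipE t1
    exact (le_abs_self _).trans (hK.FFbd (fun y => by rw [abs_of_nonneg (H.U0 _ _)]; exact hM y) r x)
  have nn : ∀ (f : RF) ρ, (∀ j, 0 ≤ f j) → 0 ≤ LV (ct r f) ρ r x := fun f ρ hf =>
    integral_nonneg fun j => mul_nonneg (indicator_nonneg (fun j _ => hf j) j) (hk_nonneg _ _)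
  have f2 := nn (fun j => V (t1 + j)) (pth (S t1) (ct r fun j => V (t1 + j))) fun j => H.V0 _
  have f3 := nn (fun j => V (t1 + j)) (pth (-S t1) (-ct r fun j => V (t1 + j))) fun j => H.V0 _
  have f4 : LV (ct r fun j => U (t1 + j) 0 ^ p) (fun _ => 0) r x ≤ W + (p + 2) * T0 ^ (1 / (p + 2)) := by
    have q0 : -1 < -((p + 1) / (p + 2)) := by
      have : (p + 1) / (p + 2) < 1 := by rw [div_lt_one lnn]; linarith
      linarith
    have qe : -((p + 1) / (p + 2)) + 1 = 1 / (p + 2) := by field_simp; ring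
    have wc : Continuous fun j => (U (t1 + j) 0 ^ (p + 1)) ^ 2 := by
      have hU := H.Uc
      exact ((by fun_prop : Continuous fun t => U (t1 + t) 0).rpow_const fun _ => Or.inr lnn).pow 2
    have i2 : IntervalIntegrable (fun j : ℝ => (r - j) ^ (-((p + 1) / (p + 2)))) volume 0 r := by
      have := (intervalIntegral.intervalIntegrable_rpow' (a := r) (b := 0) q0).comp_sub_left r
      simpa using this
    have ii : IntegrableOn (fun j => (U (t1 + j) 0 ^ (p + 1)) ^ 2 + (r - j) ^ (-((p + 1) / (p + 2)))) (Ioo 0 r) := by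
      have := (wc.intervalIntegrable 0 r).add i2
      exact ((intervalIntegrable_iff_integrableOn_Ioc_of_le hr.le).1 this).mono_set Ioo_subset_Ioc_self
    have val : ∫ j in Ioo 0 r, ((U (t1 + j) 0 ^ (p + 1)) ^ 2 + (r - j) ^ (-((p + 1) / (p + 2)))) ≤ W + (p + 2) * T0 ^ (1 / (p + 2)) := by
      rw [← integral_Ioc_eq_integral_Ioo, ← iole hr.le, iadd (wc.intervalIntegrable 0 r) i2]
      refine add_le_add ?_ ?_
      · have := intervalIntegral.integral_comp_add_left (a := 0) (b := r) (fun j => (U j 0 ^ (p + 1)) ^ 2) t1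
        rw [this]; simpa using hW
      · have := intervalIntegral.integral_comp_sub_left (a := 0) (b := r) (fun j : ℝ => j ^ (-((p + 1) / (p + 2)))) r
        rw [this]
        simp only [sub_self, sub_zero]
        rw [integral_rpow (Or.inl q0), qe, zero_rpow psv, sub_zero, div_div_eq_mul_div, div_one, mul_comm]
        gcongr
    refine le_trans ?_ val
    rw [← integral_indicator measurableSet_Ioo]
    refine integral_mono_of_nonneg (ae_of_all _ fun j => mul_nonneg (indicator_nonneg (fun j _ => rpow_nonneg (H.U0 _ _) _) j) (hk_nonneg _ _))
      (ii.integrable_indicator measurableSet_Ioo) (ae_of_all _ fun j => ?_)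
    dsimp only
    by_cases hj : j ∈ Ioo 0 r
    · rw [ct_in hj, indicator_of_mem hj]
      have s0 : 0 < r - j := by linarith [hj.2]
      have w0 := H.U0 (t1 + j) 0
      refine (mul_le_mul_of_nonneg_left (hk_le _ _) (rpow_nonneg w0 _)).trans ?_
      have hol : (2 * (p + 1) / p).HolderConjugate (2 * (p + 1) / (p + 2)) := by
        rw [Real.holderConjugate_iff]
        constructor
        · rw [lt_div_iff₀ p0]; linarith
        · field_simp; ring
      have y := Real.young_inequality_of_nonneg (rpow_nonneg w0 p) (by positivity : 0 ≤ (√(r - j))⁻¹) hol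
      have e1 : (U (t1 + j) 0 ^ p) ^ (2 * (p + 1) / p) = (U (t1 + j) 0 ^ (p + 1)) ^ 2 := by
        rw [← rpow_mul w0, ← rpow_natCast, ← rpow_mul w0]; congr 1; push_cast; field_simp
      have e2 : ((√(r - j))⁻¹) ^ (2 * (p + 1) / (p + 2)) = (r - j) ^ (-((p + 1) / (p + 2))) := by
        rw [Real.sqrt_eq_rpow, ← rpow_neg s0.le, ← rpow_mul s0.le]; congr 1; field_simp
      rw [e1, e2] at y
      refine y.trans (add_le_add ?_ ?_)
      · exact div_le_self psv (by rw [le_div_iff₀ p0]; linarith)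
      · exact div_le_self psv (by rw [le_div_iff₀ lnn]; linarith)
    · rw [ct_out hj, indicator_of_notMem hj]; simp
  linarith
end

lemma d2min {f f' : RF} {x f2 : ℝ} (h : IsLocalMin f x) (h1 : ∀ᶠ y in 𝓝 x, HasDerivAt f (f' y) y)
    (h2 : HasDerivAt f' f2 x) : 0 ≤ f2 := by
  by_contra hn
  have e : deriv f =ᶠ[𝓝 x] f' := h1.mono fun y hy => hy.deriv
  have hm := isLocalMax_of_deriv_deriv_neg (f := f) (x₀ := x) (by rw [e.deriv_eq, h2.deriv]; exact not_le.1 hn)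
    h.deriv_eq_zero h1.self_of_nhds.continuousAt
  have c : f =ᶠ[𝓝 x] fun _ => f x := by
    filter_upwards [h, hm] with y a b using le_antisymm b a
  have z : f' =ᶠ[𝓝 x] fun _ => 0 := by
    filter_upwards [c.eventuallyEq_nhds, h1] with y hy hy'
    exact hy'.unique ((hasDerivAt_const y (f x)).congr_of_eventuallyEq hy)
  have := (h2.congr_of_eventuallyEq z.symm).unique (hasDerivAt_const x (0:ℝ))
  linarith

lemma minp {K : Set (ℝ × ℝ)} (hK : IsCompact K) {z : RG} (hz : ContinuousOn (fun q : RP => z q.1 q.2) K)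
    (h : ∀ t x, (t, x) ∈ K → z t x < 0 → (∀ q ∈ K, z t x ≤ z q.1 q.2) → (∀ᶠ y in 𝓝 x, (t, y) ∈ K) ∧ (∀ᶠ j in 𝓝[<] t, (j, x) ∈ K) ∧
      ∃ (zx : RF) (zt zxx : ℝ), (∀ᶠ y in 𝓝 x, HasDerivAt (z t) (zx y) y) ∧ HasDerivAt zx zxx x ∧
        HasDerivAt (fun j => z j x) zt t ∧ zxx < zt) : ∀ t x, (t, x) ∈ K → 0 ≤ z t x := by
  intro t0 x0 h0
  obtain ⟨⟨t, x⟩, hm, hmin⟩ := hK.exists_isMinOn ⟨_, h0⟩ hz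
  have hmin' : ∀ q ∈ K, z t x ≤ z q.1 q.2 := fun q hq => hmin hq
  by_contra hn
  have hneg : z t x < 0 := (hmin' _ h0).trans_lt (not_le.1 hn)
  obtain ⟨e1, e2, zx, zt, zxx, d1, d2, d3, lt⟩ := h t x hm hneg hmin'
  have a1 := d2min (f := z t) (e1.mono fun y hy => hmin' (t, y) hy) d1 d2
  have a2 : zt ≤ 0 := by
    have tl := (hasDerivAt_iff_tendsto_slope.1 d3).mono_left (nhdsWithin_mono t (fun y hy => ne_of_lt hy : Iio t ⊆ {t}ᶜ))
    refine le_of_tendsto tl ?_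
    filter_upwards [e2, self_mem_nhdsWithin] with j hj hj'
    rw [slope_def_field]
    have hj'' : j < t := hj'
    exact div_nonpos_of_nonneg_of_nonpos (by have := hmin' (j, x) hj; simp only at this; linarith) lnn
  linarith

def NN1 (ψ : RF) (b : ℝ) (g v : RF) (t x : ℝ) : ℝ :=
  FF1 ψ t x + 2 * LV1 g (fun _ => 0) t x - LV1 v (pth b v) t x - LV1 v (pth (-b) (-v)) t x
def NN2 (ψ : RF) (b : ℝ) (g v : RF) (t x : ℝ) : ℝ :=
  FF2 ψ t x + 2 * LV2 g (fun _ => 0) t x - LV2 v (pth b v) t x - LV2 v (pth (-b) (-v)) t x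

lemma NNoff {B K : ℝ} {ψ : RF} (h : LipB B K ψ) {A G L b : ℝ} {g v : RF} (hg : Bd A G g) (hv : Bd A L v) {t x : ℝ} (ht : 0 < t)
    (x0 : x ≠ 0) (x1 : x ≠ pth b v t) (x2 : x ≠ -pth b v t) :
    HasDerivAt (NN ψ b g v t) (NN1 ψ b g v t x) x ∧ HasDerivAt (NN1 ψ b g v t) (NN2 ψ b g v t x) x ∧
    HasDerivAt (fun t => NN ψ b g v t x) (NN2 ψ b g v t x) t ∧
    ContinuousAt (fun q : RP => NN1 ψ b g v q.1 q.2) (t, x) ∧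
    ContinuousAt (fun q : RP => NN2 ψ b g v q.1 q.2) (t, x) := by
  rw [← pth_neg] at x2
  obtain ⟨f1, f2, f3, -, f4, f5⟩ := h.off ht x
  obtain ⟨a1, a2, a3, a4, a5⟩ := hg.lay0.off (t := t) x0
  obtain ⟨b1, b2, b3, b4, b5⟩ := (hv.lay hv b).off x1
  obtain ⟨c1, c2, c3, c4, c5⟩ := (hv.lay hv.neg (-b)).off x2
  refine ⟨?_, (((f2.add (a2.const_mul 2)).sub b2).sub c2), ?_, (((f4.add (continuousAt_const.mul a4)).sub b4).sub c4),
    (((f5.add (continuousAt_const.mul a5)).sub b5).sub c5)⟩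
  · have e : NN ψ b g v t = fun x => FF ψ t x + 2 * LV g (fun _ => 0) t x - LV v (pth b v) t x - LV v (pth (-b) (-v)) t x := by
      ext x; rw [NN, F0, if_neg ht.not_ge]
    rw [e]
    exact (((f1.add (a1.const_mul 2)).sub b1).sub c1)
  · refine (((f3.add (a3.const_mul 2)).sub b3).sub c3).congr_of_eventuallyEq ?_
    filter_upwards [Ioi_mem_nhds ht] with j hj
    rw [NN, F0, if_neg (not_le.2 hj)]; rfl

lemma NNc {B K : ℝ} {ψ : RF} (h : LipB B K ψ) {A G L b : ℝ} {g v : RF} (hg : Bd A G g) (hv : Bd A L v) :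
    Continuous fun q : RP => NN ψ b g v q.1 q.2 := by
  unfold NN
  exact ((h.F0c.add (continuous_const.mul hg.lay0.cont)).sub (hv.lay hv b).cont).sub (hv.lay hv.neg (-b)).cont

section
variable {p a b : ℝ} {S V : RF} {U X Z : RG} (H : Cl p a b S V U X Z)
include H

lemma Cl.bV {t1 t2 M N K1 : ℝ} (h1 : a < t1) (h12 : t1 ≤ t2) (h2 : t2 < b) (M0 : 0 < M) (N0 : 0 < N)
    (hN : 1 / N ≤ S t1) (hK : ∀ x ∈ Ioo 0 (S t1), |X t1 x| ≤ K1) (K10 : 0 ≤ K1) (hMN : K1 ≤ M * N)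
    (hM : ∀ t ∈ Icc t1 t2, ∀ x, U t x ≤ M) : V t2 ≤ 2 * M * N := by
  have hU := H.Uc
  have hX := H.Xc
  have hS := H.Sc
  have m : ∀ j ∈ Icc t1 t2, j ∈ Ioo a b := fun j hj => ⟨h1.trans_le hj.1, hj.2.trans_lt h2⟩
  let K : Set (ℝ × ℝ) := {q | q.1 ∈ Icc t1 t2 ∧ S q.1 - 1 / N ≤ q.2 ∧ q.2 ≤ S q.1}
  have mt1 : t1 ∈ Icc t1 t2 := ⟨le_rfl, h12⟩
  have mt2 : t2 ∈ Icc t1 t2 := ⟨h12, le_rfl⟩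
  have iN : 0 < 1 / N := by positivity
  have Kc : IsCompact K := by
    refine (isCompact_Icc (a := t1) (b := t2)).prod (isCompact_Icc (a := 0) (b := S t2)) |>.of_isClosed_subset ?_ fun q hq => ⟨hq.1, ?_, ?_⟩
    · exact (isClosed_Icc.preimage continuous_fst).inter ((isClosed_le fpp continuous_snd).inter (isClosed_le continuous_snd fpp))
    · have := H.Smono (m _ mt1) (m _ hq.1) hq.1.1
      linarith [hq.2.1]
    · exact hq.2.2.trans (H.Smono (m _ hq.1) (m _ mt2) hq.1.2)
  have main := minp Kc (z := fun t x => M * (2 * N * (S t - x) - N ^ 2 * (S t - x) ^ 2) - U t x) fpp (by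
    intro t x hq hneg _
    obtain ⟨ht, hx1, hx2⟩ := hq
    dsimp only at ht hx1 hx2
    have St := H.Smono (m _ mt1) (m _ ht) ht.1
    have nS : x ≠ S t := by
      rintro rfl
      rw [H.Uz t (S t) (le_abs_self _)] at hneg; simp at hneg
    have nl : x ≠ S t - 1 / N := by
      intro e
      have e1 : M * (2 * N * (S t - x) - N ^ 2 * (S t - x) ^ 2) = M := by rw [e]; field_simp; ring
      rw [e1] at hneg
      linarith [hM t ht x]
    have x1 : S t - 1 / N < x := lt_of_le_of_ne hx1 nl.symm
    have x2 : x < S t := lt_of_le_of_ne hx2 nS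
    have x0 : 0 < x := by linarith
    have nt : t ≠ t1 := by
      rintro rfl
      have l := (H.lip K10 hK).l x (S t)
      rw [H.Uz t (S t) (le_abs_self _), sub_zero, abs_of_nonneg (H.U0 _ _), abs_sub_comm, abs_of_pos lnn] at l
      have hd : 0 < S t - x := by linarith
      have hd2 : N * (S t - x) ≤ 1 := by
        have : S t - x ≤ 1 / N := by linarith
        rw [le_div_iff₀ N0] at this; linarith
      have q1 : K1 * (S t - x) ≤ M * N * (S t - x) := by gcongr
      have q2 : 0 ≤ M * N * (S t - x) * (1 - N * (S t - x)) := mul_nonneg psv lnn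
      linarith
    have t1t : t1 < t := lt_of_le_of_ne ht.1 (Ne.symm nt)
    have d : ∀ y ∈ Ioo (S t - 1 / N) (S t), HasDerivAt (fun x => M * (2 * N * (S t - x) - N ^ 2 * (S t - x) ^ 2) - U t x)
        (M * (-(2 * N) + 2 * N ^ 2 * (S t - y)) - X t y) y := fun y hy => by
      have e := (hasDerivAt_id y).const_sub (S t)
      refine (((e.const_mul (2 * N)).sub ((e.pow 2).const_mul (N ^ 2))).const_mul M).sub (H.Ud t y ⟨by linarith [hy.1], hy.2⟩) |>.congr_deriv ?_
      simp only [id]; push_cast; ring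
    have V0 := H.V0 t
    refine ⟨?_, ?_, fun y => M * (-(2 * N) + 2 * N ^ 2 * (S t - y)) - X t y,
      M * (2 * N * V t - N ^ 2 * (2 * (S t - x) * V t)) - Z t x, M * (2 * N ^ 2 * (-1)) - Z t x, ?_, ?_, ?_, ?_⟩
    · filter_upwards [Ioo_mem_nhds x1 x2] with y hy using ⟨ht, hy.1.le, hy.2.le⟩
    · have : ∀ᶠ j in 𝓝 t, S j - 1 / N < x ∧ x < S j ∧ t1 < j :=
        ((by fun_prop : ContinuousAt (fun j => S j - 1 / N) t).eventually_lt_const x1).and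
          ((hS.continuousAt.eventually_const_lt x2).and (lt_mem_nhds t1t))
      filter_upwards [nhdsWithin_le_nhds this, self_mem_nhdsWithin] with j hj hj'
      exact ⟨⟨hj.2.2.le, (le_of_lt hj').trans ht.2⟩, hj.1.le, hj.2.1.le⟩
    · filter_upwards [Ioo_mem_nhds x1 x2] with y hy using d y hy
    · exact (((((hasDerivAt_id x).const_sub (S t)).const_mul (2 * N ^ 2)).const_add _).const_mul M).sub (H.Xd t (m t ht) x ⟨x0, x2⟩)
    · have e := (H.Sd t (m t ht)).sub_const x
      refine (((e.const_mul (2 * N)).sub ((e.pow 2).const_mul (N ^ 2))).const_mul M).sub (H.Ut t (m t ht) x ⟨x0, x2⟩) |>.congr_deriv ?_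
      simp
    · have hd2 : N * (S t - x) ≤ 1 := by
        have : S t - x ≤ 1 / N := by linarith
        rw [le_div_iff₀ N0] at this; linarith
      have q1 : 0 ≤ 2 * M * N * V t * (1 - N * (S t - x)) := mul_nonneg psv lnn
      have q2 : 0 < M * N ^ 2 := by positivity
      nlinarith)
  by_contra hn
  rw [not_le] at hn
  have hc : ContinuousAt (fun y => -X t2 y) (S t2) := by fun_prop
  have ev := hc.eventually_const_lt (show 2 * M * N < -X t2 (S t2) by rw [H.XS]; linarith)
  obtain ⟨δ, hδ, hb⟩ := Metric.eventually_nhds_iff.1 ev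
  have Sp := H.Sp t2
  obtain ⟨x, hx1, hx2⟩ := exists_between (show max (max 0 (S t2 - δ)) (S t2 - 1 / N) < S t2 from max_lt (max_lt Sp lnn) lnn)
  have x0 : 0 < x := (le_max_left _ _).trans_lt ((le_max_left _ _).trans_lt hx1)
  have xd : S t2 - δ < x := (le_max_right _ _).trans_lt ((le_max_left _ _).trans_lt hx1)
  have xn : S t2 - 1 / N < x := (le_max_right _ _).trans_lt hx1
  obtain ⟨c, hcx, e⟩ := exists_hasDerivAt_eq_slope (U t2) (X t2) hx2 fpp fun z hz => H.Ud t2 z ⟨x0.trans hz.1, hz.2⟩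
  have b1 := hb (y := c) (by rw [Real.dist_eq, abs_lt]; constructor <;> linarith [hcx.1, hcx.2])
  have b2 := main t2 x ⟨mt2, xn.le, hx2.le⟩
  rw [H.Uz t2 (S t2) (le_abs_self _)] at e
  rw [e, ← neg_div, lt_div_iff₀ lnn] at b1
  have : 0 ≤ M * (N ^ 2 * (S t2 - x) ^ 2) := by positivity
  linarith

lemma Cl.bX (hp : 1 < p) {t1 t2 L G K1 : ℝ} (h1 : a < t1) (h12 : t1 < t2) (h2 : t2 < b)
    (hK : ∀ x ∈ Ioo 0 (S t1), |X t1 x| ≤ K1) (K10 : 0 ≤ K1) (L0 : 0 ≤ L) (G0 : 0 ≤ G)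
    (hL : ∀ t ∈ Icc t1 t2, V t ≤ L) (hG : ∀ t ∈ Icc t1 t2, U t 0 ^ p ≤ G) {D T0 : ℝ} (hD : 2 * S t2 ≤ D) (hT : t2 - t1 ≤ T0) :
    ∀ x ∈ Ioo 0 (S t2), |X t2 x| ≤ K1 + 2 * (G + L) * (exp (D * L / 2) * (1 + L * (2 * √T0))) := by
  intro x hx
  set r := t2 - t1
  have r0 : 0 < r := by simp only [r]; linarith
  have er : t1 + r = t2 := by simp [r]
  have mm : ∀ j ∈ Ioo 0 r, t1 + j ∈ Icc t1 t2 := fun j hj => ⟨by linarith [hj.1], by linarith [hj.2]⟩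
  obtain ⟨b1, b2⟩ := H.bds (t0 := t1) (A := r) hp L0 G0 (fun j hj => hL _ (mm j hj)) (fun j hj => hG _ (mm j hj))
  have li := H.lip K10 hK
  have m1 : t1 ∈ Ioo a b := ⟨h1, by linarith⟩
  have m2 : t1 + r ∈ Ioo a b := by rw [er]; exact ⟨by linarith, h2⟩
  have sp := H.Spth m1 m2 r0.le le_rfl
  rw [er] at sp
  have e : U t2 = NN (U t1) (S t1) (ct r fun j => U (t1 + j) 0 ^ p) (ct r fun j => V (t1 + j)) r := by
    ext y; rw [← H.rep hp m1 m2 r0.le le_rfl, er]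
  have S0 := H.Sp t2
  have D0 : 0 ≤ D := by linarith
  have d := (NNoff (b := S t1) li b2 b1 r0 hx.1.ne' (by rw [← sp]; exact hx.2.ne) (by rw [← sp]; linarith [hx.1])).1
  rw [← e] at d
  rw [(H.Ud t2 x hx).unique d, NN1]
  have f1 := abs_le.1 (li.FF1bd r0 x)
  have f2 := b2.lay0.LV1_bd (D := D) (x := x) r0 (by rw [sub_zero, abs_of_pos hx.1]; linarith [hx.2])
  have f3 := abs_le.1 ((b1.lay b1 (S t1)).LV1_bd (D := D) (x := x) r0 (by rw [← sp, abs_le]; constructor <;> linarith [hx.1, hx.2]))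
  have f4 := abs_le.1 ((b1.lay b1.neg (-S t1)).LV1_bd (D := D) (x := x) r0 (by rw [pth_neg, ← sp, abs_le]; constructor <;> linarith [hx.1, hx.2]))
  have sq : √r ≤ √T0 := sqrt_le_sqrt hT
  have k1 : exp (D * L / 2) * (1 + L * (2 * √r)) ≤ exp (D * L / 2) * (1 + L * (2 * √T0)) := by gcongr
  have k2 : exp (D * 0 / 2) * (1 + 0 * (2 * √r)) ≤ exp (D * L / 2) * (1 + L * (2 * √T0)) := by
    simp only [mul_zero, zero_div, exp_zero, zero_mul, add_zero, mul_one]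
    have : 1 ≤ exp (D * L / 2) := Real.one_le_exp psv
    nlinarith [mul_nonneg (exp_pos (D * L / 2)).le (by positivity : 0 ≤ L * (2 * √T0))]
  have f2' := abs_le.1 (f2.trans (mul_le_mul_of_nonneg_left k2 G0))
  have q := mul_le_mul_of_nonneg_left k1 L0
  rw [abs_le]; constructor <;> linarith [f1.1, f1.2, f2'.1, f2'.2, f3.1, f3.2, f4.1, f4.2]
end

def cl (a b t : ℝ) : ℝ := max a (min t b)
def uc (s : RF) (u : RG) (t x : ℝ) : ℝ := u t (min |x| (s t))
def xc (s : RF) (u : RG) (t x : ℝ) : ℝ := deriv (u t) (max 0 (min x (s t)))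

lemma cl_mem {a b : ℝ} (h : a ≤ b) (t : ℝ) : cl a b t ∈ Icc a b := ⟨le_max_left _ _, max_le h (min_le_right _ _)⟩
lemma cl_eq {a b t : ℝ} (h : t ∈ Icc a b) : cl a b t = t := by rw [cl, min_eq_left h.2, max_eq_right h.1]
lemma cl_cont (a b : ℝ) : Continuous (cl a b) := by unfold cl; fun_prop

abbrev ClS (p : ℝ) (a b : ℝ) (s : RF) (u : RG) : Prop :=
  Cl p a b (fun t => s (cl a b t)) (fun t => deriv s (cl a b t)) (fun t => uc s u (cl a b t))
    (fun t => xc s u (cl a b t)) (fun t x => deriv (deriv (u t)) x)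

lemma IsSolOn.V0 {p s₀ T : ℝ} {φ s : RF} {u : RG} (h : IsSolOn p s₀ φ T s u) {t : ℝ} (ht : t ∈ Ioc 0 T) : 0 ≤ deriv s t := by
  rw [h.stefan t ht]
  by_contra hn
  have hn : 0 < deriv (u t) (s t) := by linarith
  have t' : t ∈ Icc 0 T := ⟨ht.1.le, ht.2⟩
  have sp := h.s_pos t t'
  have c : ContinuousOn (deriv (u t)) (Icc 0 (s t)) :=
    h.ux_cont.comp (f := fun x => (t, x)) fpp fun x hx => ⟨ht, hx⟩
  have cu : ContinuousOn (u t) (Icc 0 (s t)) :=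
    h.u_cont.comp (f := fun x => (t, x)) fpp fun x hx => ⟨t', hx⟩
  have ev := (c (s t) ⟨sp.le, le_rfl⟩).eventually_const_lt hn
  obtain ⟨δ, hδ, hb⟩ := Metric.mem_nhdsWithin_iff.1 ev
  obtain ⟨x, hx1, hx2⟩ := exists_between (show max 0 (s t - δ) < s t from max_lt sp lnn)
  have x0 : 0 < x := (le_max_left _ _).trans_lt hx1
  have xd : s t - δ < x := (le_max_right _ _).trans_lt hx1
  obtain ⟨y, hy, e⟩ := exists_hasDerivAt_eq_slope (u t) (deriv (u t)) hx2 (cu.mono fun z hz => ⟨x0.le.trans hz.1, hz.2⟩)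
    fun z hz => (h.ux_diff t ht z ⟨x0.trans hz.1, hz.2⟩).hasDerivAt
  have b1 : 0 < deriv (u t) y := hb ⟨by rw [Metric.mem_ball, Real.dist_eq, abs_lt]; constructor <;> linarith [hy.1, hy.2], by linarith [hy.1], hy.2.le⟩
  rw [e, h.bc_free t ht] at b1
  have := h.u_nonneg t t' x ⟨x0.le, hx2.le⟩
  exact absurd b1 (not_lt.2 (div_nonpos_of_nonpos_of_nonneg lnn lnn))

lemma IsSolOn.toCl {p s₀ T : ℝ} {φ s : RF} {u : RG} (h : IsSolOn p s₀ φ T s u) {a b : ℝ} (ha : 0 < a) (hab : a < b) (hb : b ≤ T) :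
    ClS p a b s u := by
  have m : ∀ t, cl a b t ∈ Ioc 0 T := fun t => ⟨ha.trans_le (cl_mem hab.le t).1, (cl_mem hab.le t).2.trans hb⟩
  have m' : ∀ t, cl a b t ∈ Icc 0 T := fun t => ⟨(m t).1.le, (m t).2⟩
  have e : ∀ t ∈ Ioo a b, cl a b t = t := fun t ht => cl_eq ⟨ht.1.le, ht.2.le⟩
  have ev : ∀ t ∈ Ioo a b, ∀ᶠ j in 𝓝 t, cl a b j = j := fun t ht => by
    filter_upwards [isOpen_Ioo.mem_nhds ht] with j hj using e j hj
  have Sc : Continuous fun t => s (cl a b t) := h.s_cont.comp_continuous (cl_cont a b) m'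
  have Sp : ∀ t, 0 < s (cl a b t) := fun t => h.s_pos _ (m' t)
  have cc := cl_cont a b
  have Sc2 : Continuous fun q : RP => s (cl a b q.1) := Sc.comp continuous_fst
  have mm : ∀ t x, min |x| (s (cl a b t)) ∈ Icc 0 (s (cl a b t)) := fun t x => ⟨le_min (abs_nonneg _) (Sp t).le, min_le_right _ _⟩
  have mx : ∀ t x, max 0 (min x (s (cl a b t))) ∈ Icc 0 (s (cl a b t)) := fun t x => ⟨le_max_left _ _, max_le (Sp t).le (min_le_right _ _)⟩
  exact {
    ab := hab
    Sc := Sc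
    Sp := Sp
    Vc := h.s_deriv_cont.comp_continuous cc m
    V0 := fun t => h.V0 (m t)
    Sd := fun t ht => by
      rw [e t ht]
      refine (h.s_diff t (e t ht ▸ m t)).hasDerivAt.congr_of_eventuallyEq ?_
      filter_upwards [ev t ht] with j hj
      rw [hj]
    Uc := h.u_cont.comp_continuous (f := fun q : RP => (cl a b q.1, min |q.2| (s (cl a b q.1)))) ((cc.comp continuous_fst).prodMk (continuous_snd.abs.min Sc2)) fun q => ⟨m' _, mm _ _⟩
    Xc := h.ux_cont.comp_continuous (f := fun q : RP => (cl a b q.1, max 0 (min q.2 (s (cl a b q.1))))) ((cc.comp continuous_fst).prodMk (continuous_const.max (continuous_snd.min Sc2))) fun q => ⟨m _, mx _ _⟩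
    Ue := fun t x => by simp [uc]
    Uz := fun t x hx => by rw [uc, min_eq_right hx, h.bc_free _ (m t)]
    U0 := fun t x => h.u_nonneg _ (m' t) _ (mm t x)
    Ud := fun t x hx => by
      rw [xc, min_eq_left hx.2.le, max_eq_right hx.1.le]
      refine (h.ux_diff _ (m t) x hx).hasDerivAt.congr_of_eventuallyEq ?_
      filter_upwards [isOpen_Ioo.mem_nhds hx] with y hy
      rw [uc, abs_of_pos hy.1, min_eq_left hy.2.le]
    Ut := fun t ht x hx => by
      have hx' : x ∈ Ioo 0 (s t) := by rwa [e t ht] at hx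
      have mt : t ∈ Ioc 0 T := e t ht ▸ m t
      rw [← h.heat t mt x hx']
      refine (h.ut_diff t mt x hx').hasDerivAt.congr_of_eventuallyEq ?_
      filter_upwards [ev t ht, Sc.continuousAt.eventually_const_lt hx.2] with j hj hj'
      rw [uc, abs_of_pos hx.1, min_eq_left hj'.le, hj]
    Xd := fun t ht x hx => by
      have hx' : x ∈ Ioo 0 (s t) := by rwa [e t ht] at hx
      have mt : t ∈ Ioc 0 T := e t ht ▸ m t
      refine (h.uxx_diff t mt x hx').hasDerivAt.congr_of_eventuallyEq ?_
      filter_upwards [isOpen_Ioo.mem_nhds hx'] with y hy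
      rw [xc, e t ht, min_eq_left hy.2.le, max_eq_right hy.1.le]
    Zc := h.uxx_cont.mono fun q hq => by
      have := hq.2
      rw [e _ hq.1] at this
      exact ⟨e _ hq.1 ▸ m q.1, this⟩
    X0 := fun t => by
      rw [xc, uc, min_eq_left (Sp t).le, max_self, abs_zero, min_eq_left (Sp t).le, ← h.bc_zero _ (m t)]; ring
    XS := fun t => by
      rw [xc, min_self, max_eq_right (Sp t).le, h.stefan _ (m t)]; ring }

lemma En_eq {p a b t : ℝ} {s : RF} {u : RG} (ht : t ∈ Icc a b) (hs : 0 < s t) :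
    En p (fun t => s (cl a b t)) (fun t => uc s u (cl a b t)) (fun t => xc s u (cl a b t)) t = energy p s u t := by
  unfold En energy QQ
  simp only [cl_eq ht, min_self, uc, abs_zero, min_eq_left hs.le]
  congr 2
  refine icon fun x hx => ?_
  rw [uIcc_of_le hs.le] at hx
  simp only [xc]
  rw [min_eq_left hx.2, max_eq_right hx.1]; ring

lemma apriori {p s₀ Tm C t1 : ℝ} {φ s : RF} {u : RG} (hp : 1 < p) (h : ∀ T, 0 < T → T < Tm → IsSolOn p s₀ φ T s u)
    (h0 : 0 < t1) (h1 : t1 < Tm) (hC : ∀ t ∈ Ico t1 Tm, -C ≤ energy p s u t) :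
    ∃ K, 0 ≤ K ∧ ∀ t ∈ Ioo t1 Tm, ∀ x ∈ Ioo 0 (s t), |deriv (u t) x| ≤ K := by
  have sp : ∀ t ∈ Ioo 0 Tm, 0 < s t := fun t ht => (h t ht.1 ht.2).s_pos t ⟨ht.1.le, le_rfl⟩
  have sp1 := sp t1 ⟨h0, h1⟩
  have H1 := (h t1 h0 h1).toCl (half_pos h0) (half_lt_self h0) le_rfl
  have m1 : t1 ∈ Icc (t1 / 2) t1 := ⟨by linarith, le_rfl⟩
  obtain ⟨K1, K10, hK1⟩ := H1.Xb t1 t1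
  have hK1 : ∀ x ∈ Ioo 0 (s t1), |xc s u t1 x| ≤ K1 := fun x hx => by
    have := hK1 t1 ⟨le_rfl, le_rfl⟩ x (by rw [cl_eq m1]; exact ⟨hx.1.le, hx.2.le⟩)
    simpa only [cl_eq m1] using this
  obtain ⟨M1, hM1⟩ : ∃ M1, ∀ x, uc s u t1 x ≤ M1 := by
    have hU := H1.Uc
    obtain ⟨M, hM⟩ := (isCompact_Icc (a := 0) (b := s t1)).exists_bound_of_continuousOn
      (f := uc s u t1) (by have : Continuous (fun x => uc s u (cl (t1 / 2) t1 t1) x) := hU.comp (by fun_prop : Continuous fun x : ℝ => (t1, x))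
                           rw [cl_eq m1] at this; exact this.continuousOn)
    refine ⟨M, fun x => ?_⟩
    have := H1.Umin t1 x
    simp only [cl_eq m1] at this
    rw [this]
    exact (le_abs_self _).trans (hM _ ⟨le_min (abs_nonneg _) sp1.le, min_le_right _ _⟩)
  set E1 := energy p s u t1
  set Y := PP s (uc s u) t1 t1
  set T0 := Tm - t1
  have T00 : 0 < T0 := by simp only [T0]; linarith
  set W := ((p + 1) / (p - 1)) ^ 2 * (2 * ((1 + Y) * exp (T0 + (E1 + C)) * (E1 + C)) + 8 * (|E1| + |C|) ^ 2 * T0)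
  set M := max 1 (max M1 (M1 + 2 * (W + (p + 2) * T0 ^ (1 / (p + 2)))))
  have M0 : 1 ≤ M := le_max_left _ _
  set N := 1 / s t1 + K1
  have N0 : 0 < N := by positivity
  set L := 2 * M * N
  have L0 : 0 ≤ L := by positivity
  set D := 2 * (s t1 + L * T0)
  refine ⟨K1 + 2 * (M ^ p + L) * (exp (D * L / 2) * (1 + L * (2 * √T0))), by positivity, fun t ht x hx => ?_⟩
  obtain ⟨b, hb1, hb2⟩ := exists_between ht.2
  have H := (h b (by linarith [ht.1]) hb2).toCl (half_pos h0) (show t1 / 2 < b by linarith [ht.1]) le_rfl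
  have mI : ∀ j ∈ Icc t1 t, j ∈ Icc (t1 / 2) b := fun j hj => ⟨by linarith [hj.1], by linarith [hj.2]⟩
  have mt1 : t1 ∈ Icc t1 t := ⟨le_rfl, ht.1.le⟩
  have at1 : t1 / 2 < t1 := by linarith
  have sj : ∀ j ∈ Icc t1 t, 0 < s j := fun j hj => sp j ⟨by linarith [hj.1], by linarith [hj.2, ht.2]⟩
  have bM : ∀ j ∈ Icc t1 t, ∀ x, uc s u j x ≤ M := fun j hj x => by
    rcases hj.1.eq_or_lt with rfl | hlt
    · exact (hM1 x).trans ((le_max_left _ _).trans (le_max_right _ _))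
    have hT : j - t1 ≤ T0 := by simp only [T0]; linarith [hj.2, ht.2]
    have w := H.bI hp (t1 := t1) (t := j) (E1 := E1) (C := C) (Y := Y) (T0 := T0) at1 hlt.le (by linarith [hj.2]) hT
      (En_eq (mI _ mt1) sp1).le (fun r hr => by
        have hr' : r ∈ Icc t1 t := ⟨hr.1, hr.2.trans hj.2⟩
        rw [En_eq (mI r hr') (sj r hr')]; exact hC r ⟨hr.1, by linarith [hr'.2, ht.2]⟩)
      (by simp only [PP, cl_eq (mI _ mt1), Y]; exact le_rfl)
    have er : t1 + (j - t1) = j := by ring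
    have v := H.bU hp (t1 := t1) (r := j - t1) (M1 := M1) (W := W) (T0 := T0) at1 lnn (by rw [er]; linarith [hj.2]) hT
      (by simpa only [cl_eq (mI _ mt1)] using hM1) (by rw [er]; exact w) x
    simp only [er, cl_eq (mI j hj)] at v
    exact v.trans ((le_max_right _ _).trans (le_max_right _ _))
  have bL : ∀ j ∈ Icc t1 t, deriv s (cl (t1 / 2) b j) ≤ L := fun j hj => by
    refine H.bV (t1 := t1) (t2 := j) (M := M) (N := N) (K1 := K1) at1 hj.1 (by linarith [hj.2]) lnn N0 ?_ ?_ K10 ?_ ?_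
    · simp only [cl_eq (mI _ mt1)]
      rw [div_le_comm₀ N0 sp1]
      simp only [N]; linarith
    · simpa only [cl_eq (mI _ mt1)] using hK1
    · have : K1 ≤ N := by simp only [N]; linarith [one_div_pos.2 sp1]
      nlinarith
    · intro r hr x
      have hr' : r ∈ Icc t1 t := ⟨hr.1, hr.2.trans hj.2⟩
      simp only [cl_eq (mI r hr')]; exact bM r hr' x
  have mt : t ∈ Icc t1 t := ⟨ht.1.le, le_rfl⟩
  have Sb : s t ≤ s t1 + L * T0 := by
    have cl1 := intervalIntegral.sub_le_integral_of_hasDeriv_right_of_le (a := t1) (b := t) (g := fun t => s (cl (t1 / 2) b t))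
      (g' := fun t => deriv s (cl (t1 / 2) b t)) (φ := fun _ => L) ht.1.le H.Sc.continuousOn
      (fun r hr => (H.Sd r ⟨by linarith [hr.1], by linarith [hr.2]⟩).hasDerivWithinAt) continuous_const.integrableOn_Icc
      (fun r hr => bL r ⟨hr.1.le, hr.2.le⟩)
    simp only [cl_eq (mI _ mt), cl_eq (mI _ mt1), icst, smul_eq_mul] at cl1
    have : (t - t1) * L ≤ T0 * L := mul_le_mul_of_nonneg_right (by simp only [T0]; linarith [ht.2]) L0
    linarith
  have fin := H.bX hp (t1 := t1) (t2 := t) (L := L) (G := M ^ p) (K1 := K1) (D := D) (T0 := T0) at1 ht.1 lnn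
    (by simpa only [cl_eq (mI _ mt1)] using hK1) K10 L0 psv bL (fun r hr => by
      simp only [cl_eq (mI r hr)]
      exact rpow_le_rpow (by have := H.U0 r 0; simpa only [cl_eq (mI r hr)] using this) (bM r hr 0) lnn)
    (by simp only [cl_eq (mI _ mt), D]; linarith) (by simp only [T0]; linarith [ht.2]) x (by simpa only [cl_eq (mI _ mt)] using hx)
  simp only [cl_eq (mI _ mt)] at fin
  rwa [xc, min_eq_left hx.2.le, max_eq_right hx.1.le] at fin

lemma fixp {α : Type} (P : (α → ℝ) → Prop) (Φ : (α → ℝ) → α → ℝ) {R : ℝ} (hR : ∀ f, P f → ∀ a, |f a| ≤ R)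
    (hm : ∀ f, P f → P (Φ f)) (hcl : ∀ (F : ℕ → α → ℝ) f, (∀ n, P (F n)) → TendstoUniformly F f atTop → P f)
    (hc : ∀ f g, P f → P g → ∀ D, (∀ a, |f a - g a| ≤ D) → ∀ a, |Φ f a - Φ g a| ≤ D / 2) {f0 : α → ℝ} (h0 : P f0) :
    ∃ f, P f ∧ Φ f = f := by
  have hP : ∀ n, P (Φ^[n] f0) := fun n => by
    induction n with
    | zero => exact h0
    | succ n ih => rw [Function.iterate_succ_apply']; exact hm _ ih
  have hd : ∀ n a, |(Φ^[n] f0) a - (Φ^[n + 1] f0) a| ≤ 4 * R / 2 / 2 ^ n := fun n => by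
    induction n with
    | zero => exact fun a => (abs_sub _ _).trans (by have := hR _ (hP 0) a; have := hR _ (hP 1) a; simp only [pow_zero]; linarith)
    | succ n ih =>
      intro a
      have := hc _ _ (hP n) (hP (n + 1)) _ ih a
      rw [← Function.iterate_succ_apply' Φ n, ← Function.iterate_succ_apply' Φ (n + 1)] at this
      rw [pow_succ]; refine this.trans (le_of_eq ?_); field_simp
  have hd' : ∀ a n, dist ((Φ^[n] f0) a) ((Φ^[n + 1] f0) a) ≤ 4 * R / 2 / 2 ^ n := fun a n => hd n a
  choose f hf using fun a => cauchySeq_tendsto_of_complete (cauchySeq_of_le_geometric_two (hd' a))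
  have hfn : ∀ n a, |(Φ^[n] f0) a - f a| ≤ 4 * R / 2 ^ n := fun n a => dist_le_of_le_geometric_two_of_tendsto (hd' a) (hf a) n
  have lim : Tendsto (fun n : ℕ => 4 * R / 2 ^ n) atTop (𝓝 0) := by
    have := (tendsto_pow_atTop_nhds_zero_of_lt_one (r := (1:ℝ) / 2) (by norm_num) (by norm_num)).const_mul (4 * R)
    simpa [div_eq_mul_inv] using this
  have Pf : P f := hcl _ f hP (by
    rw [Metric.tendstoUniformly_iff]
    intro ε hε
    filter_upwards [lim.eventually_lt_const hε] with n hn a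
    rw [dist_comm]; exact (hfn n a).trans_lt hn)
  refine ⟨f, Pf, funext fun a => ?_⟩
  have l1 : Tendsto (fun n => (Φ^[n + 1] f0) a) atTop (𝓝 (f a)) := (hf a).comp (tendsto_add_atTop_nat 1)
  have l2 : Tendsto (fun n => (Φ^[n + 1] f0) a) atTop (𝓝 (Φ f a)) := by
    rw [tendsto_iff_dist_tendsto_zero]
    refine squeeze_zero (fun _ => dist_nonneg) (fun n => ?_) (by simpa using lim.div_const 2)
    rw [Function.iterate_succ_apply']
    exact hc _ _ (hP n) Pf _ (hfn n) a
  exact tendsto_nhds_unique l2 l1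

lemma fixu {α : Type} {P : (α → ℝ) → Prop} {Φ : (α → ℝ) → α → ℝ} {R : ℝ} (hR : ∀ f, P f → ∀ a, |f a| ≤ R)
    (hc : ∀ f g, P f → P g → ∀ D, (∀ a, |f a - g a| ≤ D) → ∀ a, |Φ f a - Φ g a| ≤ D / 2) {f g : α → ℝ} (hf : P f) (hg : P g)
    (ef : Φ f = f) (eg : Φ g = g) : f = g := by
  have : ∀ n : ℕ, ∀ a, |f a - g a| ≤ 2 * R / 2 ^ n := fun n => by
    induction n with
    | zero => exact fun a => (abs_sub _ _).trans (by have := hR _ hf a; have := hR _ hg a; simp only [pow_zero]; linarith)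
    | succ n ih =>
      intro a
      have := hc _ _ hf hg _ ih a
      rw [ef, eg] at this
      rw [pow_succ]; refine this.trans (le_of_eq ?_); field_simp
  funext a
  have lim : Tendsto (fun n : ℕ => 2 * R / 2 ^ n) atTop (𝓝 0) := by
    have := (tendsto_pow_atTop_nhds_zero_of_lt_one (r := (1:ℝ) / 2) (by norm_num) (by norm_num)).const_mul (2 * R)
    simpa [div_eq_mul_inv] using this
  have := ge_of_tendsto' lim fun n => this n a
  exact sub_eq_zero.1 (abs_nonpos_iff.1 this)

lemma kd {A R D C1 C2 t : ℝ} {f f' y y' : RF} {κ : RG} (ht : 0 ≤ t) (hf : Bd A R f) (hf' : Bd A R f')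
    (hD : ∀ j, |f j - f' j| ≤ D) (mκ : Measurable fun q : RP => κ q.1 q.2) (zκ : ∀ r ≤ 0, ∀ y, κ r y = 0)
    (yc : Continuous y) (yc' : Continuous y')
    (h1 : ∀ j ∈ Ioo 0 t, |κ (t - j) (y j)| ≤ C1 * (√(t - j))⁻¹) (h1' : ∀ j ∈ Ioo 0 t, |κ (t - j) (y' j)| ≤ C1 * (√(t - j))⁻¹)
    (h2 : ∀ j ∈ Ioo 0 t, |κ (t - j) (y j) - κ (t - j) (y' j)| ≤ C2 * (√(t - j))⁻¹) :
    |(∫ j, f j * κ (t - j) (y j)) - ∫ j, f' j * κ (t - j) (y' j)| ≤ (D * C1 + R * C2) * (2 * √t) := by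
  have zf : ∀ {f y : RF}, Bd A R f → ∀ j ∉ Ioo 0 t, f j * κ (t - j) (y j) = 0 := fun {f y} hf j hj => by
    by_cases h : 0 < j
    · rw [zκ _ (by by_contra hh; exact hj ⟨h, by linarith⟩), mul_zero]
    · rw [hf.gz j fun hh => h hh.1, zero_mul]
  have base : Integrable ((Ioo 0 t).indicator fun j => (√(t - j))⁻¹) := by
    have := (rsq_ind t).comp_sub_left t
    refine (this.indicator (measurableSet_Ioo (a := 0) (b := t))).congr (ae_of_all _ fun j => ?_)
    by_cases h : j ∈ Ioo 0 t
    · simp only [indicator_of_mem h]; rw [indicator_of_mem (show t - j ∈ Ioc 0 t from ⟨by linarith [h.2], by linarith [h.1]⟩)]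
    · simp only [indicator_of_notMem h]
  have val : ∫ j, (Ioo 0 t).indicator (fun j => (√(t - j))⁻¹) j = 2 * √t := by
    rw [integral_indicator measurableSet_Ioo, ← integral_Ioc_eq_integral_Ioo, ← iole ht,
      intervalIntegral.integral_comp_sub_left (fun r => (√r)⁻¹), ← rsq_val ht]; simp
  have R0 := hf.G0
  have ii : ∀ {f y : RF}, Bd A R f → Continuous y → (∀ j ∈ Ioo 0 t, |κ (t - j) (y j)| ≤ C1 * (√(t - j))⁻¹) →
      Integrable fun j => f j * κ (t - j) (y j) := fun {f y} hf yc h1 => by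
    refine (base.const_mul (R * C1)).mono' (hf.lay0.gae.mul ?_) (ae_of_all _ fun j => ?_)
    · have := yc.measurable
      exact (mκ.comp (by fun_prop : Measurable fun j => (t - j, y j))).aestronglyMeasurable
    · by_cases h : j ∈ Ioo 0 t
      · rw [indicator_of_mem h, norm_mul, mul_assoc]
        exact mul_le_mul (hf.gb j) (h1 j h) (norm_nonneg _) R0
      · rw [zf hf j h, indicator_of_notMem h]; simp
  rw [← integral_sub (ii hf yc h1) (ii hf' yc' h1'), ← val, ← integral_const_mul, ← norm_eq_abs]
  refine norm_integral_le_of_norm_le (base.const_mul _) (ae_of_all _ fun j => ?_)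
  by_cases h : j ∈ Ioo 0 t
  · rw [indicator_of_mem h, norm_eq_abs, show f j * κ (t - j) (y j) - f' j * κ (t - j) (y' j) =
      (f j - f' j) * κ (t - j) (y j) + f' j * (κ (t - j) (y j) - κ (t - j) (y' j)) by ring]
    refine (abs_add_le _ _).trans ?_
    rw [abs_mul, abs_mul, add_mul, mul_assoc, mul_assoc]
    exact add_le_add (mul_le_mul (hD j) (h1 j h) (abs_nonneg _) ((abs_nonneg _).trans (hD j)))
      (mul_le_mul (hf'.gb j) (h2 j h) (abs_nonneg _) R0)
  · rw [zf hf j h, zf hf' j h, indicator_of_notMem h]; simp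

def QF (η : ℝ) : ℝ := 112 / η ^ 4 + 16 / η ^ 3

lemma QF_pos {η : ℝ} (h : 0 < η) : 0 < QF η := by unfold QF; positivity

lemma far1 {η r y : ℝ} (h : 0 < η) (hr : 0 < r) (hr1 : r ≤ 1) (hy : η ≤ y) :
    |hk1 r y| ≤ QF η * (√r)⁻¹ ∧ |hk2 r y| ≤ QF η * (√r)⁻¹ := by
  have y0 := h.trans_le hy
  have s0 := sqrt_pos.2 hr
  have s1 : √r ≤ (√r)⁻¹ := by
    have : √r ≤ 1 := Real.sqrt_le_one.2 hr1
    exact this.trans ((one_le_inv₀ s0).2 this)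
  have a := hk1_far r y0.ne'
  have b := hk2_far r y0.ne'
  rw [abs_of_pos y0] at a
  have e1 : √r / y ^ 3 ≤ (√r)⁻¹ / η ^ 3 := by gcongr
  have e2 : √r / y ^ 4 ≤ (√r)⁻¹ / η ^ 4 := by gcongr
  have p1 : 0 ≤ (√r)⁻¹ / η ^ 3 := by positivity
  have p2 : 0 ≤ (√r)⁻¹ / η ^ 4 := by positivity
  have e : QF η * (√r)⁻¹ = 112 * ((√r)⁻¹ / η ^ 4) + 16 * ((√r)⁻¹ / η ^ 3) := by unfold QF; ring
  rw [e]
  constructor <;> linarith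

lemma far2 {η r y y' : ℝ} (h : 0 < η) (hr : 0 < r) (hr1 : r ≤ 1) (hy : η ≤ y) (hy' : η ≤ y') :
    |hk r y - hk r y'| ≤ QF η * (√r)⁻¹ * |y - y'| ∧ |hk1 r y - hk1 r y'| ≤ QF η * (√r)⁻¹ * |y - y'| :=
  ⟨(convex_Ici η).norm_image_sub_le_of_norm_hasDerivWithin_le (f := hk r) (fun x _ => (hk_hasDerivAt r x).hasDerivWithinAt)
      (fun _ hx => (far1 h hr hr1 hx).1) hy' hy,
    (convex_Ici η).norm_image_sub_le_of_norm_hasDerivWithin_le (f := hk1 r) (fun x _ => (hk1_hasDerivAt r x).hasDerivWithinAt)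
      (fun _ hx => (far1 h hr hr1 hx).2) hy' hy⟩

lemma near2 (r y y' : ℝ) : |hk1 r y - hk1 r y'| ≤ (|r| * √r)⁻¹ * |y - y'| :=
  convex_univ.norm_image_sub_le_of_norm_hasDerivWithin_le (f := hk1 r) (fun x _ => (hk1_hasDerivAt r x).hasDerivWithinAt)
      (fun x _ => hk2_le r x) (mem_univ _) (mem_univ _)

lemma kb {A R C1 t : ℝ} {f y : RF} {κ : RG} (ht : 0 ≤ t) (hf : Bd A R f)
    (mκ : Measurable fun q : RP => κ q.1 q.2) (zκ : ∀ r ≤ 0, ∀ y, κ r y = 0) (yc : Continuous y)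
    (h1 : ∀ j ∈ Ioo 0 t, |κ (t - j) (y j)| ≤ C1 * (√(t - j))⁻¹) :
    |∫ j, f j * κ (t - j) (y j)| ≤ R * C1 * (2 * √t) := by
  have := kd (D := R) (C2 := 0) (f' := fun _ => 0) ht hf ⟨fun _ _ => rfl, fun _ => by simpa using hf.G0, continuousOn_const⟩
    (by simpa using hf.gb) mκ zκ yc yc h1 h1 (by simp)
  simpa using this

def PhV (ψ : RF) (b : ℝ) (g v : RF) (t : ℝ) : ℝ :=
  -2 * FF1 ψ t (pth b v t) - 4 * LV1 g (fun _ => 0) t (pth b v t) + 2 * LV1 v (pth b v) t (pth b v t) +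
    2 * LV1 v (pth (-b) (-v)) t (pth b v t)
def PhG (p : ℝ) (ψ : RF) (b : ℝ) (g v : RF) (t : ℝ) : ℝ := (max 0 (NN ψ b g v t 0)) ^ p

def SS (p η K M R : ℝ) : ℝ := 2 * K + 6 * QF η + 8 * R * QF η + 4 * R ^ 2 + 4 * R +
  (4 + 2 * R * QF η + 4 * R + 2 * K) * (1 + p * (M + 1) ^ (p - 1))

structure Sm (p η K M R A : ℝ) : Prop where
  p1 : 1 < p
  η0 : 0 < η
  K0 : 0 ≤ K
  M0 : 0 ≤ M
  A0 : 0 < A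
  A1 : A ≤ 1
  RA : R * A ≤ η
  RK : 2 * K + 1 ≤ R
  RM : (M + 1) ^ p ≤ R
  S : 2 * √A * SS p η K M R ≤ 1 / 2

section
variable {p η K M R A b : ℝ} {ψ g v g' v' : RF}

lemma Bd.cp (hv : Bd A R v) (b : ℝ) : Continuous (pth b v) := (hv.lay hv b).Ocont

lemma Sm.sη (h : Sm p η K M R A) (hb : 2 * η ≤ b) (hv : Bd A R v) {t : ℝ} (ht : t ∈ Icc 0 A) : η ≤ pth b v t := by
  have := hv.lip b t 0
  rw [pth_zero, sub_zero, abs_of_nonneg ht.1] at this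
  have := (abs_le.1 (this.trans ((mul_le_mul_of_nonneg_left ht.2 hv.G0).trans h.RA))).1
  linarith

lemma Sm.eb (h : Sm p η K M R A) (hb : 2 * η ≤ b) (hψ : LipB b K ψ) (hM : |ψ 0| ≤ M) (hg : Bd A R g) (hv : Bd A R v) {t : ℝ} (ht : t ∈ Ioo 0 A) :
    |PhV ψ b g v t| ≤ R ∧ |NN ψ b g v t 0| ≤ M + 1 := by
  have hs : ∀ j ∈ Icc 0 t, η ≤ pth b v j := fun j hj => h.sη hb hv ⟨hj.1, hj.2.trans ht.2.le⟩
  have hst := hs t ⟨ht.1.le, le_rfl⟩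
  have c := hv.cp b
  have c' := hv.neg.cp (-b)
  have R0 := hv.G0
  have Q0 := QF_pos h.η0
  have m1 : ∀ j ∈ Ioo 0 t, 0 < t - j ∧ t - j ≤ 1 ∧ η ≤ pth b v j := fun j hj =>
    ⟨by linarith [hj.2], by linarith [hj.1, ht.2, h.A1], hs j ⟨hj.1.le, hj.2.le⟩⟩
  have t2 : |LV1 g (fun _ => 0) t (pth b v t)| ≤ R * QF η * (2 * √t) :=
    kb ht.1.le hg hk1_meas (fun r hr y => hk1_of_nonpos hr y) continuous_const fun j hj =>
      (far1 h.η0 (m1 j hj).1 (m1 j hj).2.1 lnn).1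
  have t4 : |LV1 v (pth (-b) (-v)) t (pth b v t)| ≤ R * QF η * (2 * √t) :=
    kb ht.1.le hv hk1_meas (fun r hr y => hk1_of_nonpos hr y) (continuous_const.sub c') fun j hj =>
      (far1 h.η0 (m1 j hj).1 (m1 j hj).2.1 (by rw [pth_neg]; linarith [(m1 j hj).2.2, h.η0])).1
  have t3 : |LV1 v (pth b v) t (pth b v t)| ≤ R * R * (2 * √t) :=
    kb ht.1.le hv hk1_meas (fun r hr y => hk1_of_nonpos hr y) (continuous_const.sub c) fun j hj => by
      have r0 := (m1 j hj).1
      refine (hk1_le' _ _).trans ?_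
      have := hv.lip b t j
      rw [abs_of_pos r0] at this ⊢
      refine (mul_le_mul_of_nonneg_right this psv).trans (le_of_eq ?_)
      have := (sqrt_pos.2 r0).ne'
      field_simp
  have hkb : ∀ r y, |hk r y| ≤ 1 * (√r)⁻¹ := fun r y => by rw [abs_of_nonneg (hk_nonneg r y), one_mul]; exact hk_le r y
  have t5 : |LV g (fun _ => 0) t 0| ≤ R * 1 * (2 * √t) :=
    kb ht.1.le hg hk_meas (fun r hr y => hk_of_nonpos hr y) continuous_const fun j hj => hkb _ _
  have t6 : |LV v (pth b v) t 0| ≤ R * 1 * (2 * √t) :=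
    kb ht.1.le hv hk_meas (fun r hr y => hk_of_nonpos hr y) (continuous_const.sub c) fun j hj => hkb _ _
  have t7 : |LV v (pth (-b) (-v)) t 0| ≤ R * 1 * (2 * √t) :=
    kb ht.1.le hv hk_meas (fun r hr y => hk_of_nonpos hr y) (continuous_const.sub c') fun j hj => hkb _ _
  have f1 := hψ.FF1bd ht.1 (pth b v t)
  have f2 := hψ.FFini ht.1 0
  have hP : 0 ≤ p * (M + 1) ^ (p - 1) := mul_nonneg (by linarith [h.p1]) (rpow_nonneg (by linarith [h.M0]) _)
  have sA : √t ≤ √A := sqrt_le_sqrt ht.2.le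
  have st := Real.sqrt_nonneg t
  have K0 := h.K0
  have RQ := mul_nonneg R0 Q0.le
  have small : ∀ c, c ≤ SS p η K M R → c * (2 * √t) ≤ 1 / 2 := fun c hc => by
    refine le_trans ?_ h.S
    have : 0 ≤ SS p η K M R := by unfold SS; positivity
    calc c * (2 * √t) ≤ SS p η K M R * (2 * √A) := by gcongr
      _ = _ := by ring
  have hX : (4 + 2 * R * QF η + 4 * R + 2 * K) ≤ (4 + 2 * R * QF η + 4 * R + 2 * K) * (1 + p * (M + 1) ^ (p - 1)) :=
    le_mul_of_one_le_right psv lnn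
  have s1 := small (6 * R * QF η + 2 * R ^ 2) (by unfold SS; nlinarith [sq_nonneg R])
  have s2 := small (2 * K + 4 * R) (by unfold SS; nlinarith [sq_nonneg R])
  have RK := h.RK
  rw [abs_le] at *
  refine ⟨?_, ?_⟩
  · unfold PhV; constructor <;> linarith
  · rw [NN, F0, if_neg ht.1.not_ge, abs_le]; constructor <;> linarith

lemma Sm.ec (h : Sm p η K M R A) (hb : 2 * η ≤ b) (hψ : LipB b K ψ) (hM : |ψ 0| ≤ M) (hg : Bd A R g) (hv : Bd A R v)
    (hg' : Bd A R g') (hv' : Bd A R v') {D : ℝ} (dg : ∀ j, |g j - g' j| ≤ D) (dv : ∀ j, |v j - v' j| ≤ D) {t : ℝ} (ht : t ∈ Ioo 0 A) :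
    |PhV ψ b g v t - PhV ψ b g' v' t| ≤ D / 2 ∧ |PhG p ψ b g v t - PhG p ψ b g' v' t| ≤ D / 2 := by
  have hs : ∀ j ∈ Icc 0 t, η ≤ pth b v j := fun j hj => h.sη hb hv ⟨hj.1, hj.2.trans ht.2.le⟩
  have hs' : ∀ j ∈ Icc 0 t, η ≤ pth b v' j := fun j hj => h.sη hb hv' ⟨hj.1, hj.2.trans ht.2.le⟩
  have mt : t ∈ Icc 0 t := ⟨ht.1.le, le_rfl⟩
  have D0 := (abs_nonneg _).trans (dg 0)
  have dd : ∀ x y, |(pth b v x - pth b v y) - (pth b v' x - pth b v' y)| ≤ D * |x - y| := fun x y => by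
    have e : (pth b v x - pth b v y) - (pth b v' x - pth b v' y) = ∫ r in y..x, (v r - v' r) := by
      simp only [pth]
      rw [isub (hv.ii _ _) (hv'.ii _ _), ← iisl (hv.ii 0 x) (hv.ii 0 y),
        ← iisl (hv'.ii 0 x) (hv'.ii 0 y)]; ring
    rw [e]
    exact nil (f := fun r => v r - v' r) fun r _ => dv r
  have t1 : t ≤ 1 := ht.2.le.trans h.A1
  have dS' : ∀ j ∈ Icc 0 t, |pth b v j - pth b v' j| ≤ D * t := fun j hj => by
    have := dd j 0
    simp only [pth_zero, sub_zero, abs_of_nonneg hj.1] at this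
    rw [show pth b v j - b - (pth b v' j - b) = pth b v j - pth b v' j by ring] at this
    exact this.trans (mul_le_mul_of_nonneg_left hj.2 D0)
  have dS : ∀ j ∈ Icc 0 t, |pth b v j - pth b v' j| ≤ D := fun j hj => (dS' j hj).trans (mul_le_of_le_one_right D0 t1)
  have c := hv.cp b
  have c' := hv.neg.cp (-b)
  have d := hv'.cp b
  have d' := hv'.neg.cp (-b)
  have R0 := hv.G0
  have Q0 := QF_pos h.η0
  have η0 := h.η0
  have m1 : ∀ j ∈ Ioo 0 t, 0 < t - j ∧ t - j ≤ 1 ∧ η ≤ pth b v j ∧ η ≤ pth b v' j := fun j hj =>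
    ⟨by linarith [hj.2], by linarith [hj.1, ht.2, h.A1], hs j ⟨hj.1.le, hj.2.le⟩, hs' j ⟨hj.1.le, hj.2.le⟩⟩
  have hst := hs t mt
  have hst' := hs' t mt
  have cmb : ∀ {κ : RG} {r y y' E : ℝ}, 0 < r → |κ r y - κ r y'| ≤ QF η * (√r)⁻¹ * |y - y'| → |y - y'| ≤ E →
      |κ r y - κ r y'| ≤ QF η * E * (√r)⁻¹ := fun {κ r y y' E} hr h1 h2 => by
    refine h1.trans ((mul_le_mul_of_nonneg_left h2 psv).trans (le_of_eq (by ring)))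
  have t2 : |LV1 g (fun _ => 0) t (pth b v t) - LV1 g' (fun _ => 0) t (pth b v' t)| ≤ (D * QF η + R * (QF η * D)) * (2 * √t) :=
    kd ht.1.le hg hg' dg hk1_meas (fun r hr y => hk1_of_nonpos hr y) continuous_const continuous_const
      (fun j hj => (far1 η0 (m1 j hj).1 (m1 j hj).2.1 lnn).1)
      (fun j hj => (far1 η0 (m1 j hj).1 (m1 j hj).2.1 lnn).1)
      (fun j hj => cmb (κ := hk1) (m1 j hj).1 (far2 η0 (m1 j hj).1 (m1 j hj).2.1 lnn lnn).2
        (by simpa using dS t mt))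
  have t4 : |LV1 v (pth (-b) (-v)) t (pth b v t) - LV1 v' (pth (-b) (-v')) t (pth b v' t)| ≤ (D * QF η + R * (QF η * (2 * D))) * (2 * √t) :=
    kd ht.1.le hv hv' dv hk1_meas (fun r hr y => hk1_of_nonpos hr y) (continuous_const.sub c') (continuous_const.sub d')
      (fun j hj => (far1 η0 (m1 j hj).1 (m1 j hj).2.1 (by rw [pth_neg]; linarith [(m1 j hj).2.2.1])).1)
      (fun j hj => (far1 η0 (m1 j hj).1 (m1 j hj).2.1 (by rw [pth_neg]; linarith [(m1 j hj).2.2.2])).1)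
      (fun j hj => cmb (κ := hk1) (m1 j hj).1 (far2 η0 (m1 j hj).1 (m1 j hj).2.1
        (by rw [pth_neg]; linarith [(m1 j hj).2.2.1]) (by rw [pth_neg]; linarith [(m1 j hj).2.2.2])).2
        (by
          have a1 := abs_le.1 (dS t mt)
          have a2 := abs_le.1 (dS j ⟨hj.1.le, hj.2.le⟩)
          rw [pth_neg, pth_neg, abs_le]; constructor <;> linarith [a1.1, a1.2, a2.1, a2.2]))
  have t3 : |LV1 v (pth b v) t (pth b v t) - LV1 v' (pth b v') t (pth b v' t)| ≤ (D * R + R * D) * (2 * √t) := by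
    have one : ∀ {v : RF}, Bd A R v → ∀ j ∈ Ioo 0 t, |hk1 (t - j) (pth b v t - pth b v j)| ≤ R * (√(t - j))⁻¹ := fun {v} hv j hj => by
      have r0 := (m1 j hj).1
      refine (hk1_le' _ _).trans ?_
      have := hv.lip b t j
      rw [abs_of_pos r0] at this ⊢
      refine (mul_le_mul_of_nonneg_right this psv).trans (le_of_eq ?_)
      have := (sqrt_pos.2 r0).ne'
      field_simp
    refine kd ht.1.le hv hv' dv hk1_meas (fun r hr y => hk1_of_nonpos hr y) (continuous_const.sub c) (continuous_const.sub d)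
      (one hv) (one hv') fun j hj => ?_
    have r0 := (m1 j hj).1
    refine (near2 _ _ _).trans ?_
    have := dd t j
    rw [abs_of_pos r0] at this ⊢
    refine (mul_le_mul_of_nonneg_left this psv).trans (le_of_eq ?_)
    have := (sqrt_pos.2 r0).ne'
    field_simp
  have hkb : ∀ r y, |hk r y| ≤ 1 * (√r)⁻¹ := fun r y => by rw [abs_of_nonneg (hk_nonneg r y), one_mul]; exact hk_le r y
  have t5 : |LV g (fun _ => 0) t 0 - LV g' (fun _ => 0) t 0| ≤ (D * 1 + R * 0) * (2 * √t) :=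
    kd ht.1.le hg hg' dg hk_meas (fun r hr y => hk_of_nonpos hr y) continuous_const continuous_const (fun j hj => hkb _ _)
      (fun j hj => hkb _ _) (by simp)
  have t7 : |LV v (pth (-b) (-v)) t 0 - LV v' (pth (-b) (-v')) t 0| ≤ (D * 1 + R * (QF η * D)) * (2 * √t) :=
    kd ht.1.le hv hv' dv hk_meas (fun r hr y => hk_of_nonpos hr y) (continuous_const.sub c') (continuous_const.sub d') (fun j hj => hkb _ _)
      (fun j hj => hkb _ _) (fun j hj => by
        have := (far2 η0 (m1 j hj).1 (m1 j hj).2.1 (m1 j hj).2.2.1 (m1 j hj).2.2.2).1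
        simp only [pth_neg, zero_sub, neg_neg]
        exact cmb (κ := hk) (m1 j hj).1 this (dS j ⟨hj.1.le, hj.2.le⟩))
  have t6 : |LV v (pth b v) t 0 - LV v' (pth b v') t 0| ≤ (D * 1 + R * (QF η * D)) * (2 * √t) :=
    kd ht.1.le hv hv' dv hk_meas (fun r hr y => hk_of_nonpos hr y) (continuous_const.sub c) (continuous_const.sub d) (fun j hj => hkb _ _)
      (fun j hj => hkb _ _) (fun j hj => by
        have := (far2 η0 (m1 j hj).1 (m1 j hj).2.1 (m1 j hj).2.2.1 (m1 j hj).2.2.2).1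
        simp only [zero_sub, hk_neg]
        exact cmb (κ := hk) (m1 j hj).1 this (dS j ⟨hj.1.le, hj.2.le⟩))
  have f1 : |FF1 ψ t (pth b v t) - FF1 ψ t (pth b v' t)| ≤ K * D * (2 * √t) := by
    refine (hψ.FF1lip ht.1 _ _).trans ?_
    have q := sqrt_pos.2 ht.1
    calc K * |pth b v t - pth b v' t| * (2 / √t) ≤ K * (D * t) * (2 / √t) := by have := dS' t mt; have := h.K0; gcongr
      _ = K * D * (2 * √t) := by
        have : t / √t = √t := Real.div_sqrt
        calc _ = K * D * (2 * (t / √t)) := by ring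
          _ = _ := by rw [this]
  have M0 := h.M0
  set Pc := p * (M + 1) ^ (p - 1) with hPc
  have hP : 0 ≤ Pc := mul_nonneg (by linarith [h.p1]) (rpow_nonneg (by linarith [h.M0]) _)
  have sA : √t ≤ √A := sqrt_le_sqrt ht.2.le
  have st := Real.sqrt_nonneg t
  have K0 := h.K0
  have RQ := mul_nonneg R0 Q0.le
  have small : ∀ c, c ≤ SS p η K M R → c * (2 * √t) ≤ 1 / 2 := fun c hc => by
    refine le_trans ?_ h.S
    have : 0 ≤ SS p η K M R := by unfold SS; positivity
    calc c * (2 * √t) ≤ SS p η K M R * (2 * √A) := by gcongr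
      _ = _ := by ring
  have hX : (4 + 2 * R * QF η) * Pc ≤ (4 + 2 * R * QF η + 4 * R + 2 * K) * (1 + Pc) :=
    mul_le_mul lnn lnn hP psv
  have hX0 : 0 ≤ (4 + 2 * R * QF η + 4 * R + 2 * K) * (1 + Pc) := by positivity
  have s1 := mul_le_mul_of_nonneg_left (small (2 * K + 6 * QF η + 8 * R * QF η + 4 * R) (by unfold SS; nlinarith [sq_nonneg R])) D0
  have s2 := mul_le_mul_of_nonneg_left (small ((4 + 2 * R * QF η) * Pc) (by unfold SS; nlinarith [sq_nonneg R])) D0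
  have n1 := abs_le.1 (h.eb hb hψ hM hg hv ht).2
  have n2 := abs_le.1 (h.eb hb hψ hM hg' hv' ht).2
  have dN : |NN ψ b g v t 0 - NN ψ b g' v' t 0| ≤ D * (4 + 2 * R * QF η) * (2 * √t) := by
    rw [NN, NN, abs_le]
    rw [abs_le] at t5 t6 t7
    constructor <;> linarith
  constructor
  · unfold PhV
    rw [abs_le] at *
    constructor <;> linarith
  · unfold PhG
    have := (convex_Icc 0 (M + 1)).norm_image_sub_le_of_norm_hasDerivWithin_le (f := fun x : ℝ => x ^ p) (f' := fun x : ℝ => p * x ^ (p - 1)) (C := Pc)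
      (x := max 0 (NN ψ b g' v' t 0)) (y := max 0 (NN ψ b g v t 0))
      (fun x _ => (Real.hasDerivAt_rpow_const (Or.inr h.p1.le)).hasDerivWithinAt)
      (fun x hx => by
        rw [norm_eq_abs, abs_of_nonneg (mul_nonneg (by linarith [h.p1]) (rpow_nonneg hx.1 _)), hPc]
        exact mul_le_mul_of_nonneg_left (rpow_le_rpow hx.1 hx.2 (by linarith [h.p1])) (by linarith [h.p1]))
      ⟨le_max_left _ _, max_le lnn n2.2⟩ ⟨le_max_left _ _, max_le lnn n1.2⟩
    have q : |max 0 (NN ψ b g v t 0) - max 0 (NN ψ b g' v' t 0)| ≤ D * (4 + 2 * R * QF η) * (2 * √t) :=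
      (abs_max_sub_max_le_max _ _ _ _).trans (by simpa using dN)
    refine this.trans ((mul_le_mul_of_nonneg_left q hP).trans ?_)
    linarith
end

structure Fx (p R A b : ℝ) (ψ g v : RF) : Prop where
  hg : Bd A R g
  hv : Bd A R v
  ev : ∀ t ∈ Ioo 0 A, v t = PhV ψ b g v t
  eg : ∀ t ∈ Ioo 0 A, g t = PhG p ψ b g v t

section
variable {p η K M R A b : ℝ} {ψ g v g' v' : RF}

lemma Sm.cV (h : Sm p η K M R A) (hb : 2 * η ≤ b) (hψ : LipB b K ψ) (hg : Bd A R g) (hv : Bd A R v) :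
    ContinuousOn (PhV ψ b g v) (Ioo 0 A) := by
  intro t ht
  have hs := h.η0.trans_le (h.sη hb hv ⟨ht.1.le, ht.2.le⟩)
  have c := (hv.cp b).continuousAt (x := t)
  have cc : ContinuousAt (fun t => (t, pth b v t)) t := continuousAt_id.prodMk c
  obtain ⟨-, -, -, -, f4, -⟩ := hψ.off ht.1 (pth b v t)
  obtain ⟨-, -, -, a4, -⟩ := hg.lay0.off (t := t) (x := pth b v t) hs.ne'
  obtain ⟨-, -, -, c4, -⟩ := (hv.lay hv.neg (-b)).off (t := t) (x := pth b v t) (by rw [pth_neg]; linarith)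
  have q : ContinuousAt (fun t => LV1 v (pth b v) t (pth b v t)) t := by
    have l := ((hv.lay hv b).LQ_cont ht).comp (x := t) (f := fun t => (t, pth b v t)) cc
    refine (l.sub ((hv.gc.continuousAt (isOpen_Ioo.mem_nhds ht)).div_const 2)).congr ?_
    filter_upwards [isOpen_Ioo.mem_nhds ht] with j hj
    exact (((hv.lay hv b).side hj).2.2 rfl).symm
  refine ContinuousAt.continuousWithinAt ?_
  unfold PhV
  exact (((continuousAt_const.mul (f4.comp (x := t) (f := fun t => (t, pth b v t)) cc)).sub
    (continuousAt_const.mul (a4.comp (x := t) (f := fun t => (t, pth b v t)) cc))).add (continuousAt_const.mul q)).add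
    (continuousAt_const.mul (c4.comp (x := t) (f := fun t => (t, pth b v t)) cc))

lemma Sm.bG (h : Sm p η K M R A) (hb : 2 * η ≤ b) (hψ : LipB b K ψ) (hM : |ψ 0| ≤ M) (hg : Bd A R g) (hv : Bd A R v) :
    Bd A R (ct A (PhV ψ b g v)) ∧ Bd A R (ct A (PhG p ψ b g v)) := by
  refine ⟨ct_bd hv.G0 (h.cV hb hψ hg hv) fun t ht => (h.eb hb hψ hM hg hv ht).1, ct_bd hv.G0 ?_ fun t ht => ?_⟩
  · have : Continuous fun t => NN ψ b g v t 0 := (NNc hψ hg hv).comp (by fun_prop : Continuous fun t : ℝ => (t, (0:ℝ)))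
    have : Continuous (PhG p ψ b g v) := (continuous_const.max this).rpow_const fun _ => Or.inr (by linarith [h.p1])
    exact this.continuousOn
  · have n := abs_le.1 (h.eb hb hψ hM hg hv ht).2
    have m : 0 ≤ max 0 (NN ψ b g v t 0) := le_max_left _ _
    unfold PhG
    rw [abs_of_nonneg (rpow_nonneg m _)]
    exact (rpow_le_rpow m (max_le (by linarith [h.M0]) n.2) (by linarith [h.p1])).trans h.RM

def PhP (p A b : ℝ) (ψ : RF) (f : Bool × ℝ → ℝ) (q : Bool × ℝ) : ℝ :=
  if q.1 then ct A (PhV ψ b (fun t => f (false, t)) fun t => f (true, t)) q.2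
  else ct A (PhG p ψ b (fun t => f (false, t)) fun t => f (true, t)) q.2

def PP2 (A R : ℝ) (f : Bool × ℝ → ℝ) : Prop := Bd A R (fun t => f (false, t)) ∧ Bd A R fun t => f (true, t)

lemma PP2b {f : Bool × ℝ → ℝ} (h : PP2 A R f) : ∀ a, |f a| ≤ R
  | (false, t) => h.1.gb t
  | (true, t) => h.2.gb t

lemma Sm.con (h : Sm p η K M R A) (hb : 2 * η ≤ b) (hψ : LipB b K ψ) (hM : |ψ 0| ≤ M) (f g : Bool × ℝ → ℝ) (hf : PP2 A R f) (hg : PP2 A R g)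
    (D : ℝ) (hD : ∀ a, |f a - g a| ≤ D) (a : Bool × ℝ) : |PhP p A b ψ f a - PhP p A b ψ g a| ≤ D / 2 := by
  obtain ⟨i, t⟩ := a
  have D0 := (abs_nonneg _).trans (hD (i, t))
  by_cases ht : t ∈ Ioo 0 A
  · have := h.ec hb hψ hM hf.1 hf.2 hg.1 hg.2 (fun j => hD (false, j)) (fun j => hD (true, j)) ht
    cases i
    · simpa [PhP, ct_in ht] using this.2
    · simpa [PhP, ct_in ht] using this.1
  · cases i <;> simpa [PhP, ct_out ht] using by linarith

lemma Sm.exi (h : Sm p η K M R A) (hb : 2 * η ≤ b) (hψ : LipB b K ψ) (hM : |ψ 0| ≤ M) : ∃ g v, Fx p R A b ψ g v := by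
  have R0 : 0 ≤ R := by linarith [h.RK, h.K0]
  obtain ⟨f, hf, e⟩ := fixp (PP2 A R) (PhP p A b ψ) (R := R) (f0 := fun _ => 0) (fun f hf => PP2b hf)
    (fun f hf => by
      have := h.bG hb hψ hM hf.1 hf.2
      exact ⟨this.2, this.1⟩)
    (fun F f hF hl => by
      have key : ∀ i, (∀ n, Bd A R fun t => F n (i, t)) → Bd A R fun t => f (i, t) := fun i hn => by
        have pt : ∀ t, Tendsto (fun n => F n (i, t)) atTop (𝓝 (f (i, t))) := fun t => hl.tendsto_at _
        refine ⟨fun t ht => ?_, fun t => le_of_tendsto (pt t).abs (Eventually.of_forall fun n => (hn n).gb t), ?_⟩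
        · exact tendsto_nhds_unique (pt t) (by simp [(hn _).gz t ht])
        · have : TendstoUniformly (fun n t => F n (i, t)) (fun t => f (i, t)) atTop := hl.comp _
          exact this.tendstoUniformlyOn.continuousOn (Frequently.of_forall fun n => (hn n).gc)
      exact ⟨key _ fun n => (hF n).1, key _ fun n => (hF n).2⟩)
    (h.con hb hψ hM) ⟨⟨fun _ _ => rfl, fun _ => by simpa, continuousOn_const⟩, ⟨fun _ _ => rfl, fun _ => by simpa, continuousOn_const⟩⟩
  refine ⟨_, _, hf.1, hf.2, fun t ht => ?_, fun t ht => ?_⟩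
  · have := congrFun e (true, t)
    simpa [PhP, ct_in ht] using this.symm
  · have := congrFun e (false, t)
    simpa [PhP, ct_in ht] using this.symm

lemma Sm.unq (h : Sm p η K M R A) (hb : 2 * η ≤ b) (hψ : LipB b K ψ) (hM : |ψ 0| ≤ M) (F : Fx p R A b ψ g v) (F' : Fx p R A b ψ g' v') :
    g = g' ∧ v = v' := by
  have mk : ∀ {g v : RF}, Fx p R A b ψ g v → PhP p A b ψ (fun q => if q.1 then v q.2 else g q.2) = fun q => if q.1 then v q.2 else g q.2 := by
    intro g v F
    funext ⟨i, t⟩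
    by_cases ht : t ∈ Ioo 0 A
    · cases i
      · simp [PhP, ct_in ht, F.eg t ht]
      · simp [PhP, ct_in ht]; exact (F.ev t ht).symm
    · cases i
      · simp [PhP, ct_out ht, F.hg.gz t ht]
      · simp [PhP, ct_out ht, F.hv.gz t ht]
  have := fixu (P := PP2 A R) (fun f hf => PP2b hf) (h.con hb hψ hM) (f := fun q => if q.1 then v q.2 else g q.2)
    (g := fun q => if q.1 then v' q.2 else g' q.2) ⟨by simpa using F.hg, by simpa using F.hv⟩ ⟨by simpa using F'.hg, by simpa using F'.hv⟩ (mk F) (mk F')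
  exact ⟨funext fun t => by simpa using congrFun this (false, t), funext fun t => by simpa using congrFun this (true, t)⟩

lemma Sm.mono (h : Sm p η K M R A) {A' : ℝ} (h0 : 0 < A') (h1 : A' ≤ A) : Sm p η K M R A' where
  p1 := h.p1
  η0 := h.η0
  K0 := h.K0
  M0 := h.M0
  A0 := h0
  A1 := h1.trans h.A1
  RA := (mul_le_mul_of_nonneg_left h1 (by linarith [h.RK, h.K0])).trans h.RA
  RK := h.RK
  RM := h.RM
  S := by
    refine le_trans ?_ h.S
    have R0 : 0 ≤ R := by linarith [h.RK, h.K0]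
    have K0 := h.K0
    have Q0 := QF_pos h.η0
    have hP : 0 ≤ p * (M + 1) ^ (p - 1) := mul_nonneg (by linarith [h.p1]) (rpow_nonneg (by linarith [h.M0]) _)
    have : 0 ≤ SS p η K M R := by unfold SS; positivity
    gcongr

lemma Sm.ex {p η K M : ℝ} (p1 : 1 < p) (η0 : 0 < η) (K0 : 0 ≤ K) (M0 : 0 ≤ M) : ∃ R A, Sm p η K M R A := by
  set R := max (2 * K + 1) ((M + 1) ^ p)
  have RK : 2 * K + 1 ≤ R := le_max_left _ _
  have R0 : 0 < R := by linarith
  have l : ∀ f : RF, Continuous f → f 0 = 0 → ∀ c, 0 < c → ∀ᶠ x in 𝓝[>] (0:ℝ), f x < c := fun f hf h0 c hc =>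
    (((hf.tendsto 0).mono_left nhdsWithin_le_nhds).eventually_lt_const (by rwa [h0]))
  obtain ⟨A, h1, h2, h3, h4⟩ := ((l (fun x => x) continuous_id rfl 1 one_pos).and ((l (fun x => R * x) fpp (by simp) η η0).and
    ((l (fun x => 2 * √x * SS p η K M R) fpp (by simp) (1 / 2) (by norm_num)).and self_mem_nhdsWithin))).exists
  exact ⟨R, A, p1, η0, K0, M0, h4, h1.le, h2.le, RK, le_max_right _ _, h3.le⟩

lemma LV1_cau {A A' : ℝ} {f O : RF} {t x : ℝ} (h : t ≤ A) (h' : t ≤ A') {O' : RF} (hs : ∀ j ∈ Ioo 0 t, O j = O' j) :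
    LV1 (ct A f) O t x = LV1 (ct A' f) O' t x := by
  unfold LV1
  congr 1; ext j
  by_cases h1 : j < t
  · by_cases h2 : 0 < j
    · rw [ct_in ⟨h2, h1.trans_le h⟩, ct_in ⟨h2, h1.trans_le h'⟩, hs j ⟨h2, h1⟩]
    · rw [ct_out fun h3 => h2 h3.1, ct_out fun h3 => h2 h3.1]; simp
  · rw [hk1_of_nonpos lnn, hk1_of_nonpos lnn]; simp

lemma Fx.res (F : Fx p R A b ψ g v) {A' : ℝ} (h1 : A' ≤ A) : Fx p R A' b ψ (ct A' g) (ct A' v) := by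
  have e : ∀ {f : RF}, Bd A R f → ct A f = f := fun {f} hf => by
    ext t
    by_cases h : t ∈ Ioo 0 A
    · exact ct_in h
    · rw [ct_out h, hf.gz t h]
  have bd : ∀ {f : RF}, Bd A R f → Bd A' R (ct A' f) := fun {f} hf =>
    ct_bd hf.G0 (hf.gc.mono fun t ht => ⟨ht.1, ht.2.trans_le h1⟩) fun t _ => hf.gb t
  refine ⟨bd F.hg, bd F.hv, fun t ht => ?_, fun t ht => ?_⟩
  · have hA : t ≤ A := ht.2.le.trans h1
    have s1 : ∀ (b : ℝ) v, ∀ j ∈ Ioc 0 t, pth b (ct A v) j = pth b (ct A' v) j := fun b v j hj =>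
      pth_cau hj.1.le (hj.2.trans hA) (hj.2.trans ht.2.le)
    have m : t ∈ Ioc 0 t := ⟨ht.1, le_rfl⟩
    have i : ∀ {j}, j ∈ Ioo 0 t → j ∈ Ioc 0 t := fun h => ⟨h.1, h.2.le⟩
    rw [ct_in ht, F.ev t ⟨ht.1, ht.2.trans_le h1⟩]
    conv_lhs => rw [← e F.hg, ← e F.hv]
    unfold PhV
    rw [ct_neg, ct_neg, s1 b v t m, LV1_cau hA ht.2.le (fun _ _ => rfl), LV1_cau hA ht.2.le (fun j hj => s1 b v j (i hj)),
      LV1_cau hA ht.2.le (fun j hj => s1 (-b) (-v) j (i hj))]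
  · rw [ct_in ht, F.eg t ⟨ht.1, ht.2.trans_le h1⟩]
    conv_lhs => rw [← e F.hg, ← e F.hv]
    unfold PhG
    rw [NN_cau (ht.2.le.trans h1) ht.2.le]
end

def N1i (ψ : RF) (b : ℝ) (g v : RF) (t x : ℝ) : ℝ :=
  FF1 ψ t x + 2 * (LQ g (fun _ => 0) (fun _ => 0) t x - g t) - LQ v (pth b v) v t x - LV1 v (pth (-b) (-v)) t x

section
variable {B K A G L b : ℝ} {ψ g v : RF} (h : LipB B K ψ) (hg : Bd A G g) (hv : Bd A L v) {t : ℝ} (ht : t ∈ Ioo 0 A)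
include hg hv ht

lemma N1in {x : ℝ} (h0 : 0 < x) (h1 : x < pth b v t) : NN1 ψ b g v t x = N1i ψ b g v t x := by
  rw [NN1, N1i, (hg.lay0.side ht).2.1 h0, ((hv.lay hv b).side ht).1 h1]

lemma N1out {x : ℝ} (h0 : 0 < x) (h1 : pth b v t < x) : NN1 ψ b g v t x = N1i ψ b g v t x + v t := by
  rw [NN1, N1i, (hg.lay0.side ht).2.1 h0, ((hv.lay hv b).side ht).2.1 h1]; ring

include h in
lemma N1c {x : ℝ} (hx : x ≠ -pth b v t) : ContinuousAt (fun q : RP => N1i ψ b g v q.1 q.2) (t, x) := by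
  rw [← pth_neg] at hx
  obtain ⟨-, -, -, -, f4, -⟩ := h.off ht.1 x
  obtain ⟨-, -, -, c4, -⟩ := (hv.lay hv.neg (-b)).off hx
  have cg : ContinuousAt (fun q : RP => g q.1) (t, x) :=
    ContinuousAt.comp (x := (t, x)) (f := Prod.fst) (hg.gc.continuousAt (isOpen_Ioo.mem_nhds ht)) continuousAt_fst
  exact ((f4.add (continuousAt_const.mul ((hg.lay0.LQ_cont ht).sub cg))).sub ((hv.lay hv b).LQ_cont ht)).sub c4

lemma N1s (h0 : 0 < pth b v t) : N1i ψ b g v t (pth b v t) = -PhV ψ b g v t / 2 - v t / 2 := by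
  rw [N1i, PhV, (hg.lay0.side ht).2.1 h0, ((hv.lay hv b).side ht).2.2 rfl]; ring

lemma N10 (he : ∀ x, ψ (-x) = ψ x) (h0 : 0 < pth b v t) : N1i ψ b g v t 0 = -g t := by
  have f : FF1 ψ t 0 = 0 := by have := FF1_odd he t 0; rw [neg_zero] at this; linarith
  have z : ∀ r, hk1 r 0 = 0 := fun r => by have := hk1_neg r 0; rw [neg_zero] at this; linarith
  have l : LV1 g (fun _ => 0) t 0 = 0 := by simp [LV1, z]
  have e := (hg.lay0.side (x := 0) ht).2.2 rfl
  have e2 : LV1 v (pth (-b) (-v)) t 0 = -LV1 v (pth b v) t 0 := by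
    unfold LV1
    rw [← integral_neg]
    congr 1; ext j
    rw [pth_neg, show (0:ℝ) - -pth b v j = -(0 - pth b v j) by ring, hk1_neg]; ring
  rw [N1i, f, ← ((hv.lay hv b).side ht).1 h0, e2]
  linarith
end

lemma NN_zero {A G L b : ℝ} {ψ g v : RF} (hg : Bd A G g) (hv : Bd A L v) (x : ℝ) : NN ψ b g v 0 x = ψ x := by
  have a1 := hg.lay0.bound le_rfl x
  have a2 := (hv.lay hv b).bound le_rfl x
  have a3 := (hv.lay hv.neg (-b)).bound le_rfl x
  simp only [sqrt_zero, mul_zero, abs_nonpos_iff] at a1 a2 a3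
  rw [NN, F0, if_pos le_rfl, a1, a2, a3]; ring

lemma NN_bd {A G L b B K : ℝ} {ψ g v : RF} (h : LipB B K ψ) (hg : Bd A G g) (hv : Bd A L v) (T : ℝ) :
    ∃ M, 0 ≤ M ∧ ∀ t ∈ Icc 0 T, ∀ x, |NN ψ b g v t x| ≤ M := by
  obtain ⟨m, m0, hm⟩ := h.bd
  have G0 := hg.G0
  have L0 := hv.G0
  refine ⟨m + 2 * (G * (2 * √T)) + L * (2 * √T) + L * (2 * √T), by positivity, fun t ht x => ?_⟩
  have sq : √t ≤ √T := sqrt_le_sqrt ht.2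
  have a1 := abs_le.1 ((hg.lay0.bound ht.1 x).trans (by gcongr : _ ≤ G * (2 * √T)))
  have a2 := abs_le.1 (((hv.lay hv b).bound ht.1 x).trans (by gcongr : _ ≤ L * (2 * √T)))
  have a3 := abs_le.1 (((hv.lay hv.neg (-b)).bound ht.1 x).trans (by gcongr : _ ≤ L * (2 * √T)))
  have a0 : |F0 ψ t x| ≤ m := by
    unfold F0; split_ifs
    · exact hm x
    · exact h.FFbd hm t x
  have a0 := abs_le.1 a0
  rw [NN, abs_le]; constructor <;> linarith [a0.1, a0.2, a1.1, a1.2, a2.1, a2.2, a3.1, a3.2]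

lemma comp {T : ℝ} {α β : RF} (hα : Continuous α) (hβ : Continuous β) {z zx zxx zt : RG}
    (zc : Continuous fun q : RP => z q.1 q.2) (h0 : ∀ x ∈ Icc (α 0) (β 0), 0 ≤ z 0 x)
    (h1 : ∀ t ∈ Icc 0 T, 0 ≤ z t (β t))
    (h2 : ∀ t ∈ Ioc 0 T, ∀ x ∈ Ioo (α t) (β t), HasDerivAt (z t) (zx t x) x ∧ HasDerivAt (zx t) (zxx t x) x ∧
      HasDerivAt (fun j => z j x) (zt t x) t ∧ zxx t x < zt t x)
    (h3 : ∀ t ∈ Ioc 0 T, z t (α t) < 0 → ∀ᶠ y in 𝓝[>] (α t), zx t y < 0) :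
    ∀ t ∈ Icc 0 T, ∀ x ∈ Icc (α t) (β t), 0 ≤ z t x := by
  let K : Set (ℝ × ℝ) := {q | q.1 ∈ Icc 0 T ∧ α q.1 ≤ q.2 ∧ q.2 ≤ β q.1}
  obtain ⟨m, hm⟩ := (isCompact_Icc (a := 0) (b := T)).bddBelow_image hα.continuousOn
  obtain ⟨M, hM⟩ := (isCompact_Icc (a := 0) (b := T)).bddAbove_image hβ.continuousOn
  have Kc : IsCompact K := by
    refine (isCompact_Icc (a := 0) (b := T)).prod (isCompact_Icc (a := m) (b := M)) |>.of_isClosed_subset ?_ fun q hq => ⟨hq.1, ?_, ?_⟩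
    · exact (isClosed_Icc.preimage continuous_fst).inter ((isClosed_le fpp continuous_snd).inter (isClosed_le continuous_snd fpp))
    · exact (hm (mem_image_of_mem _ hq.1)).trans hq.2.1
    · exact hq.2.2.trans (hM (mem_image_of_mem _ hq.1))
  have main := minp Kc (z := z) zc.continuousOn (by
    intro t x hq hneg hmin
    obtain ⟨ht, hx1, hx2⟩ := hq
    dsimp only at ht hx1 hx2
    have t0 : 0 < t := lt_of_le_of_ne ht.1 (by rintro rfl; exact hneg.not_ge (h0 x ⟨hx1, hx2⟩))
    have x2 : x < β t := lt_of_le_of_ne hx2 (by rintro rfl; exact hneg.not_ge (h1 t ht))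
    have x1 : α t < x := by
      refine lt_of_le_of_ne hx1 ?_
      rintro rfl
      have ev := (h3 t ⟨t0, ht.2⟩ hneg).and (Ioo_mem_nhdsGT x2)
      obtain ⟨y, hy, hy'⟩ := (mem_nhdsGT_iff_exists_Ioo_subset' x2).1 ev
      have hy : α t < y := hy
      obtain ⟨w, w1, w2⟩ := exists_between hy
      obtain ⟨c, hc, e⟩ := exists_hasDerivAt_eq_slope (z t) (zx t) w1
        (zc.comp (by fun_prop : Continuous fun y => (t, y))).continuousOn fun c hc => (h2 t ⟨t0, ht.2⟩ c (hy' ⟨hc.1, hc.2.trans w2⟩).2).1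
      have n := (hy' ⟨hc.1, hc.2.trans w2⟩).1
      rw [e, div_neg_iff] at n
      have := hmin (t, w) ⟨ht, w1.le, (hy' ⟨w1, w2⟩).2.2.le⟩
      dsimp only at this
      rcases n with n | n <;> linarith [n.1, n.2]
    obtain ⟨d1, d2, d3, d4⟩ := h2 t ⟨t0, ht.2⟩ x ⟨x1, x2⟩
    refine ⟨?_, ?_, zx t, zt t x, zxx t x, ?_, d2, d3, d4⟩
    · filter_upwards [Ioo_mem_nhds x1 x2] with y hy using ⟨ht, hy.1.le, hy.2.le⟩
    · have : ∀ᶠ j in 𝓝 t, α j < x ∧ x < β j ∧ 0 < j :=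
        (hα.continuousAt.eventually_lt_const x1).and ((hβ.continuousAt.eventually_const_lt x2).and (lt_mem_nhds t0))
      filter_upwards [nhdsWithin_le_nhds this, self_mem_nhdsWithin] with j hj hj'
      exact ⟨⟨hj.2.2.le, (le_of_lt hj').trans ht.2⟩, hj.1.le, hj.2.1.le⟩
    · filter_upwards [Ioo_mem_nhds x1 x2] with y hy using (h2 t ⟨t0, ht.2⟩ y hy).1)
  exact fun t ht x hx => main t x ⟨ht, hx.1, hx.2⟩

def Hb (κ t x : ℝ) : ℝ := exp (2 * t - x) + κ * (x ^ 2 + 3 * t)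

lemma NNcmp {B K A G L b T : ℝ} {ψ g v : RF} (h : LipB B K ψ) (hg : Bd A G g) (hv : Bd A L v)
    {α β : RF} (hα : Continuous α) (hβ : Continuous β) {c ε κ : ℝ} (ε0 : 0 < ε) (κ0 : 0 ≤ κ)
    (hx : ∀ t ∈ Ioc 0 T, ∀ x ∈ Ioo (α t) (β t), x ≠ 0 ∧ x ≠ pth b v t ∧ x ≠ -pth b v t)
    (h0 : ∀ x ∈ Icc (α 0) (β 0), 0 ≤ c * ψ x)
    (h1 : ∀ t ∈ Icc 0 T, 0 ≤ c * NN ψ b g v t (β t) + ε * Hb κ t (β t))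
    (h3 : ∀ t ∈ Ioc 0 T, c * NN ψ b g v t (α t) < 0 → 2 * κ * α t < exp (2 * t - α t) ∧ Tendsto (NN1 ψ b g v t) (𝓝[>] (α t)) (𝓝 0)) :
    ∀ t ∈ Icc 0 T, ∀ x ∈ Icc (α t) (β t), 0 ≤ c * NN ψ b g v t x + ε * Hb κ t x := by
  have Hp : ∀ t x, 0 ≤ t → 0 ≤ Hb κ t x := fun t x ht => by unfold Hb; positivity
  refine comp hα hβ (zx := fun t x => c * NN1 ψ b g v t x + ε * (-exp (2 * t - x) + 2 * κ * x))
    (zxx := fun t x => c * NN2 ψ b g v t x + ε * (exp (2 * t - x) + 2 * κ))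
    (zt := fun t x => c * NN2 ψ b g v t x + ε * (2 * exp (2 * t - x) + κ * 3)) ?_ ?_ h1 ?_ ?_
  · have := NNc (b := b) h hg hv
    unfold Hb; fun_prop
  · intro x hx
    rw [NN_zero hg hv]
    have := h0 x hx
    have := Hp 0 x le_rfl
    positivity
  · intro t ht x hx'
    obtain ⟨a0, a1, a2⟩ := hx t ht x hx'
    obtain ⟨d1, d2, d3, -, -⟩ := NNoff h hg hv ht.1 a0 a1 a2
    have e1 : HasDerivAt (fun x => exp (2 * t - x)) (-exp (2 * t - x)) x := by
      refine (((hasDerivAt_id x).const_sub (2 * t)).exp).congr_deriv ?_; simp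
    refine ⟨(d1.const_mul c).add (HasDerivAt.const_mul ε ?_), (d2.const_mul c).add (HasDerivAt.const_mul ε ?_), (d3.const_mul c).add (HasDerivAt.const_mul ε ?_), ?_⟩
    · refine (e1.add ((((hasDerivAt_id x).pow 2).add_const (3 * t)).const_mul κ)).congr_deriv ?_
      simp; ring
    · refine (e1.neg.add ((hasDerivAt_id x).const_mul (2 * κ))).congr_deriv ?_
      simp
    · have e2 : HasDerivAt (fun t => 2 * t - x) 2 t := by simpa using ((hasDerivAt_id t).const_mul 2).sub_const x
      have e3 : HasDerivAt (fun t => x ^ 2 + 3 * t) 3 t := by simpa using ((hasDerivAt_id t).const_mul 3).const_add (x ^ 2)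
      refine (e2.exp.add (e3.const_mul κ)).congr_deriv ?_
      ring
    · have := exp_pos (2 * t - x)
      nlinarith
  · intro t ht hn
    have hn' : c * NN ψ b g v t (α t) < 0 := by
      have := mul_nonneg ε0.le (Hp t (α t) ht.1.le)
      linarith
    obtain ⟨l1, l2⟩ := h3 t ht hn'
    have cc : Continuous fun x => ε * (-exp (2 * t - x) + 2 * κ * x) := by fun_prop
    have := (l2.const_mul c).add (cc.continuousAt (x := α t).tendsto.mono_left (nhdsWithin_le_nhds (s := Ioi (α t))))
    refine this.eventually_lt_const ?_
    have : ε * (-exp (2 * t - α t) + 2 * κ * α t) < 0 := mul_neg_of_pos_of_neg ε0 lnn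
    linarith

lemma epz {a H : ℝ} (H0 : 0 < H) (h : ∀ ε > 0, 0 ≤ a + ε * H) : 0 ≤ a := by
  by_contra hn
  have := h (-a / (2 * H)) (by apply div_pos <;> linarith)
  have e : -a / (2 * H) * H = -a / 2 := by field_simp
  linarith

section
variable {p η K M R A b : ℝ} {ψ g v : RF} (h : Sm p η K M R A) (hb : 2 * η ≤ b) (hψ : LipB b K ψ) (F : Fx p R A b ψ g v)
include h hb hψ F

lemma Fx.sp {t : ℝ} (ht : t ∈ Icc 0 A) : 0 < pth b v t := h.η0.trans_le (h.sη hb F.hv ht)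

lemma Fx.xs {t : ℝ} (ht : t ∈ Ioo 0 A) : N1i ψ b g v t (pth b v t) = -v t := by
  rw [N1s F.hg F.hv ht (F.sp h hb hψ ⟨ht.1.le, ht.2.le⟩), ← F.ev t ht]; ring

lemma Fx.out {t x : ℝ} (ht : t ∈ Ico 0 A) (hx : pth b v t ≤ x) : NN ψ b g v t x = 0 := by
  have tl : ∀ j, j ∈ Icc 0 t → j ∈ Icc 0 A := fun j hj => ⟨hj.1, hj.2.trans ht.2.le⟩
  have tl' : ∀ j, j ∈ Ioc 0 t → j ∈ Ioo 0 A := fun j hj => ⟨hj.1, hj.2.trans_lt ht.2⟩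
  obtain ⟨N, N0, hN⟩ := NN_bd (b := b) hψ F.hg F.hv t
  have O0 : 0 < b + R * A := by
    have := mul_nonneg F.hv.G0 h.A0.le
    linarith [h.η0]
  set O := b + R * A
  have sO : ∀ j ∈ Icc 0 t, pth b v j ≤ O := fun j hj => by
    have := F.hv.lip b j 0
    rw [pth_zero, sub_zero, abs_of_nonneg hj.1] at this
    have := (abs_le.1 (this.trans (mul_le_mul_of_nonneg_left (tl j hj).2 F.hv.G0))).2
    simp only [O]; linarith
  set κ := exp (-O) / (4 * O)
  have κ0 : 0 < κ := by positivity
  have H0 : 0 < Hb κ t x := by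
    have := ht.1
    unfold Hb; positivity
  have key : ∀ c : ℝ, |c| = 1 → 0 ≤ c * NN ψ b g v t x := fun c hc => epz H0 fun ε ε0 => by
    set B := max (max x 1) (max O (N / (ε * κ)))
    have Bx : x ≤ B := (le_max_left _ _).trans (le_max_left _ _)
    have B1 : 1 ≤ B := (le_max_right _ _).trans (le_max_left _ _)
    have BN : N / (ε * κ) ≤ B := (le_max_right _ _).trans (le_max_right _ _)
    refine NNcmp (T := t) hψ F.hg F.hv (F.hv.cp b) (continuous_const (y := B)) ε0 κ0.le ?_ ?_ ?_ ?_ t ⟨ht.1, le_rfl⟩ x ⟨hx, Bx⟩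
    · intro j hj y hy
      have := F.sp h hb hψ (tl j ⟨hj.1.le, hj.2⟩)
      exact ⟨by linarith [hy.1], hy.1.ne', by linarith [hy.1]⟩
    · intro y hy
      rw [pth_zero] at hy
      have e : ψ y = 0 := by
        rcases eq_or_lt_of_le hy.1 with e | e
        · have z : ψ =ᶠ[𝓝[>] b] fun _ => 0 := by
            filter_upwards [self_mem_nhdsWithin] with w hw using hψ.z w fun hc => (not_lt.2 hc.2) hw
          have := (hψ.c.tendsto b).mono_left (nhdsWithin_le_nhds (s := Ioi b))
          rw [← e]
          exact tendsto_nhds_unique (this.congr' z) tendsto_const_nhds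
        · exact hψ.z y fun hc => (not_lt.2 hc.2) e
      rw [e, mul_zero]
    · intro j hj
      have a := abs_le.1 (show |c * NN ψ b g v j B| ≤ N by rw [abs_mul, hc, one_mul]; exact hN j hj B)
      rw [div_le_iff₀ psv] at BN
      have : ε * (κ * B ^ 2) ≤ ε * Hb κ j B := by
        have := hj.1
        unfold Hb
        gcongr
        nlinarith [exp_pos (2 * j - B), mul_nonneg κ0.le this]
      have : B * (ε * κ) ≤ ε * (κ * B ^ 2) := by
        have : 0 < ε * κ := by positivity
        nlinarith
      linarith [a.1]
    · intro j hj _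
      have sp := F.sp h hb hψ (tl j ⟨hj.1.le, hj.2⟩)
      have ss := sO j ⟨hj.1.le, hj.2⟩
      constructor
      · have e1 : exp (-O) ≤ exp (2 * j - pth b v j) := exp_le_exp.2 (by linarith [hj.1])
        have e2 : 2 * κ * pth b v j ≤ 2 * κ * O := by gcongr
        have e3 : 2 * κ * O = exp (-O) / 2 := by simp only [κ]; field_simp; norm_num
        linarith [exp_pos (-O)]
      · have c := (N1c hψ F.hg F.hv (tl' j hj) (x := pth b v j) lnn).comp (x := pth b v j) (f := fun y => (j, y)) fpp
        have l := (c.tendsto.mono_left (nhdsWithin_le_nhds (s := Ioi (pth b v j)))).add_const (v j)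
        dsimp only [Function.comp] at l
        rw [F.xs h hb hψ (tl' j hj), neg_add_cancel] at l
        refine l.congr' ?_
        filter_upwards [self_mem_nhdsWithin] with y hy
        exact (N1out F.hg F.hv (tl' j hj) (sp.trans hy) hy).symm
  have a1 := key 1 (by simp)
  have a2 := key (-1) (by simp)
  linarith

lemma Fx.pos (he : ∀ x, ψ (-x) = ψ x) (hp : ∀ x, 0 ≤ ψ x) {t x : ℝ} (ht : t ∈ Ico 0 A) (hx : 0 ≤ x) : 0 ≤ NN ψ b g v t x := by
  rcases le_total (pth b v t) x with hs | hs
  · exact (F.out h hb hψ ht hs).ge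
  have tl : ∀ j, j ∈ Icc 0 t → j ∈ Icc 0 A := fun j hj => ⟨hj.1, hj.2.trans ht.2.le⟩
  have tl' : ∀ j, j ∈ Ioc 0 t → j ∈ Ioo 0 A := fun j hj => ⟨hj.1, hj.2.trans_lt ht.2⟩
  have H0 : 0 < Hb 0 t x := by rw [Hb, zero_mul, add_zero]; exact exp_pos _
  refine epz H0 fun ε ε0 => ?_
  rw [← one_mul (NN ψ b g v t x)]
  refine NNcmp (T := t) (c := 1) hψ F.hg F.hv (continuous_const (y := 0)) (F.hv.cp b) ε0 le_rfl ?_ ?_ ?_ ?_ t ⟨ht.1, le_rfl⟩ x ⟨hx, hs⟩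
  · intro j hj y hy
    have := F.sp h hb hψ (tl j ⟨hj.1.le, hj.2⟩)
    exact ⟨hy.1.ne', hy.2.ne, by linarith [hy.1]⟩
  · intro y _; linarith [hp y]
  · intro j hj
    have := hj.1
    rw [F.out h hb hψ ⟨hj.1, hj.2.trans_lt ht.2⟩ le_rfl]
    unfold Hb; positivity
  · intro j hj hn
    have sp := F.sp h hb hψ (tl j ⟨hj.1.le, hj.2⟩)
    refine ⟨by simpa using exp_pos _, ?_⟩
    have g0 : g j = 0 := by
      rw [F.eg j (tl' j hj), PhG, max_eq_left lnn, zero_rpow (by linarith [h.p1])]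
    have c := (N1c hψ F.hg F.hv (tl' j hj) (x := 0) lnn).comp (x := (0:ℝ)) (f := fun y => (j, y)) fpp
    have l := c.tendsto.mono_left (nhdsWithin_le_nhds (s := Ioi 0))
    dsimp only [Function.comp] at l
    rw [N10 F.hg F.hv (tl' j hj) he sp, g0, neg_zero] at l
    refine l.congr' ?_
    filter_upwards [Ioo_mem_nhdsGT sp] with y hy
    exact (N1in F.hg F.hv (tl' j hj) hy.1 hy.2).symm

lemma Fx.x0 (he : ∀ x, ψ (-x) = ψ x) (hp : ∀ x, 0 ≤ ψ x) {t : ℝ} (ht : t ∈ Ioo 0 A) : N1i ψ b g v t 0 = -NN ψ b g v t 0 ^ p := by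
  rw [N10 F.hg F.hv ht he (F.sp h hb hψ ⟨ht.1.le, ht.2.le⟩), F.eg t ht, PhG, max_eq_right (F.pos h hb hψ he hp ⟨ht.1.le, ht.2⟩ le_rfl)]
end

def DD (S : RF) : Set (ℝ × ℝ) := {q | q.2 ∈ Icc 0 (S q.1)}

structure Sat (p : ℝ) (S V : RF) (U X : RG) (t : ℝ) : Prop where
  sp : 0 < S t
  sd : HasDerivAt S (V t) t
  vc : ContinuousAt V t
  uc : ∀ x ∈ Icc 0 (S t), ContinuousWithinAt (fun q : RP => U q.1 q.2) (DD S) (t, x)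
  xc : ∀ x ∈ Icc 0 (S t), ContinuousWithinAt (fun q : RP => X q.1 q.2) (DD S) (t, x)
  u0 : ∀ x ∈ Icc 0 (S t), 0 ≤ U t x
  uz : U t (S t) = 0
  ud : ∀ x ∈ Ioo 0 (S t), HasDerivAt (U t) (X t x) x
  xd : ∀ x ∈ Ioo 0 (S t), HasDerivAt (X t) (deriv (X t) x) x
  ut : ∀ x ∈ Ioo 0 (S t), HasDerivAt (fun j => U j x) (deriv (X t) x) t
  zc : ∀ x ∈ Ioo 0 (S t), ContinuousAt (fun q : RP => deriv (X q.1) q.2) (t, x)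
  x0 : X t 0 = -U t 0 ^ p
  xs : X t (S t) = -V t

section
variable {p : ℝ} {S V S' V' : RF} {U X U' X' : RG} {t : ℝ}

lemma Sat.inn (H : Sat p S V U X t) {x : ℝ} (hx : x ∈ Ioo 0 (S t)) : ∀ᶠ q in 𝓝 (t, x), q.2 ∈ Ioo 0 (S q.1) := by
  have c : ContinuousAt (fun q : RP => S q.1 - q.2) (t, x) :=
    (ContinuousAt.comp (x := (t, x)) (f := Prod.fst) H.sd.continuousAt continuousAt_fst).sub continuousAt_snd
  filter_upwards [c.eventually_const_lt (show 0 < S t - x by linarith [hx.2]),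
    continuousAt_snd.eventually_const_lt (show 0 < (t, x).2 from hx.1)] with q h1 h2
  exact ⟨h2, by linarith⟩

lemma Sat.innt (H : Sat p S V U X t) {x : ℝ} (hx : x ∈ Ioo 0 (S t)) : ∀ᶠ j in 𝓝 t, x ∈ Ioo 0 (S j) :=
  (H.sd.continuousAt.eventually_const_lt hx.2).mono fun _ h => ⟨hx.1, h⟩

lemma Sat.congr (H : Sat p S V U X t)
    (e : ∀ᶠ j in 𝓝 t, S' j = S j ∧ V' j = V j ∧ ∀ x ∈ Icc 0 (S j), U' j x = U j x ∧ X' j x = X j x) : Sat p S' V' U' X' t := by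
  obtain ⟨eS, eV, eU⟩ := e.self_of_nhds
  have e2 : ∀ x, ∀ᶠ q : RP in 𝓝 (t, x), S' q.1 = S q.1 ∧ V' q.1 = V q.1 ∧ ∀ x ∈ Icc 0 (S q.1), U' q.1 x = U q.1 x ∧ X' q.1 x = X q.1 x :=
    fun x => (continuous_fst.tendsto (t, x)).eventually e
  have ds : ∀ x, DD S ∈ 𝓝[DD S'] (t, x) := fun x => by
    filter_upwards [nhdsWithin_le_nhds (e2 x), self_mem_nhdsWithin] with q hq hq'
    simpa [DD, hq.1] using hq'
  have lx : ∀ j, (∀ x ∈ Icc 0 (S j), U' j x = U j x ∧ X' j x = X j x) → ∀ x ∈ Ioo 0 (S j), X' j =ᶠ[𝓝 x] X j := fun j hj x hx => by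
    filter_upwards [isOpen_Ioo.mem_nhds hx] with y hy using (hj y ⟨hy.1.le, hy.2.le⟩).2
  have S0 : (0:ℝ) ∈ Icc 0 (S t) := ⟨le_rfl, H.sp.le⟩
  have S1 : S t ∈ Icc 0 (S t) := ⟨H.sp.le, le_rfl⟩
  refine ⟨by rw [eS]; exact H.sp, ?_, H.vc.congr (e.mono fun j h => h.2.1.symm), ?_, ?_, ?_, ?_, ?_, ?_, ?_, ?_, ?_, ?_⟩
  · rw [eV]; exact H.sd.congr_of_eventuallyEq (e.mono fun j h => h.1)
  all_goals try rw [eS]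
  · intro x hx
    refine ((H.uc x hx).mono_of_mem_nhdsWithin (ds x)).congr_of_eventuallyEq ?_ (eU x hx).1
    filter_upwards [nhdsWithin_le_nhds (e2 x), ds x] with q hq hq' using (hq.2.2 _ hq').1
  · intro x hx
    refine ((H.xc x hx).mono_of_mem_nhdsWithin (ds x)).congr_of_eventuallyEq ?_ (eU x hx).2
    filter_upwards [nhdsWithin_le_nhds (e2 x), ds x] with q hq hq' using (hq.2.2 _ hq').2
  · intro x hx; rw [(eU x hx).1]; exact H.u0 x hx
  · rw [(eU _ S1).1, H.uz]
  · intro x hx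
    rw [(eU x ⟨hx.1.le, hx.2.le⟩).2]
    refine (H.ud x hx).congr_of_eventuallyEq ?_
    filter_upwards [isOpen_Ioo.mem_nhds hx] with y hy using (eU y ⟨hy.1.le, hy.2.le⟩).1
  · intro x hx
    rw [(lx t eU x hx).deriv_eq]
    exact (H.xd x hx).congr_of_eventuallyEq (lx t eU x hx)
  · intro x hx
    rw [(lx t eU x hx).deriv_eq]
    refine (H.ut x hx).congr_of_eventuallyEq ?_
    filter_upwards [e, H.innt hx] with j h1 h2
    exact (h1.2.2 x ⟨h2.1.le, h2.2.le⟩).1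
  · intro x hx
    refine (H.zc x hx).congr ?_
    filter_upwards [e2 x, H.inn hx] with q h1 h2 using (lx _ h1.2.2 _ h2).deriv_eq.symm
  · rw [(eU 0 S0).2, (eU 0 S0).1, H.x0]
  · rw [(eU _ S1).2, H.xs, eV]

lemma Sat.xeq (H : Sat p S V U X t) (H' : Sat p S' V' U' X' t) (eS : S' t = S t) (eV : V' t = V t)
    (eU : ∀ x ∈ Icc 0 (S t), U' t x = U t x) : ∀ x ∈ Icc 0 (S t), X' t x = X t x := by
  intro x hx
  rcases eq_or_lt_of_le hx.1 with rfl | h1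
  · rw [H.x0, H'.x0, eU 0 hx]
  rcases eq_or_lt_of_le hx.2 with rfl | h2
  · rw [H.xs, ← eS, H'.xs, eV]
  refine (H'.ud x (by rw [eS]; exact ⟨h1, h2⟩)).unique ((H.ud x ⟨h1, h2⟩).congr_of_eventuallyEq ?_)
  filter_upwards [Ioo_mem_nhds h1 h2] with y hy using eU y ⟨hy.1.le, hy.2.le⟩

lemma Sat.shift {c : ℝ} (H : Sat p S V U X (t - c)) :
    Sat p (fun t => S (t - c)) (fun t => V (t - c)) (fun t => U (t - c)) (fun t => X (t - c)) t := by
  have c2 : Continuous fun q : RP => (q.1 - c, q.2) := by fun_prop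
  refine ⟨H.sp, H.sd.comp_sub_const t c, ContinuousAt.comp (x := t) (f := fun t => t - c) H.vc fpp, ?_, ?_, H.u0, H.uz, H.ud, H.xd, ?_, ?_, H.x0, H.xs⟩
  · exact fun x hx => ContinuousWithinAt.comp (x := (t, x)) (f := fun q : RP => (q.1 - c, q.2)) (t := DD S) (H.uc x hx) c2.continuousWithinAt fun q hq => hq
  · exact fun x hx => ContinuousWithinAt.comp (x := (t, x)) (f := fun q : RP => (q.1 - c, q.2)) (t := DD S) (H.xc x hx) c2.continuousWithinAt fun q hq => hq
  · exact fun x hx => (H.ut x hx).comp_sub_const t c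
  · exact fun x hx => ContinuousAt.comp (x := (t, x)) (f := fun q : RP => (q.1 - c, q.2)) (H.zc x hx) c2.continuousAt
end

lemma IsSolOn.sat {p s₀ T : ℝ} {φ s : RF} {u : RG} (h : IsSolOn p s₀ φ T s u) {t : ℝ} (ht : t ∈ Ioo 0 T) :
    Sat p s (deriv s) u (fun t => deriv (u t)) t := by
  have t1 : t ∈ Ioc 0 T := ⟨ht.1, ht.2.le⟩
  have t2 : t ∈ Icc 0 T := ⟨ht.1.le, ht.2.le⟩
  have sp := h.s_pos t t2
  have sc := (h.s_diff t t1).continuousAt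
  have ev : ∀ x, ∀ᶠ q : RP in 𝓝 (t, x), q.1 ∈ Ioo 0 T := fun x => continuousAt_fst.eventually (isOpen_Ioo.mem_nhds ht)
  refine ⟨sp, (h.s_diff t t1).hasDerivAt, h.s_deriv_cont.continuousAt (Ioc_mem_nhds ht.1 ht.2), ?_, ?_, h.u_nonneg t t2, h.bc_free t t1,
    fun x hx => (h.ux_diff t t1 x hx).hasDerivAt, fun x hx => (h.uxx_diff t t1 x hx).hasDerivAt, ?_, ?_, ?_, ?_⟩
  · intro x hx
    refine (h.u_cont (t, x) ⟨t2, hx⟩).mono_of_mem_nhdsWithin ?_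
    filter_upwards [nhdsWithin_le_nhds (ev x), self_mem_nhdsWithin] with q h1 h2 using ⟨⟨h1.1.le, h1.2.le⟩, h2⟩
  · intro x hx
    refine (h.ux_cont (t, x) ⟨t1, hx⟩).mono_of_mem_nhdsWithin ?_
    filter_upwards [nhdsWithin_le_nhds (ev x), self_mem_nhdsWithin] with q h1 h2 using ⟨⟨h1.1, h1.2.le⟩, h2⟩
  · intro x hx
    rw [← h.heat t t1 x hx]
    exact (h.ut_diff t t1 x hx).hasDerivAt
  · intro x hx
    refine (h.uxx_cont (t, x) ⟨t1, hx⟩).continuousAt ?_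
    have c : ContinuousAt (fun q : RP => s q.1 - q.2) (t, x) :=
      (ContinuousAt.comp (x := (t, x)) (f := Prod.fst) sc continuousAt_fst).sub continuousAt_snd
    filter_upwards [ev x, c.eventually_const_lt (show 0 < s t - x by linarith [hx.2]),
      continuousAt_snd.eventually_const_lt (show 0 < (t, x).2 from hx.1)] with q h0 h1 h2
    exact ⟨⟨h0.1, h0.2.le⟩, h2, by linarith⟩
  · have := h.bc_zero t t1; linarith
  · have := h.stefan t t1; linarith

lemma Fx.sat {p η K M R A b : ℝ} {ψ g v : RF} (h : Sm p η K M R A) (hb : 2 * η ≤ b) (hψ : LipB b K ψ) (F : Fx p R A b ψ g v)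
    (he : ∀ x, ψ (-x) = ψ x) (hp : ∀ x, 0 ≤ ψ x) {t : ℝ} (ht : t ∈ Ioo 0 A) :
    Sat p (pth b v) v (NN ψ b g v) (N1i ψ b g v) t := by
  have tc : t ∈ Ico 0 A := ⟨ht.1.le, ht.2⟩
  have sp := F.sp h hb hψ ⟨ht.1.le, ht.2.le⟩
  have sd := (F.hv.lay F.hv b).Od t ht
  have dd : ∀ j ∈ Ioo 0 A, ∀ x ∈ Ioo 0 (pth b v j), N1i ψ b g v j =ᶠ[𝓝 x] NN1 ψ b g v j := fun j hj x hx => by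
    filter_upwards [isOpen_Ioo.mem_nhds hx] with y hy using (N1in F.hg F.hv hj hy.1 hy.2).symm
  have of := fun j (hj : j ∈ Ioo 0 A) x (hx : x ∈ Ioo 0 (pth b v j)) =>
    NNoff hψ F.hg F.hv hj.1 hx.1.ne' hx.2.ne (by linarith [hx.1, hx.2] : x ≠ -pth b v j)
  have d2 : ∀ j ∈ Ioo 0 A, ∀ x ∈ Ioo 0 (pth b v j), deriv (N1i ψ b g v j) x = NN2 ψ b g v j x := fun j hj x hx => by
    rw [(dd j hj x hx).deriv_eq, (of j hj x hx).2.1.deriv]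
  refine ⟨sp, sd, F.hv.gc.continuousAt (isOpen_Ioo.mem_nhds ht), fun x _ => (NNc hψ F.hg F.hv).continuousWithinAt,
    fun x hx => (N1c hψ F.hg F.hv ht (by linarith [hx.1])).continuousWithinAt, fun x hx => F.pos h hb hψ he hp tc hx.1,
    F.out h hb hψ tc le_rfl, ?_, ?_, ?_, ?_, F.x0 h hb hψ he hp ht, F.xs h hb hψ ht⟩
  · intro x hx
    rw [← N1in F.hg F.hv ht hx.1 hx.2]
    exact (of t ht x hx).1
  · intro x hx
    rw [d2 t ht x hx]
    exact (of t ht x hx).2.1.congr_of_eventuallyEq (dd t ht x hx)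
  · intro x hx
    rw [d2 t ht x hx]
    exact (of t ht x hx).2.2.1
  · intro x hx
    refine (of t ht x hx).2.2.2.2.congr ?_
    have c : Continuous fun q : RP => pth b v q.1 - q.2 := ((F.hv.cp b).comp continuous_fst).sub continuous_snd
    filter_upwards [continuousAt_fst.eventually (isOpen_Ioo.mem_nhds ht), c.continuousAt.eventually_const_lt (show 0 < pth b v t - x by linarith [hx.2]),
      continuousAt_snd.eventually_const_lt (show 0 < (t, x).2 from hx.1)] with q h0 h1 h2
    exact (d2 _ h0 _ ⟨h2, by linarith⟩).symm

def xt (S : RF) (U X : RG) (t x : ℝ) : ℝ :=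
  if x < 0 then U t 0 + x * X t 0 else if S t < x then (x - S t) * X t (S t) else U t x

section
variable {p : ℝ} {S V : RF} {U X : RG} {t : ℝ}

lemma xt_in {x : ℝ} (hx : x ∈ Icc 0 (S t)) : xt S U X t x = U t x := by
  rw [xt, if_neg (not_lt.2 hx.1), if_neg (not_lt.2 hx.2)]

lemma Sat.sl (H : Sat p S V U X t) {f : RG} {x : ℝ} (hc : ContinuousWithinAt (fun q : RP => f q.1 q.2) (DD S) (t, x)) :
    ContinuousWithinAt (f t) (Icc 0 (S t)) x :=
  ContinuousWithinAt.comp (x := x) (f := fun x => (t, x)) (t := DD S) hc fpp fun y hy => hy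

lemma Sat.ed (H : Sat p S V U X t) {x : ℝ} (hx : x ∈ Icc 0 (S t)) : HasDerivAt (xt S U X t) (X t x) x := by
  have sp := H.sp
  have ei : ∀ y ∈ Ioo 0 (S t), xt S U X t =ᶠ[𝓝 y] U t := fun y hy => by
    filter_upwards [isOpen_Ioo.mem_nhds hy] with z hz using xt_in ⟨hz.1.le, hz.2.le⟩
  have di : ∀ y ∈ Ioo 0 (S t), HasDerivAt (xt S U X t) (X t y) y := fun y hy => (H.ud y hy).congr_of_eventuallyEq (ei y hy)
  have df : DifferentiableOn ℝ (xt S U X t) (Ioo 0 (S t)) := fun y hy => (di y hy).differentiableAt.differentiableWithinAt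
  have cw : ∀ y ∈ Icc 0 (S t), ContinuousWithinAt (xt S U X t) (Ioo 0 (S t)) y := fun y hy =>
    ((H.sl (H.uc y hy)).mono Ioo_subset_Icc_self).congr (fun z hz => xt_in ⟨hz.1.le, hz.2.le⟩) (xt_in hy)
  have dl : ∀ y ∈ Icc 0 (S t), Tendsto (deriv (xt S U X t)) (𝓝[Ioo 0 (S t)] y) (𝓝 (X t y)) := fun y hy => by
    refine ((H.sl (H.xc y hy)).mono Ioo_subset_Icc_self).congr' ?_
    filter_upwards [self_mem_nhdsWithin] with z hz using (di z hz).deriv.symm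
  rcases eq_or_lt_of_le hx.1 with rfl | h1
  · have r := hasDerivWithinAt_Ici_of_tendsto_deriv df (cw 0 hx) (Ioo_mem_nhdsGT sp) (by
      have := dl 0 hx; rwa [nhdsWithin_Ioo_eq_nhdsGT sp] at this)
    have l : HasDerivWithinAt (xt S U X t) (X t 0) (Iic 0) 0 := by
      have : HasDerivAt (fun x => U t 0 + x * X t 0) (X t 0) 0 := by
        simpa using ((hasDerivAt_id (0:ℝ)).mul_const (X t 0)).const_add (U t 0)
      refine this.hasDerivWithinAt.congr (fun y hy => ?_) (by rw [xt_in hx]; simp)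
      rcases eq_or_lt_of_le (mem_Iic.1 hy) with rfl | hy
      · rw [xt_in hx]; simp
      · rw [xt, if_pos hy]
    have := l.union r
    rwa [Iic_union_Ici, hasDerivWithinAt_univ] at this
  rcases eq_or_lt_of_le hx.2 with rfl | h2
  · have l := hasDerivWithinAt_Iic_of_tendsto_deriv df (cw _ hx) (Ioo_mem_nhdsLT sp) (by
      have := dl _ hx; rwa [nhdsWithin_Ioo_eq_nhdsLT sp] at this)
    have r : HasDerivWithinAt (xt S U X t) (X t (S t)) (Ici (S t)) (S t) := by
      have : HasDerivAt (fun x => (x - S t) * X t (S t)) (X t (S t)) (S t) := by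
        simpa using ((hasDerivAt_id (S t)).sub_const (S t)).mul_const (X t (S t))
      refine this.hasDerivWithinAt.congr (fun y hy => ?_) (by rw [xt_in hx, H.uz]; simp)
      rcases eq_or_lt_of_le (mem_Ici.1 hy) with hy | hy
      · rw [← hy, xt_in hx, H.uz]; simp
      · rw [xt, if_neg lnn, if_pos hy]
    have := l.union r
    rwa [Iic_union_Ici, hasDerivWithinAt_univ] at this
  exact di x ⟨h1, h2⟩

lemma toSol {s₀ T ε : ℝ} {φ s : RF} {u : RG} (T0 : 0 < T) (H : ∀ t ∈ Ioc 0 T, Sat p S V U X t)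
    (h : IsSolOn p s₀ φ ε s u) (eS : ∀ t ∈ Ico 0 ε, S t = s t) (eU : ∀ t ∈ Ico 0 ε, U t = u t) :
    IsSolOn p s₀ φ T S (xt S U X) := by
  have e0 := h.T_pos
  have z : (0:ℝ) ∈ Ico 0 ε := ⟨le_rfl, e0⟩
  have z' : (0:ℝ) ∈ Icc 0 ε := ⟨le_rfl, e0.le⟩
  have cs : ∀ t, t ∈ Icc 0 T → t = 0 ∨ t ∈ Ioc 0 T := fun t ht => (eq_or_lt_of_le ht.1).imp Eq.symm fun h => ⟨h, ht.2⟩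
  have oS := eS 0 z
  have oU := eU 0 z
  have nz : ∀ x, ∀ᶠ q : RP in 𝓝 (0, x), q.1 < ε := fun x => (continuous_fst.tendsto (0, x)).eventually (gt_mem_nhds e0)
  have dX : ∀ t ∈ Ioc 0 T, ∀ x ∈ Icc 0 (S t), deriv (xt S U X t) x = X t x := fun t ht x hx => ((H t ht).ed hx).deriv
  have eX : ∀ t ∈ Ioc 0 T, ∀ x ∈ Ioo 0 (S t), deriv (xt S U X t) =ᶠ[𝓝 x] X t := fun t ht x hx => by
    filter_upwards [isOpen_Ioo.mem_nhds hx] with y hy using dX t ht y ⟨hy.1.le, hy.2.le⟩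
  have dt : ∀ t ∈ Ioc 0 T, ∀ x ∈ Ioo 0 (S t), HasDerivAt (fun j => xt S U X j x) (deriv (X t) x) t := fun t ht x hx => by
    refine ((H t ht).ut x hx).congr_of_eventuallyEq ?_
    filter_upwards [(H t ht).innt hx] with j h2
    exact xt_in ⟨h2.1.le, h2.2.le⟩
  have sd : ∀ t ∈ Ioc 0 T, deriv S t = V t := fun t ht => (H t ht).sd.deriv
  have l0 : ∀ t ∈ Ioc 0 T, (0:ℝ) ∈ Icc 0 (S t) := fun t ht => ⟨le_rfl, (H t ht).sp.le⟩
  have l1 : ∀ t ∈ Ioc 0 T, S t ∈ Icc 0 (S t) := fun t ht => ⟨(H t ht).sp.le, le_rfl⟩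
  refine ⟨T0, ?_, fun t ht => (H t ht).sd.differentiableAt, ?_, ?_, fun t ht x hx => (dt t ht x hx).differentiableAt,
    fun t ht x hx => ((H t ht).ed ⟨hx.1.le, hx.2.le⟩).differentiableAt, ?_, ?_, ?_, ?_, ?_, ?_, ?_, ?_, ?_, ?_, ?_, ?_⟩
  · intro t ht
    rcases cs t ht with rfl | ht
    · have c := (h.s_cont 0 z').mono_of_mem_nhdsWithin (s := Icc 0 T) (by
        filter_upwards [nhdsWithin_le_nhds (gt_mem_nhds e0), self_mem_nhdsWithin] with j h1 h2 using ⟨h2.1, le_of_lt h1⟩)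
      refine c.congr_of_eventuallyEq ?_ oS
      filter_upwards [nhdsWithin_le_nhds (gt_mem_nhds e0), self_mem_nhdsWithin] with j h1 h2 using eS j ⟨h2.1, h1⟩
    · exact (H t ht).sd.continuousAt.continuousWithinAt
  · exact fun t ht => (H t ht).vc.continuousWithinAt.congr (fun j hj => sd j hj) (sd t ht)
  · intro t ht
    rcases cs t ht with rfl | ht
    · rw [oS]; exact h.s_pos 0 z'
    · exact (H t ht).sp
  · intro t ht x hx
    exact ((H t ht).xd x hx).differentiableAt.congr_of_eventuallyEq (eX t ht x hx)
  · rintro ⟨t, x⟩ ⟨ht, hx⟩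
    exact ((H t ht).zc x hx).continuousWithinAt.congr (fun q hq => (dt q.1 hq.1 q.2 hq.2).deriv) (dt t ht x hx).deriv
  · rintro ⟨t, x⟩ ⟨ht, hx⟩
    exact ((H t ht).zc x hx).continuousWithinAt.congr (fun q hq => (eX q.1 hq.1 q.2 hq.2).deriv_eq) (eX t ht x hx).deriv_eq
  · rintro ⟨t, x⟩ ⟨ht, hx⟩
    exact (((H t ht).xc x hx).mono fun q hq => hq.2).congr (fun q hq => dX q.1 hq.1 q.2 hq.2) (dX t ht x hx)
  · rintro ⟨t, x⟩ ⟨ht, hx⟩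
    dsimp only at ht hx
    rcases cs t ht with rfl | ht
    · have c := (h.u_cont (0, x) ⟨z', by rw [← oS]; exact hx⟩).mono_of_mem_nhdsWithin (s := {q : RP | q.1 ∈ Icc 0 T ∧ q.2 ∈ Icc 0 (S q.1)}) (by
        filter_upwards [nhdsWithin_le_nhds (nz x), self_mem_nhdsWithin] with q h1 h2
        exact ⟨⟨h2.1.1, h1.le⟩, by rw [← eS q.1 ⟨h2.1.1, h1⟩]; exact h2.2⟩)
      refine c.congr_of_eventuallyEq ?_ (by dsimp only; rw [xt_in hx, oU])
      filter_upwards [nhdsWithin_le_nhds (nz x), self_mem_nhdsWithin] with q h1 h2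
      rw [xt_in h2.2, eU q.1 ⟨h2.1.1, h1⟩]
    · exact (((H t ht).uc x hx).mono fun q hq => hq.2).congr (fun q hq => xt_in hq.2) (xt_in hx)
  · intro t ht x hx
    rw [xt_in hx]
    rcases cs t ht with rfl | ht
    · rw [oU]; exact h.u_nonneg 0 z' x (by rw [← oS]; exact hx)
    · exact (H t ht).u0 x hx
  · intro t ht x hx
    rw [(dt t ht x hx).deriv, (eX t ht x hx).deriv_eq]
  · intro t ht
    rw [dX t ht 0 (l0 t ht), xt_in (l0 t ht), (H t ht).x0, neg_neg]
  · intro t ht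
    rw [xt_in (l1 t ht), (H t ht).uz]
  · intro t ht
    rw [sd t ht, dX t ht _ (l1 t ht), (H t ht).xs, neg_neg]
  · intro x hx
    have : S 0 = s₀ := oS.trans h.init_s
    rw [xt_in (by rw [this]; exact hx), oU, h.init x hx]
  · exact oS.trans h.init_s
end

section
variable {p a b : ℝ} {S V : RF} {U X Z : RG} (H : Cl p a b S V U X Z)
include H

lemma Cl.fx (hp : 1 < p) {t0 A K R : ℝ} (h0 : t0 ∈ Ioo a b) (h1 : t0 + A < b) (R0 : 0 ≤ R) (hψ : LipB (S t0) K (U t0))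
    (hL : ∀ j ∈ Ioo 0 A, V (t0 + j) ≤ R) (hG : ∀ j ∈ Ioo 0 A, (U (t0 + j) 0) ^ p ≤ R) :
    Fx p R A (S t0) (U t0) (ct A fun j => (U (t0 + j) 0) ^ p) (ct A fun j => V (t0 + j)) := by
  obtain ⟨bv, bg⟩ := H.bds hp R0 R0 hL hG
  have m : ∀ t ∈ Ioo 0 A, t0 + t ∈ Ioo a b := fun t ht => ⟨by linarith [h0.1, ht.1], by linarith [ht.2]⟩
  have hr : ∀ t ∈ Ioo 0 A, U (t0 + t) = NN (U t0) (S t0) (ct A fun j => (U (t0 + j) 0) ^ p) (ct A fun j => V (t0 + j)) t :=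
    fun t ht => funext fun x => H.rep hp h0 (m t ht) ht.1.le ht.2.le x
  refine ⟨bg, bv, fun t ht => ?_, fun t ht => ?_⟩
  · have e := H.Spth h0 (m t ht) ht.1.le ht.2.le
    have r := hr t ht
    have s0 := H.Sp (t0 + t)
    have vt : ct A (fun j => V (t0 + j)) t = V (t0 + t) := ct_in ht
    set g := ct A fun j => (U (t0 + j) 0) ^ p
    set v := ct A fun j => V (t0 + j)
    have i : ∀ x ∈ Ioo 0 (S (t0 + t)), X (t0 + t) x = N1i (U t0) (S t0) g v t x := fun x hx => by
      have d := (NNoff hψ bg bv ht.1 hx.1.ne' (e ▸ hx.2.ne) (by rw [← e]; linarith [hx.1] : x ≠ -pth (S t0) v t)).1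
      rw [← N1in bg bv ht hx.1 (e ▸ hx.2)]
      have d' := H.Ud (t0 + t) x hx
      rw [r] at d'
      exact d'.unique d
    have hX := H.Xc
    have c1 : Tendsto (X (t0 + t)) (𝓝[<] S (t0 + t)) (𝓝 (X (t0 + t) (S (t0 + t)))) :=
      ((by fun_prop : Continuous (X (t0 + t))).tendsto _).mono_left nhdsWithin_le_nhds
    have c := (N1c hψ bg bv ht (x := pth (S t0) v t) lnn).comp (x := pth (S t0) v t) (f := fun y => (t, y)) fpp
    have c2 := c.tendsto.mono_left (nhdsWithin_le_nhds (s := Iio (pth (S t0) v t)))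
    dsimp only [Function.comp] at c2
    rw [N1s bg bv ht (e ▸ s0), ← e] at c2
    have := tendsto_nhds_unique (c1.congr' (by filter_upwards [Ioo_mem_nhdsLT s0] with x hx using i x hx)) c2
    rw [H.XS, ← vt] at this
    linarith
  · rw [ct_in ht, PhG, ← hr t ht, max_eq_right (H.U0 _ _)]

lemma Cl.ov (hp : 1 < p) {t0 A A' η K M R : ℝ} {g v : RF} (h : Sm p η K M R A') (hA : A ≤ A') (A0 : 0 < A) (h0 : t0 ∈ Ioo a b) (h1 : t0 + A < b)
    (hb : 2 * η ≤ S t0) (hψ : LipB (S t0) K (U t0)) (hM : |U t0 0| ≤ M)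
    (hL : ∀ j ∈ Ioo 0 A, V (t0 + j) ≤ R) (hG : ∀ j ∈ Ioo 0 A, (U (t0 + j) 0) ^ p ≤ R) (F : Fx p R A' (S t0) (U t0) g v) {r : ℝ} (hr : r ∈ Ioo 0 A) :
    S (t0 + r) = pth (S t0) v r ∧ V (t0 + r) = v r ∧ ∀ x, U (t0 + r) x = NN (U t0) (S t0) g v r x := by
  have R0 : 0 ≤ R := by linarith [h.RK, h.K0]
  have m : t0 + r ∈ Ioo a b := ⟨by linarith [h0.1, hr.1], by linarith [hr.2]⟩
  obtain ⟨e1, e2⟩ := (h.mono A0 hA).unq hb hψ hM (H.fx hp h0 h1 R0 hψ hL hG) (F.res hA)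
  have e : ∀ {f : RF}, Bd A' R f → ct A' f = f := fun {f} hf => by
    ext t
    by_cases h : t ∈ Ioo 0 A'
    · exact ct_in h
    · rw [ct_out h, hf.gz t h]
  have hr' : r ≤ A' := hr.2.le.trans hA
  refine ⟨?_, ?_, fun x => ?_⟩
  · rw [H.Spth h0 m hr.1.le hr.2.le, e2, pth_cau hr.1.le hr.2.le hr', e F.hv]
  · have := congrFun e2 r
    rwa [ct_in hr, ct_in hr] at this
  · rw [H.rep hp h0 m hr.1.le hr.2.le, e1, e2, NN_cau hr.2.le hr', e F.hv, e F.hg]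

lemma Cl.bdy {t K : ℝ} (hK : ∀ x ∈ Ioo 0 (S t), |X t x| ≤ K) : V t ≤ K ∧ U t 0 ^ p ≤ K := by
  have hX := H.Xc
  have c : Continuous (X t) := by fun_prop
  have k : ∀ x ∈ Icc 0 (S t), |X t x| ≤ K := by
    have : closure (Ioo 0 (S t)) ⊆ {x | |X t x| ≤ K} := (isClosed_le c.abs continuous_const).closure_subset_iff.2 hK
    rwa [closure_Ioo (H.Sp t).ne] at this
  have k1 := k 0 ⟨le_rfl, (H.Sp t).le⟩
  have k2 := k (S t) ⟨(H.Sp t).le, le_rfl⟩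
  rw [H.X0] at k1
  rw [H.XS] at k2
  exact ⟨by linarith [(abs_le.1 k2).1], by linarith [(abs_le.1 k1).1]⟩
end

lemma en_anti {p s₀ Tm : ℝ} {φ s : RF} {u : RG} (hp : 1 < p) (h : ∀ T, 0 < T → T < Tm → IsSolOn p s₀ φ T s u)
    {t1 t2 : ℝ} (h0 : 0 < t1) (h12 : t1 ≤ t2) (h2 : t2 < Tm) : energy p s u t2 ≤ energy p s u t1 := by
  obtain ⟨T, hT, hT'⟩ := exists_between h2
  have I := h T lnn hT'
  have H := I.toCl (half_pos h0) lnn le_rfl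
  have e := H.energy hp (half_lt_self h0) h12 hT
  have q := inn h12 (μ := volume) (f := fun t => (uc s u (cl (t1 / 2) T t) 0 ^ (p + 1) - QQ (fun t => s (cl (t1 / 2) T t)) (fun t => xc s u (cl (t1 / 2) T t)) t t) ^ 2 /
    (1 + PP (fun t => s (cl (t1 / 2) T t)) (fun t => uc s u (cl (t1 / 2) T t)) t t)) fun t _ => div_nonneg (sq_nonneg _) (by linarith [H.PP0 t])
  rw [← En_eq (p := p) (u := u) (a := t1 / 2) (b := T) ⟨by linarith, by linarith⟩ (I.s_pos t1 ⟨h0.le, by linarith⟩),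
    ← En_eq (p := p) (u := u) (a := t1 / 2) (b := T) ⟨by linarith, by linarith⟩ (I.s_pos t2 ⟨by linarith, by linarith⟩)]
  unfold En
  linarith

lemma uc_in {s : RF} {u : RG} {t x : ℝ} (hx : x ∈ Icc 0 (s t)) : uc s u t x = u t x := by
  rw [uc, abs_of_nonneg hx.1, min_eq_left hx.2]

lemma extend {p s₀ Tm t1 K : ℝ} {φ s : RF} {u : RG} (hp : 1 < p) (h : ∀ T, 0 < T → T < Tm → IsSolOn p s₀ φ T s u)
    (h0 : 0 < t1) (h1 : t1 < Tm) (K0 : 0 ≤ K) (hK : ∀ t ∈ Ioo t1 Tm, ∀ x ∈ Ioo 0 (s t), |deriv (u t) x| ≤ K) :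
    ∃ T, Tm < T ∧ ∃ O w, IsSolOn p s₀ φ T O w := by
  have sp : ∀ t ∈ Ioo 0 Tm, 0 < s t := fun t ht => (h t ht.1 ht.2).s_pos t ⟨ht.1.le, le_rfl⟩
  have hC : ∀ T, t1 < T → T < Tm → ClS p (t1 / 2) T s u := fun T hT hT' => (h T (h0.trans hT) hT').toCl (half_pos h0) lnn le_rfl
  have ce : ∀ {t T}, t1 ≤ t → t ≤ T → cl (t1 / 2) T t = t := fun {t T} a b => cl_eq ⟨by linarith, b⟩
  have hX : ∀ t ∈ Ioo t1 Tm, ∀ T, t ≤ T → ∀ x ∈ Ioo 0 (s (cl (t1 / 2) T t)), |xc s u (cl (t1 / 2) T t) x| ≤ K := fun t ht T hT x hx => by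
    rw [ce ht.1.le hT] at hx ⊢
    rw [xc, min_eq_left hx.2.le, max_eq_right hx.1.le]
    exact hK t ht x hx
  have hB : ∀ t ∈ Ioo t1 Tm, deriv s t ≤ K ∧ uc s u t 0 ^ p ≤ K ∧ s t1 ≤ s t := fun t ht => by
    obtain ⟨T, hT, hT'⟩ := exists_between ht.2
    have H := hC T (ht.1.trans hT) hT'
    have := H.bdy (hX t ht T hT.le)
    have sm := H.Smono (t := t1) (t' := t) ⟨by linarith, by linarith [ht.1]⟩ ⟨by linarith [ht.1], hT⟩ ht.1.le
    simp only [ce ht.1.le hT.le, ce le_rfl (ht.1.trans hT).le] at this sm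
    exact ⟨this.1, this.2, sm⟩
  have s1 := sp t1 ⟨h0, h1⟩
  obtain ⟨R, A, hS⟩ := Sm.ex (η := s t1 / 2) (K := K) (M := 1 + K) hp (half_pos s1) K0 lnn
  have KR : K ≤ R := by linarith [hS.RK]
  have A0 := hS.A0
  obtain ⟨t0, h2, h3⟩ := exists_between (show max t1 (Tm - A) < Tm from max_lt h1 lnn)
  obtain ⟨h2, h4⟩ := max_lt_iff.1 h2
  have m0 : t0 ∈ Ioo t1 Tm := ⟨h2, h3⟩
  have hb : 2 * (s t1 / 2) ≤ s t0 := by linarith [(hB t0 m0).2.2]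
  obtain ⟨Ti, i1, i2⟩ := exists_between h3
  have Hi := hC Ti (h2.trans i1) i2
  have hψ := Hi.lip K0 (hX t0 m0 Ti i1.le)
  have he := Hi.Ue t0
  have hn := Hi.U0 t0
  simp only [ce h2.le i1.le] at hψ he hn
  have hM : |uc s u t0 0| ≤ 1 + K := by
    rw [abs_of_nonneg (hn 0)]
    by_contra! c
    have := self_le_rpow_of_one_le (x := uc s u t0 0) (y := p) lnn hp.le
    linarith [(hB t0 m0).2.1]
  obtain ⟨g, v, F⟩ := hS.exi hb hψ hM
  have ov : ∀ t ∈ Ioo t0 Tm, s t = pth (s t0) v (t - t0) ∧ deriv s t = v (t - t0) ∧ ∀ x, uc s u t x = NN (uc s u t0) (s t0) g v (t - t0) x := fun t ht => by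
    obtain ⟨T, hT, hT'⟩ := exists_between ht.2
    obtain ⟨T1, hT1, hT1'⟩ := exists_between hT
    have H := hC T ((h2.trans ht.1).trans hT) hT'
    have e0 : cl (t1 / 2) T t0 = t0 := ce h2.le (ht.1.trans hT).le
    have et : cl (t1 / 2) T (t0 + (t - t0)) = t := by rw [add_sub_cancel]; exact ce (h2.trans ht.1).le hT.le
    have bb : ∀ j ∈ Ioo 0 (T1 - t0), t0 + j ∈ Ioo t1 Tm ∧ cl (t1 / 2) T (t0 + j) = t0 + j := fun j hj =>
      ⟨⟨by linarith [hj.1], by linarith [hj.2]⟩, ce (by linarith [hj.1]) (by linarith [hj.2])⟩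
    have o := H.ov hp (t0 := t0) (A := T1 - t0) (g := g) (v := v) hS lnn (by linarith [ht.1]) ⟨by linarith, by linarith [ht.1]⟩ lnn (by simpa only [e0] using hb)
      (by simpa only [e0] using hψ) (by simpa only [e0] using hM)
      (fun j hj => by simp only [(bb j hj).2]; exact (hB _ (bb j hj).1).1.trans KR)
      (fun j hj => by simp only [(bb j hj).2]; exact (hB _ (bb j hj).1).2.1.trans KR) (by simpa only [e0] using F) (r := t - t0) ⟨by linarith [ht.1], by linarith⟩
    simpa only [e0, et] using o
  have Ho : ∀ t ∈ Ioo 0 Tm, Sat p s (deriv s) u (fun t => deriv (u t)) t := fun t ht => by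
    obtain ⟨T, hT, hT'⟩ := exists_between ht.2
    exact (h T (ht.1.trans hT) hT').sat ⟨ht.1, hT⟩
  have Hn : ∀ t ∈ Ioo t0 (t0 + A), Sat p (fun t => pth (s t0) v (t - t0)) (fun t => v (t - t0)) (fun t => NN (uc s u t0) (s t0) g v (t - t0))
      (fun t => N1i (uc s u t0) (s t0) g v (t - t0)) t := fun t ht =>
    Sat.shift (Fx.sat hS hb hψ F he hn ⟨by linarith [ht.1], by linarith [ht.2]⟩)
  have oU : ∀ t ∈ Ioo t0 Tm, ∀ x ∈ Icc 0 (s t), NN (uc s u t0) (s t0) g v (t - t0) x = u t x := fun t ht x hx => by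
    rw [← (ov t ht).2.2 x, uc_in hx]
  have oX : ∀ t ∈ Ioo t0 Tm, ∀ x ∈ Icc 0 (s t), N1i (uc s u t0) (s t0) g v (t - t0) x = deriv (u t) x := fun t ht =>
    (Ho t ⟨by linarith [ht.1], ht.2⟩).xeq (Hn t ⟨ht.1, by linarith [ht.2]⟩) (ov t ht).1.symm (ov t ht).2.1.symm (oU t ht)
  obtain ⟨t2, h5, h6⟩ := exists_between h3
  obtain ⟨T, h7, h8⟩ := exists_between (show Tm < t0 + A by linarith)
  refine ⟨T, h7, _, _, toSol (ε := t2) (S := fun t => if t < t2 then s t else pth (s t0) v (t - t0)) (V := fun t => if t < t2 then deriv s t else v (t - t0))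
    (U := fun t => if t < t2 then u t else NN (uc s u t0) (s t0) g v (t - t0))
    (X := fun t => if t < t2 then deriv (u t) else N1i (uc s u t0) (s t0) g v (t - t0)) lnn (fun t ht => ?_)
    (h t2 lnn h6) (fun t ht => if_pos ht.2) (fun t ht => if_pos ht.2)⟩
  by_cases c : t < t2
  · refine (Ho t ⟨ht.1, c.trans h6⟩).congr ?_
    filter_upwards [Iio_mem_nhds c] with j (hj : j < t2)
    simp only [if_pos hj, implies_true, and_self]
  · push Not at c
    refine (Hn t ⟨by linarith, by linarith [ht.2]⟩).congr ?_
    filter_upwards [Ioi_mem_nhds (show t0 < t by linarith)] with j (hj : t0 < j)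
    by_cases d : j < t2
    · have m : j ∈ Ioo t0 Tm := ⟨hj, d.trans h6⟩
      simp only [if_pos d]
      refine ⟨(ov j m).1, (ov j m).2.1, fun x hx => ?_⟩
      rw [← (ov j m).1] at hx
      exact ⟨(oU j m x hx).symm, (oX j m x hx).symm⟩
    · simp only [if_neg d, implies_true, and_self]

theorem stmt_17 (p : ℝ) (hp : 1 < p) (s₀ : ℝ) (φ : ℝ → ℝ) (hW : memW s₀ φ)
    (s : ℝ → ℝ) (u : ℝ → ℝ → ℝ) (Tm : ℝ≥0∞)
    (hmax : IsMaxSol p s₀ φ Tm s u) (hfin : Tm ≠ ⊤) :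
    Tendsto (fun t => energy p s u t) (𝓝[<] Tm.toReal) atBot := by
  obtain ⟨p0, h, hm⟩ := hmax
  have T0 := ENNReal.toReal_pos p0.ne' hfin
  have h' : ∀ T, 0 < T → T < Tm.toReal → IsSolOn p s₀ φ T s u := fun T hT hT' => h T hT ((ENNReal.ofReal_lt_iff_lt_toReal hT.le hfin).2 hT')
  rw [tendsto_atBot]
  by_contra! c
  obtain ⟨C, hC⟩ := c
  have e : ∀ t ∈ Ico (Tm.toReal / 2) Tm.toReal, -(-C) ≤ energy p s u t := fun t ht => by
    by_contra! c
    apply hC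
    filter_upwards [Ioo_mem_nhdsLT ht.2] with τ hτ
    linarith [en_anti hp h' (by linarith [ht.1] : 0 < t) hτ.1.le hτ.2]
  obtain ⟨K, K0, hK⟩ := apriori hp h' (half_pos T0) (half_lt_self T0) e
  obtain ⟨T, hT, hs⟩ := extend hp h' (half_pos T0) (half_lt_self T0) K0 hK
  exact hm T ((ENNReal.lt_ofReal_iff_toReal_lt hfin).2 hT) hs
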